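/- arXiv:0904.1421 — 4 statements merged into one kernel-verified Lean document; each statement's English description precedes it below -/
import Mathlib

section
/- The subgroup N is a free group; moreover, there exists a section s : π → F of the quotient map p (i.e. p(s(g)) = g for all g ∈ π) such that the family (s(g)·B·s(g)⁻¹) indexed by g ∈ π is a free basis of the group N. (Proposition 4.1, first part — Cohen–Lyndon-type basis.) -/
/-! The normal closure of a nontrivial element `B` of a free group which is not a proper power is
freely generated by conjugates of `B`. The proof follows Magnus' method: the free group on `E` and an additional
letter is an HNN extension of a free group in which the lift of `B` has more letters than `B`, and
the claim passes along HNN extensions in both directions.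
-/

open Subgroup

/-- `G` is generated by the image of `A` and an element `t` with `t * ι (i c) = ι (j c) * t`, and is
universal with this property: `G` is the HNN extension of `A` along `i, j : C →* A`. -/
structure IsHNN {A C G : Type} [Group A] [Group C] [Group G] (i j : C →* A) (ι : A →* G) (t : G) :
    Prop where
  rel : ∀ c, t * ι (i c) = ι (j c) * t
  gen : closure (insert t (Set.range ι)) = ⊤
  lift : ∀ (W : Type) [Group W] (α : A →* W) (τ : W), (∀ c, τ * α (i c) = α (j c) * τ) →
    ∃ β : G →* W, (∀ a, β (ι a) = α a) ∧ β t = τ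

/-- The normal closure `M` of `ι N` in `G` is the free product of the conjugates
`(s l)⁻¹ * ι N * s l`, where `s` is a transversal for `ι A \ G / M`. -/
structure KernelSplitting {A G : Type} [Group A] [Group G] (ι : A →* G) (N : Subgroup A) where
  /-- The index set of the transversal. -/
  Index : Type
  /-- The index of the trivial coset. -/
  base : Index
  /-- The transversal. -/
  s : Index → G
  s_base : s base = 1
  exists_rep : ∀ x, ∃ a l, ∃ m ∈ normalClosure (ι '' N), x = ι a * s l * m
  rep_unique : ∀ a l a' l', ∀ m ∈ normalClosure (ι '' N), ι a * s l * m = ι a' * s l' →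
    l = l' ∧ a⁻¹ * a' ∈ N
  le_closure : normalClosure (ι '' N) ≤
    closure {x | ∃ l, ∃ n ∈ N, x = (s l)⁻¹ * ι n * s l}
  conj_mem : ∀ l, ∀ n ∈ N, (s l)⁻¹ * ι n * s l ∈ normalClosure (ι '' N)
  lift : ∀ (H : Type) [Group H] (f : Index → N →* H),
    ∃ Ψ : normalClosure (ι '' N) →* H, ∀ l (n : N), Ψ ⟨_, conj_mem l n n.2⟩ = f l n

theorem map_mem_normalClosure {A G : Type} [Group A] [Group G] {ι : A →* G}
    {N : Subgroup A} {n : A} (hn : n ∈ N) (x : G) :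
    x⁻¹ * ι n * x ∈ normalClosure (ι '' (N : Set A)) := by
  simpa using (normalClosure_normal (s := ι '' (N : Set A))).conj_mem (ι n)
    (subset_normalClosure ⟨n, hn, rfl⟩) x⁻¹

namespace IsHNN

open HNNExtension HNNExtension.NormalWord

variable {A C G : Type} [Group A] [Group C] [Group G] {i j : C →* A} {ι : A →* G} {t : G}
  {N : Subgroup A} [N.Normal]

theorem mk_comp_injective (i : C →* A) (hi : ∀ c, i c ∈ N → c = 1) :
    Function.Injective ((QuotientGroup.mk' N).comp i) := by
  refine (injective_iff_map_eq_one _).2 fun c hc => hi c ?_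
  simpa using hc

/-- The isomorphism between the images of `i` and `j` modulo `N`. -/
noncomputable def quotEquiv (hi : ∀ c, i c ∈ N → c = 1) (hj : ∀ c, j c ∈ N → c = 1) :
    ((QuotientGroup.mk' N).comp i).range ≃* ((QuotientGroup.mk' N).comp j).range :=
  (MonoidHom.ofInjective (mk_comp_injective i hi)).symm.trans
    (MonoidHom.ofInjective (mk_comp_injective j hj))

theorem quotEquiv_apply (hi : ∀ c, i c ∈ N → c = 1) (hj : ∀ c, j c ∈ N → c = 1) (c : C) :
    quotEquiv hi hj ⟨(i c : A ⧸ N), c, rfl⟩ = ⟨(j c : A ⧸ N), c, rfl⟩ := by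
  have : (MonoidHom.ofInjective (mk_comp_injective i hi)).symm ⟨(i c : A ⧸ N), c, rfl⟩ = c := by
    rw [MulEquiv.symm_apply_eq]; rfl
  simp only [quotEquiv, MulEquiv.trans_apply, this]
  rfl

/-- The HNN extension of `A ⧸ N` induced by `i` and `j`. -/
abbrev Quot (hi : ∀ c, i c ∈ N → c = 1) (hj : ∀ c, j c ∈ N → c = 1) : Type :=
  HNNExtension (A ⧸ N) _ _ (quotEquiv hi hj)

section NormalForm

variable {K : Type} [Group K] {U V : Subgroup K} {φ : U ≃* V} (d : TransversalPair K U V)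

/-- The head of the normal form. -/
noncomputable def hd (y : HNNExtension K U V φ) : K := (NormalWord.equiv φ d y).head

/-- The tail of the normal form. -/
noncomputable def tl (y : HNNExtension K U V φ) : List (ℤˣ × K) := (NormalWord.equiv φ d y).toList

theorem hd_prod (w : NormalWord d) : hd d (w.prod φ) = w.head := by
  rw [hd]; exact congrArg (fun w => w.head) ((NormalWord.equiv φ d).apply_symm_apply w)

theorem tl_prod (w : NormalWord d) : tl d (w.prod φ) = w.toList := by
  rw [tl]; exact congrArg (fun w => w.toList) ((NormalWord.equiv φ d).apply_symm_apply w)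

theorem exists_prod (y : HNNExtension K U V φ) : ∃ w : NormalWord d, w.prod φ = y :=
  (NormalWord.equiv φ d).symm.surjective y

theorem hd_of_mul (a : K) (y : HNNExtension K U V φ) : hd d (of a * y) = a * hd d y := by
  obtain ⟨w, rfl⟩ := exists_prod d y
  rw [← prod_group_smul, hd_prod, hd_prod, group_smul_head]

theorem tl_of_mul (a : K) (y : HNNExtension K U V φ) : tl d (of a * y) = tl d y := by
  obtain ⟨w, rfl⟩ := exists_prod d y
  rw [← prod_group_smul, tl_prod, tl_prod, group_smul_toList]

theorem hd_one : hd d (1 : HNNExtension K U V φ) = 1 := by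
  rw [← prod_empty φ (d := d), hd_prod, empty_head]

theorem tl_one : tl d (1 : HNNExtension K U V φ) = [] := by
  rw [← prod_empty φ (d := d), tl_prod, empty_toList]

end NormalForm

/-- The element of `G` spelled by a list of pairs `(u, g)`, read as `t ^ u * σ g`. -/
def spell {K : Type} (ι : A →* G) (t : G) (σ : K → A) : List (ℤˣ × K) → G
  | [] => 1
  | x :: l => t ^ (x.1 : ℤ) * ι (σ x.2) * spell ι t σ l

section Kernel

variable {hi : ∀ c, i c ∈ N → c = 1} {hj : ∀ c, j c ∈ N → c = 1}
  (d : TransversalPair (A ⧸ N) ((QuotientGroup.mk' N).comp i).range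
    ((QuotientGroup.mk' N).comp j).range)
  {σ : A ⧸ N → A} {q : G →* Quot hi hj}

theorem map_spell (hσ : ∀ a, (σ a : A ⧸ N) = a) (hqι : ∀ a, q (ι a) = of (a : A ⧸ N))
    (hqt : q t = HNNExtension.t) (l : List (ℤˣ × (A ⧸ N))) :
    q (spell ι t σ l) = (l.map fun x => HNNExtension.t ^ (x.1 : ℤ) * of x.2).prod := by
  induction l with
  | nil => simp [spell]
  | cons x l ih => simp [spell, ih, hqι, hqt, hσ]

theorem of_head_mul_map_spell (hσ : ∀ a, (σ a : A ⧸ N) = a)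
    (hqι : ∀ a, q (ι a) = of (a : A ⧸ N)) (hqt : q t = HNNExtension.t) (w : NormalWord d) :
    of w.head * q (spell ι t σ w.toList) = w.prod (quotEquiv hi hj) := by
  rw [map_spell hσ hqι hqt, ReducedWord.prod]

theorem map_spell_eq_prod (hσ : ∀ a, (σ a : A ⧸ N) = a)
    (hqι : ∀ a, q (ι a) = of (a : A ⧸ N)) (hqt : q t = HNNExtension.t) (w : NormalWord d) :
    q (spell ι t σ w.toList) = (w.head⁻¹ • w).prod (quotEquiv hi hj) := by
  rw [prod_group_smul, ← of_head_mul_map_spell d hσ hqι hqt w, map_inv, inv_mul_cancel_left]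

theorem existsUnique_transversal_left (hi : ∀ c, i c ∈ N → c = 1) (a : A ⧸ N) :
    ∃! c, ((i c : A ⧸ N))⁻¹ * a ∈ d.set 1 := by
  have h : IsComplement (((QuotientGroup.mk' N).comp i).range : Set (A ⧸ N)) (d.set 1) := d.compl 1
  obtain ⟨⟨⟨_, c, rfl⟩, x⟩, hx, hu⟩ := h.existsUnique a
  refine ⟨c, ?_, fun c' hc' => ?_⟩
  · have : ((i c : A ⧸ N))⁻¹ * a = x := by rw [inv_mul_eq_iff_eq_mul]; exact hx.symm
    simpa only [this] using x.2
  · have := hu ⟨⟨(i c' : A ⧸ N), c', rfl⟩, ⟨_, hc'⟩⟩ (by simp)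
    exact mk_comp_injective (N := N) i hi (congrArg (fun z => (z.1 : A ⧸ N)) this)

theorem exists_transversal (u : ℤˣ) (a : A ⧸ N) :
    ∃ c, ((if u = 1 then i c else j c : A) : A ⧸ N)⁻¹ * a ∈ d.set u := by
  obtain ⟨⟨⟨x, hx⟩, y⟩, hxy, -⟩ := (d.compl u).existsUnique a
  have key : ∀ b : A, (b : A ⧸ N) = x → (b : A ⧸ N)⁻¹ * a ∈ d.set u := by
    rintro b rfl
    have : (b : A ⧸ N)⁻¹ * a = y := by rw [inv_mul_eq_iff_eq_mul]; exact hxy.symm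
    simpa only [this] using y.2
  rcases Int.units_eq_one_or u with rfl | rfl
  · obtain ⟨c, hc⟩ := hx
    exact ⟨c, key _ (by simpa using hc)⟩
  · obtain ⟨c, hc⟩ := hx
    exact ⟨c, key _ (by simpa using hc)⟩

end Kernel

/-- The cocycle on `A` prescribed by homomorphisms on the conjugates of `N`. -/
noncomputable def cocycle {hi : ∀ c, i c ∈ N → c = 1} {hj : ∀ c, j c ∈ N → c = 1}
    (d : TransversalPair (A ⧸ N) ((QuotientGroup.mk' N).comp i).range
      ((QuotientGroup.mk' N).comp j).range)
    {σ : A ⧸ N → A} (hσ : ∀ a, (σ a : A ⧸ N) = a) {H : Type} [Group H]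
    (f : List (ℤˣ × (A ⧸ N)) → N →* H) (a : A) (y : Quot hi hj) : H :=
  f (tl d y) ⟨(σ (a * hd d y))⁻¹ * a * σ (hd d y), by
    rw [← QuotientGroup.eq_one_iff]; simp [hσ]⟩

section Cocycle

variable {hi : ∀ c, i c ∈ N → c = 1} {hj : ∀ c, j c ∈ N → c = 1}
  (d : TransversalPair (A ⧸ N) ((QuotientGroup.mk' N).comp i).range
    ((QuotientGroup.mk' N).comp j).range)
  {σ : A ⧸ N → A} (hσ : ∀ a, (σ a : A ⧸ N) = a) {H : Type} [Group H]
  (f : List (ℤˣ × (A ⧸ N)) → N →* H)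

theorem cocycle_mul (a b : A) (y : Quot hi hj) :
    cocycle d hσ f (a * b) y =
      cocycle d hσ f a (of (b : A ⧸ N) * y) * cocycle d hσ f b y := by
  simp only [cocycle, tl_of_mul, ← map_mul]
  congr 1
  ext
  simp [hd_of_mul, mul_assoc]

theorem cocycle_one (y : Quot hi hj) : cocycle d hσ f 1 y = 1 := by
  have := cocycle_mul d hσ f 1 1 y
  simpa using this

/-- The homomorphism from `A` to the wreath product given by `cocycle`. -/
noncomputable def cocycleHom : A →* RegularWreathProduct H (Quot hi hj) where
  toFun a := ⟨fun z => cocycle d hσ f a ((of (a : A ⧸ N))⁻¹ * z), of (a : A ⧸ N)⟩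
  map_one' := by ext <;> simp [cocycle_one]
  map_mul' a b := by
    ext
    · simp [cocycle_mul, mul_assoc]
    · simp

theorem exists_hom (hG : IsHNN i j ι t)
    (q : G →* Quot hi hj) (hqι : ∀ a, q (ι a) = of (a : A ⧸ N)) (hqt : q t = HNNExtension.t) :
    ∃ β : G →* RegularWreathProduct H (Quot hi hj), (∀ x, (β x).right = q x) ∧
      (∀ a y, (β (ι a)).left (of (a : A ⧸ N) * y) = cocycle d hσ f a y) ∧
      ∀ y, hd d y ∈ d.set 1 → (β t).left (HNNExtension.t * y) = 1 := by
  choose c hc hcu using existsUnique_transversal_left (j := j) d hi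
  have hc_mul : ∀ (x : C) (a : A ⧸ N), c ((i x : A ⧸ N) * a) = x * c a := fun x a =>
    (hcu _ _ (by simpa [mul_assoc] using hc a)).symm
  have hc_one : ∀ a ∈ d.set 1, c a = 1 := fun a ha => (hcu _ _ (by simpa using ha)).symm
  have htc : ∀ (x : C) (y : Quot hi hj), HNNExtension.t * (of (i x : A ⧸ N) * y) =
      of (j x : A ⧸ N) * (HNNExtension.t * y) := fun x y => by
    have := t_mul_of (φ := quotEquiv hi hj) ⟨(i x : A ⧸ N), x, rfl⟩
    rw [quotEquiv_apply] at this
    rw [← mul_assoc, this, mul_assoc]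
  let r : Quot hi hj → Quot hi hj := fun y => (of (i (c (hd d y)) : A ⧸ N))⁻¹ * y
  let Θ : Quot hi hj → H := fun y =>
    cocycle d hσ f (j (c (hd d y))) (HNNExtension.t * r y) *
      (cocycle d hσ f (i (c (hd d y))) (r y))⁻¹
  have hr : ∀ (x : C) y, r (of (i x : A ⧸ N) * y) = r y := fun x y => by
    simp [r, hd_of_mul, hc_mul, mul_assoc]
  have hΘ : ∀ (x : C) y, Θ (of (i x : A ⧸ N) * y) * cocycle d hσ f (i x) y =
      cocycle d hσ f (j x) (HNNExtension.t * y) * Θ y := fun x y => by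
    have e1 : of (i (c (hd d y)) : A ⧸ N) * r y = y := by simp [r]
    have e2 : of (j (c (hd d y)) : A ⧸ N) * (HNNExtension.t * r y) = HNNExtension.t * y := by
      rw [← htc, e1]
    simp only [Θ, hr, hd_of_mul, hc_mul, map_mul, cocycle_mul, e1, e2]
    group
  let τ : RegularWreathProduct H (Quot hi hj) :=
    ⟨fun z => Θ (HNNExtension.t⁻¹ * z), HNNExtension.t⟩
  obtain ⟨β, hβ, hβt⟩ := hG.lift _ (cocycleHom d hσ f) τ fun x => by
    ext z
    · obtain ⟨y, rfl⟩ : ∃ y, z = HNNExtension.t * (of (i x : A ⧸ N) * y) :=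
        ⟨(of (i x : A ⧸ N))⁻¹ * (HNNExtension.t⁻¹ * z), by simp⟩
      have := hΘ x y
      simp only [cocycleHom, τ, RegularWreathProduct.mul_left, Pi.mul_apply, MonoidHom.coe_mk,
        OneHom.coe_mk, inv_mul_cancel_left]
      rw [htc]
      simpa using this
    · simpa [cocycleHom, τ] using htc x 1
  refine ⟨β, ?_, fun a y => by simp [hβ, cocycleHom], fun y hy => ?_⟩
  · have : (RegularWreathProduct.rightHom).comp β = q := by
      refine MonoidHom.eq_of_eqOn_dense hG.gen ?_
      rintro x (rfl | ⟨a, rfl⟩)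
      · simp [hβt, τ, hqt]
      · simp [hβ, cocycleHom, hqι]
    intro x
    exact DFunLike.congr_fun this x
  · simp [hβt, τ, Θ, hc_one _ hy, cocycle_one]

theorem left_mul_apply {Q : Type} [Group Q] {q : G →* Q} {β : G →* RegularWreathProduct H Q}
    (hβ : ∀ x, (β x).right = q x) (x x' : G) (y : Q) :
    (β (x * x')).left (q (x * x') * y) =
      (β x).left (q x * (q x' * y)) * (β x').left (q x' * y) := by
  simp [hβ, mul_assoc]

theorem left_spell (hd1 : ∀ u, 1 ∈ d.set u) (hσ1 : σ 1 = 1)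
    {q : G →* Quot hi hj} (hqι : ∀ a, q (ι a) = of (a : A ⧸ N)) (hqt : q t = HNNExtension.t)
    {β : G →* RegularWreathProduct H (Quot hi hj)} (hβ : ∀ x, (β x).right = q x)
    (hβι : ∀ a y, (β (ι a)).left (of (a : A ⧸ N) * y) = cocycle d hσ f a y)
    (hβt : ∀ y, hd d y ∈ d.set 1 → (β t).left (HNNExtension.t * y) = 1)
    (w : NormalWord d) : (β (spell ι t σ w.toList)).left (q (spell ι t σ w.toList)) = 1 := by
  induction w using consRecOn with
  | ofGroup g => simp [spell]
  | cons g u w h1 h2 ih =>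
    set s := spell ι t σ w.toList with hs
    have hhd : hd d (q s) = 1 := by
      rw [hs, map_spell_eq_prod d hσ hqι hqt, hd_prod]; simp
    have hw : of w.head * q s = w.prod (quotEquiv hi hj) := of_head_mul_map_spell d hσ hqι hqt w
    have key : (β (t ^ (u : ℤ))).left (q (t ^ (u : ℤ)) * w.prod (quotEquiv hi hj)) = 1 := by
      rcases Int.units_eq_one_or u with rfl | rfl
      · simpa [hqt] using hβt _ (by rwa [hd_prod])
      · have hv : (NormalWord.cons 1 (-1) w h1 h2).prod (quotEquiv hi hj) =
            HNNExtension.t⁻¹ * w.prod (quotEquiv hi hj) := by simp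
        have := hβt ((NormalWord.cons 1 (-1) w h1 h2).prod (quotEquiv hi hj))
          (by rw [hd_prod]; exact hd1 1)
        rw [hv, mul_inv_cancel_left] at this
        simp [hqt, hβ, this]
    have hcons : spell ι t σ (NormalWord.cons g u w h1 h2).toList =
        t ^ (u : ℤ) * (ι (σ w.head) * s) := by simp [spell, mul_assoc, hs]
    have e1 : q (ι (σ w.head) * s) = w.prod (quotEquiv hi hj) := by rw [map_mul, hqι, hσ, hw]
    rw [hcons, ← mul_one (q _), left_mul_apply hβ, left_mul_apply hβ, mul_one, mul_one, e1, key,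
      ih, one_mul, mul_one, hqι, hβι, cocycle]
    convert map_one (f (tl d (q s)))
    simp [hhd, hσ1, hσ]

end Cocycle

theorem t_zpow_mul (hG : IsHNN i j ι t) (u : ℤˣ) (c : C) :
    t ^ (u : ℤ) * ι (if u = 1 then i c else j c) =
      ι (if u = 1 then j c else i c) * t ^ (u : ℤ) := by
  rcases Int.units_eq_one_or u with rfl | rfl
  · simp [hG.rel]
  · have := hG.rel c
    simp only [Units.val_neg, Units.val_one, zpow_neg, zpow_one, inv_mul_eq_iff_eq_mul]
    simp [← mul_assoc, hG.rel]

theorem exists_rep (hG : IsHNN i j ι t)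
    (d : TransversalPair (A ⧸ N) ((QuotientGroup.mk' N).comp i).range
      ((QuotientGroup.mk' N).comp j).range) (hd1 : ∀ u, 1 ∈ d.set u)
    {σ : A ⧸ N → A} (hσ : ∀ a, (σ a : A ⧸ N) = a) (hσ1 : σ 1 = 1) (x : G) :
    ∃ (a : A) (w : NormalWord d), ∃ m ∈ closure {x | ∃ w : NormalWord d, ∃ n ∈ N,
      x = (spell ι t σ w.toList)⁻¹ * ι n * spell ι t σ w.toList},
      x = ι a * spell ι t σ w.toList * m := by
  set M := closure {x | ∃ w : NormalWord d, ∃ n ∈ N,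
      x = (spell ι t σ w.toList)⁻¹ * ι n * spell ι t σ w.toList} with hM
  let P : G → Prop := fun x => ∃ (a : A) (w : NormalWord d), ∃ m ∈ M,
    x = ι a * spell ι t σ w.toList * m
  have hA : ∀ b x, P x → P (ι b * x) := by
    rintro b _ ⟨a, w, m, hm, rfl⟩
    exact ⟨b * a, w, m, hm, by simp [mul_assoc]⟩
  have hcancel : ∀ (w : NormalWord d), ∀ m ∈ M, ∀ u : ℤˣ, ∀ u' ∈ Option.map Prod.fst w.toList.head?,
      u ≠ u' → P (t ^ (u : ℤ) * spell ι t σ w.toList * m) := by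
    intro w m hm u u' hu' hne
    induction w using consRecOn with
    | ofGroup g => simp at hu'
    | cons g v w h1 h2 _ =>
      obtain rfl : v = u' := by simpa using hu'
      obtain rfl := Int.units_ne_iff_eq_neg.1 hne
      exact ⟨σ w.head, w, m, hm, by simp [spell, mul_assoc]⟩
  have ht : ∀ (u : ℤˣ) x, P x → P (t ^ (u : ℤ) * x) := by
    rintro u _ ⟨a, w, m, hm, rfl⟩
    obtain ⟨c, hc⟩ := exists_transversal d u (a : A ⧸ N)
    set b : A := if u = 1 then i c else j c with hb
    set τ : A ⧸ N := (b : A ⧸ N)⁻¹ * a with hτ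
    obtain ⟨n, hn, hna⟩ : ∃ n ∈ N, b⁻¹ * a = σ τ * n :=
      ⟨(σ τ)⁻¹ * (b⁻¹ * a), by rw [← QuotientGroup.eq_one_iff]; simp [hσ, hτ], by simp⟩
    have ha : a = b * (σ τ * n) := by rw [← hna, mul_inv_cancel_left]
    have hm' : (spell ι t σ w.toList)⁻¹ * ι n * spell ι t σ w.toList * m ∈ M :=
      mul_mem (subset_closure ⟨w, n, hn, rfl⟩) hm
    have hx : t ^ (u : ℤ) * (ι a * spell ι t σ w.toList * m) =
        ι (if u = 1 then j c else i c) * (t ^ (u : ℤ) * ι (σ τ) * spell ι t σ w.toList *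
          ((spell ι t σ w.toList)⁻¹ * ι n * spell ι t σ w.toList * m)) := by
      rw [ha]
      simp only [map_mul, mul_assoc, mul_inv_cancel_left]
      simp only [← mul_assoc, hb, t_zpow_mul hG]
    rw [hx]
    refine hA _ _ ?_
    by_cases hcan : ∀ u' ∈ Option.map Prod.fst w.toList.head?,
        τ ∈ toSubgroup ((QuotientGroup.mk' N).comp i).range
          ((QuotientGroup.mk' N).comp j).range u → u = u'
    · refine ⟨1, NormalWord.cons 1 u ((τ * w.head⁻¹) • w) (by simpa using hc) (by simpa using hcan),
        _, hm', ?_⟩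
      simp [spell]
    · push Not at hcan
      obtain ⟨u', hu', hmem, hne⟩ := hcan
      have hτ1 : τ = 1 := by
        have := (d.compl u).existsUnique τ
        have := this.unique (y₁ := ⟨⟨τ, hmem⟩, ⟨1, hd1 u⟩⟩) (y₂ := ⟨1, ⟨τ, hc⟩⟩) (by simp) (by simp)
        simpa using congrArg (fun z => (z.1 : A ⧸ N)) this
      rw [hτ1, hσ1, map_one, mul_one]
      exact hcancel w _ hm' u u' hu' hne
  have hmem : ∀ x ∈ closure (insert t (Set.range ι)), ∀ y, P y → P (x * y) := by
    intro x hx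
    induction hx using closure_induction'' with
    | mem x hx =>
      rcases hx with rfl | ⟨a, rfl⟩
      · simpa using ht 1
      · exact hA a
    | inv_mem x hx =>
      rcases hx with rfl | ⟨a, rfl⟩
      · simpa using ht (-1)
      · simpa using hA a⁻¹
    | one => simp
    | mul x y _ _ hx hy => exact fun z hz => by rw [mul_assoc]; exact hx _ (hy _ hz)
  have := hmem x (hG.gen ▸ mem_top x) 1 ⟨1, NormalWord.empty, 1, one_mem _, by simp [spell]⟩
  simpa using this


theorem nonempty_kernelSplitting (hG : IsHNN i j ι t) (hi : ∀ c, i c ∈ N → c = 1)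
    (hj : ∀ c, j c ∈ N → c = 1) : Nonempty (KernelSplitting ι N) := by
  obtain ⟨q, hqι, hqt⟩ : ∃ q : G →* Quot hi hj,
      (∀ a, q (ι a) = of (a : A ⧸ N)) ∧ q t = HNNExtension.t := by
    refine hG.lift _ (of.comp (QuotientGroup.mk' N)) HNNExtension.t fun c => ?_
    have := t_mul_of (φ := quotEquiv hi hj) ⟨(i c : A ⧸ N), c, rfl⟩
    rwa [quotEquiv_apply] at this
  obtain ⟨d, hd1⟩ : ∃ d : TransversalPair (A ⧸ N) ((QuotientGroup.mk' N).comp i).range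
      ((QuotientGroup.mk' N).comp j).range, ∀ u, 1 ∈ d.set u := by
    choose S hS hS1 using fun u => (toSubgroup ((QuotientGroup.mk' N).comp i).range
      ((QuotientGroup.mk' N).comp j).range u).exists_isComplement_right 1
    exact ⟨⟨S, hS⟩, hS1⟩
  obtain ⟨σ, hσ, hσ1⟩ : ∃ σ : A ⧸ N → A, (∀ a, (σ a : A ⧸ N) = a) ∧ σ 1 = 1 := by
    classical
    refine ⟨Function.update Quotient.out 1 1, fun a => ?_, by simp⟩
    rcases eq_or_ne a 1 with rfl | ha <;> simp [*]
  have hker : normalClosure (ι '' (N : Set A)) ≤ q.ker := by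
    refine normalClosure_le_normal ?_
    rintro _ ⟨n, hn, rfl⟩
    simp [hqι, (QuotientGroup.eq_one_iff n).2 hn]
  have htl : ∀ (a : A) (w : NormalWord d), tl d (q (ι a * spell ι t σ w.toList)) = w.toList := by
    intro a w
    rw [map_mul, hqι, tl_of_mul, map_spell_eq_prod d hσ hqι hqt, tl_prod, group_smul_toList]
  have hhd : ∀ (a : A) (w : NormalWord d), hd d (q (ι a * spell ι t σ w.toList)) = a := by
    intro a w
    rw [map_mul, hqι, hd_of_mul, map_spell_eq_prod d hσ hqι hqt, hd_prod]
    simp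
  have hle : closure {x | ∃ w : NormalWord d, ∃ n ∈ N,
      x = (spell ι t σ w.toList)⁻¹ * ι n * spell ι t σ w.toList} ≤
      normalClosure (ι '' (N : Set A)) := by
    rw [closure_le]
    rintro _ ⟨w, n, hn, rfl⟩
    exact map_mem_normalClosure hn _
  refine ⟨
    { Index := {l // ∃ w : NormalWord d, w.toList = l}
      base := ⟨[], NormalWord.empty, rfl⟩
      s := fun l => spell ι t σ l
      s_base := rfl
      exists_rep := fun x => ?_
      rep_unique := ?_
      le_closure := fun x hx => ?_
      conj_mem := fun l n hn => map_mem_normalClosure hn _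
      lift := fun H _ f => ?_ }⟩
  · obtain ⟨a, w, m, hm, rfl⟩ := exists_rep hG d hd1 hσ hσ1 x
    exact ⟨a, ⟨_, w, rfl⟩, m, hle hm, rfl⟩
  · rintro a ⟨_, w, rfl⟩ a' ⟨_, w', rfl⟩ m hm h
    have hq := congrArg q h
    rw [map_mul, (hker hm : q m = 1), mul_one] at hq
    have h1 := congrArg (tl d) hq
    have h2 := congrArg (hd d) hq
    rw [htl, htl] at h1
    rw [hhd, hhd] at h2
    exact ⟨Subtype.ext h1, QuotientGroup.eq.1 h2⟩
  · obtain ⟨a, w, m, hm, rfl⟩ := exists_rep hG d hd1 hσ hσ1 x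
    have hq : q (ι a * spell ι t σ w.toList) = 1 := by
      have h := hker hx
      rwa [MonoidHom.mem_ker, map_mul, (hker (hle hm) : q m = 1), mul_one] at h
    have h1 := htl a w
    have h2 := hhd a w
    rw [hq, tl_one] at h1
    rw [hq, hd_one] at h2
    rw [← h1]
    refine mul_mem (subset_closure ⟨⟨[], NormalWord.empty, rfl⟩, a, ?_, ?_⟩)
      (closure_mono ?_ hm)
    · exact (QuotientGroup.eq_one_iff a).1 h2.symm
    · simp [spell]
    · rintro _ ⟨w, n, hn, rfl⟩
      exact ⟨⟨_, w, rfl⟩, n, hn, rfl⟩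
  · classical
    let f' : List (ℤˣ × (A ⧸ N)) → N →* H := fun l =>
      if hl : ∃ w : NormalWord d, w.toList = l then f ⟨l, hl⟩ else 1
    obtain ⟨β, hβ, hβι, hβt⟩ := exists_hom d hσ f' hG q hqι hqt
    refine ⟨
      { toFun := fun n => (β n).left 1
        map_one' := by simp
        map_mul' := fun x y => by
          have := hker x.2
          rw [MonoidHom.mem_ker] at this
          simp [hβ, this] }, ?_⟩
    rintro ⟨_, w, rfl⟩ n
    set s := spell ι t σ w.toList with hs
    have hs1 : (β s).left (q s) = 1 := left_spell d hσ f' hd1 hσ1 hqι hqt hβ hβι hβt w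
    have hqn : q (ι n) = 1 := hker (subset_normalClosure ⟨n, n.2, rfl⟩)
    have h1 := htl 1 w
    have h2 := hhd 1 w
    rw [map_one, one_mul, ← hs] at h1 h2
    have h3 := hβι n (q s)
    rw [(QuotientGroup.eq_one_iff _).2 n.2, map_one, one_mul, cocycle] at h3
    have h4 : f' (tl d (q s)) = f ⟨_, w, rfl⟩ := by
      rw [h1]; exact dif_pos ⟨w, rfl⟩
    have h6 : (β (s⁻¹ * (ι n * s))).left 1 = (β (ι n)).left (q s) := by
      rw [map_mul, map_mul, RegularWreathProduct.mul_left, RegularWreathProduct.mul_left]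
      simp [hqn, hβ, hs1]
    simp only [MonoidHom.coe_mk, OneHom.coe_mk, mul_assoc]
    rw [h6, h3, h4]
    congr 1
    simp [h2, hσ1, (QuotientGroup.eq_one_iff (n : A)).2 n.2]

end IsHNN

/-- The normal closure of `r` is freely generated by conjugates of `r`, one for each element of the
quotient. -/
def CohenLyndon {G : Type} [Group G] (r : G) : Prop :=
  ∃ b : FreeGroupBasis (G ⧸ normalClosure {r}) (normalClosure {r}),
    ∀ g, ∃ x : G, (x : G ⧸ normalClosure {r}) = g ∧ (b g : G) = x * r * x⁻¹

theorem conj_mem_normalClosure_singleton {G : Type} [Group G] (r x : G) :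
    x * r * x⁻¹ ∈ normalClosure {r} :=
  (normalClosure_normal (s := {r})).conj_mem r (subset_normalClosure (Set.mem_singleton r)) x

theorem normalClosure_image_normalClosure {A G : Type} [Group A] [Group G] (ι : A →* G) (r : A) :
    normalClosure (ι '' normalClosure {r}) = normalClosure {ι r} := by
  apply le_antisymm
  · refine normalClosure_le_normal ?_
    rw [Set.image_subset_iff]
    refine normalClosure_le_normal (N := (normalClosure {ι r}).comap ι) ?_
    simpa using subset_normalClosure (s := {ι r}) rfl
  · refine normalClosure_mono ?_
    simpa using ⟨r, subset_normalClosure rfl, rfl⟩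

theorem KernelSplitting.exists_lift {A G H : Type} [Group A] [Group G] [Group H] {ι : A →* G}
    {r : A} (S : KernelSplitting ι (normalClosure {r})) (f : S.Index → normalClosure {r} →* H) :
    ∃ Ψ : normalClosure {ι r} →* H, ∀ l (n : normalClosure {r}) (x : normalClosure {ι r}),
      (x : G) = (S.s l)⁻¹ * ι n * S.s l → Ψ x = f l n := by
  obtain ⟨Ψ, hΨ⟩ := S.lift H f
  refine ⟨Ψ.comp (inclusion (normalClosure_image_normalClosure ι r).ge), ?_⟩
  rintro l n ⟨x, hx⟩ rfl
  exact hΨ l n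

theorem FreeGroupBasis.closure_range_coe {I G : Type} [Group G] {M : Subgroup G}
    (b : FreeGroupBasis I M) : closure (Set.range fun g => (b g : G)) = M := by
  have h : closure (Set.range b) = ⊤ := by
    have hb : (Set.range b : Set M) = b.repr.symm.toMonoidHom '' Set.range FreeGroup.of := by
      rw [← Set.range_comp]; rfl
    rw [hb, ← MonoidHom.map_closure, FreeGroup.closure_range_of]
    exact map_top_of_surjective _ b.repr.symm.surjective
  have := congrArg (map M.subtype) h
  rwa [MonoidHom.map_closure, ← MonoidHom.range_eq_map, range_subtype, ← Set.range_comp] at this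

theorem exists_hom_coe_eq {A G : Type} [Group A] [Group G] (f : A →* G) {N : Subgroup A}
    {M : Subgroup G} (h : ∀ n ∈ N, f n ∈ M) : ∃ κ : N →* M, ∀ n : N, (κ n : G) = f n :=
  ⟨(f.comp N.subtype).codRestrict M fun n => h n n.2, fun _ => rfl⟩

namespace CohenLyndon

theorem of_hom {G I : Type} [Group G] {r : G} (e : I → G)
    (he : Function.Bijective fun i => (e i : G ⧸ normalClosure {r}))
    (hcl : normalClosure {r} ≤ closure (Set.range fun i => e i * r * (e i)⁻¹))
    (Ψ : normalClosure {r} →* FreeGroup I)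
    (hΨ : ∀ i, Ψ ⟨e i * r * (e i)⁻¹, conj_mem_normalClosure_singleton r _⟩ = FreeGroup.of i) :
    CohenLyndon r := by
  let Φ : FreeGroup I →* normalClosure {r} :=
    FreeGroup.lift fun i => ⟨e i * r * (e i)⁻¹, conj_mem_normalClosure_singleton r _⟩
  have h1 : Ψ.comp Φ = MonoidHom.id _ := by ext i; simp [Φ, hΨ]
  have hsurj : Function.Surjective Φ := by
    intro x
    have hx : closure (Set.range fun i => e i * r * (e i)⁻¹) ≤
        Φ.range.map (normalClosure {r}).subtype := by
      rw [closure_le]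
      rintro _ ⟨i, rfl⟩
      exact ⟨_, ⟨FreeGroup.of i, rfl⟩, by simp [Φ]⟩
    obtain ⟨_, ⟨y, rfl⟩, hy⟩ := hx (hcl x.2)
    exact ⟨y, Subtype.ext hy⟩
  have h2 : Φ.comp Ψ = MonoidHom.id _ := by
    ext x
    obtain ⟨y, rfl⟩ := hsurj x
    simpa using congrArg (fun z => (Φ z : G)) (DFunLike.congr_fun h1 y)
  let b : FreeGroupBasis I (normalClosure {r}) := ⟨Ψ.toMulEquiv Φ h2 h1⟩
  have hb : ∀ i, (b i : G) = e i * r * (e i)⁻¹ := fun i => by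
    have : b i = Φ (FreeGroup.of i) := rfl
    simp [this, Φ]
  refine ⟨b.reindex (Equiv.ofBijective _ he), fun g => ?_⟩
  obtain ⟨i, rfl⟩ := he.2 g
  refine ⟨e i, rfl, ?_⟩
  rw [FreeGroupBasis.reindex_apply, Equiv.ofBijective_symm_apply_apply, hb]

variable {A G : Type} [Group A] [Group G] {ι : A →* G} {r : A}

theorem map (S : KernelSplitting ι (normalClosure {r})) (h : CohenLyndon r) :
    CohenLyndon (ι r) := by
  obtain ⟨b, hb⟩ := h
  choose x hx hbx using hb
  have hM := normalClosure_image_normalClosure ι r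
  have hι : ∀ n ∈ normalClosure {r}, ι n ∈ normalClosure {ι r} := fun n hn =>
    hM ▸ subset_normalClosure ⟨n, hn, rfl⟩
  have hcl : ∀ l, ∀ n ∈ normalClosure {r}, (S.s l)⁻¹ * ι n * S.s l ∈ closure (Set.range
      fun i : (A ⧸ normalClosure {r}) × S.Index =>
        ((S.s i.2)⁻¹ * ι (x i.1)) * ι r * ((S.s i.2)⁻¹ * ι (x i.1))⁻¹) := by
    intro l n hn
    rw [← FreeGroupBasis.closure_range_coe b] at hn
    have : closure (Set.range fun g => (b g : A)) ≤ (closure (Set.range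
      fun i : (A ⧸ normalClosure {r}) × S.Index =>
        ((S.s i.2)⁻¹ * ι (x i.1)) * ι r * ((S.s i.2)⁻¹ * ι (x i.1))⁻¹)).comap
        ((MulAut.conj (S.s l)⁻¹).toMonoidHom.comp ι) := by
      rw [closure_le]
      rintro _ ⟨g, rfl⟩
      exact subset_closure ⟨⟨g, l⟩, by simp [hbx, mul_assoc]⟩
    simpa using this hn
  obtain ⟨Ψ, hΨ⟩ := S.exists_lift fun l => b.lift fun a => FreeGroup.of (a, l)
  refine of_hom (fun i : (A ⧸ normalClosure {r}) × S.Index => (S.s i.2)⁻¹ * ι (x i.1))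
    ⟨?_, ?_⟩ ?_ Ψ ?_
  · rintro ⟨a, l⟩ ⟨a', l'⟩ h
    have h' := congrArg (fun z => z⁻¹) h
    simp only [← QuotientGroup.mk_inv] at h'
    rw [QuotientGroup.eq] at h'
    obtain ⟨rfl, h2⟩ := S.rep_unique (x a)⁻¹ l (x a')⁻¹ l' _ (hM ▸ h') (by simp [mul_assoc])
    have := QuotientGroup.eq.2 h2
    simp only [QuotientGroup.mk_inv, hx, inv_inj] at this
    rw [this]
  · intro g
    obtain ⟨z, rfl⟩ := QuotientGroup.mk_surjective g
    obtain ⟨a, l, m, hm, hz⟩ := S.exists_rep z⁻¹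
    rw [hM] at hm
    refine ⟨⟨(a⁻¹ : A), l⟩, ?_⟩
    have h1 : (ι (x (a⁻¹ : A)) : G ⧸ normalClosure {ι r}) = ι a⁻¹ := by
      rw [QuotientGroup.eq, ← map_inv, ← map_mul]
      exact hι _ (QuotientGroup.eq.1 (hx _))
    rw [← inv_inv z, hz]
    simp only [QuotientGroup.mk_mul, h1]
    simp [(QuotientGroup.eq_one_iff m).2 hm]
  · rw [← hM]
    refine S.le_closure.trans ?_
    rw [closure_le]
    rintro _ ⟨l, n, hn, rfl⟩
    exact hcl l n hn
  · rintro ⟨a, l⟩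
    rw [hΨ l (b a) _ (by simp [hbx, mul_assoc])]
    simp

theorem comap (S : KernelSplitting ι (normalClosure {r})) (h : CohenLyndon (ι r)) :
    CohenLyndon r := by
  obtain ⟨b, hb⟩ := h
  choose y hy hby using hb
  have hM := normalClosure_image_normalClosure ι r
  have hι : ∀ n ∈ normalClosure {r}, ι n ∈ normalClosure {ι r} := fun n hn =>
    hM ▸ subset_normalClosure ⟨n, hn, rfl⟩
  obtain ⟨p, hpι⟩ : ∃ p : A ⧸ normalClosure {r} → G ⧸ normalClosure {ι r},
      ∀ a : A, p a = (ι a : G) := ⟨QuotientGroup.map _ _ ι hι, fun _ => rfl⟩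
  have hp : ∀ a l m, m ∈ normalClosure {ι r} → ∀ a', (ι a * S.s l * m : G) = ι a' →
      l = S.base ∧ (a : A ⧸ normalClosure {r}) = a' := by
    intro a l m hm a' h
    obtain ⟨h1, h2⟩ := S.rep_unique a l a' S.base m (hM ▸ hm) (by simp [h, S.s_base])
    exact ⟨h1, QuotientGroup.eq.2 h2⟩
  classical
  obtain ⟨ρ, hρ⟩ := S.exists_lift fun l => if l = S.base then MonoidHom.id _ else 1
  have hρι : ∀ n (hn : n ∈ normalClosure {r}), ρ ⟨ι n, hι n hn⟩ = ⟨n, hn⟩ := fun n hn => by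
    rw [hρ S.base ⟨n, hn⟩ _ (by simp [S.s_base])]; simp
  have hpinj : Function.Injective p := by
    intro a a' h
    obtain ⟨a, rfl⟩ := QuotientGroup.mk_surjective a
    obtain ⟨a', rfl⟩ := QuotientGroup.mk_surjective a'
    rw [hpι, hpι, QuotientGroup.eq] at h
    exact (hp a S.base _ h a' (by simp [S.s_base])).2
  have hconj : ∀ a : A, a⁻¹ * r * a ∈ normalClosure {r} := fun a => by
    simpa using conj_mem_normalClosure_singleton r a⁻¹
  have hgen : ∀ g, ∃ a l, ∃ m : normalClosure {ι r}, (y g)⁻¹ = ι a * S.s l * m ∧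
      ρ (b g) = (ρ m)⁻¹ * (if l = S.base then ⟨a⁻¹ * r * a, hconj a⟩ else 1) * ρ m := by
    intro g
    obtain ⟨a, l, m, hm, hz⟩ := S.exists_rep (y g)⁻¹
    rw [hM] at hm
    refine ⟨a, l, ⟨m, hm⟩, hz, ?_⟩
    have h1 : (b g : G) = m⁻¹ * ((S.s l)⁻¹ * ι (a⁻¹ * r * a) * S.s l) * m := by
      rw [hby, ← inv_inv (y g), hz]
      simp [mul_assoc]
    have h2 : (S.s l)⁻¹ * ι (a⁻¹ * r * a) * S.s l ∈ normalClosure {ι r} :=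
      hM ▸ S.conj_mem l _ (hconj a)
    have h3 : b g = ⟨m, hm⟩⁻¹ * ⟨_, h2⟩ * ⟨m, hm⟩ := Subtype.ext h1
    rw [h3, map_mul, map_mul, map_inv, hρ l ⟨a⁻¹ * r * a, hconj a⟩ ⟨_, h2⟩ rfl]
    split_ifs <;> simp
  have hbp : ∀ g : A ⧸ normalClosure {r}, ∃ e : A, (e : A ⧸ normalClosure {r}) = g ∧
      (ρ (b (p g)) : A) = e * r * e⁻¹ := by
    intro g
    obtain ⟨a, l, m, hz, hρm⟩ := hgen (p g)
    obtain ⟨a', rfl⟩ := QuotientGroup.mk_surjective g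
    have h1 : ((y (p a'))⁻¹ : G ⧸ normalClosure {ι r}) = (ι a'⁻¹ : G) := by
      rw [hy, map_inv, hpι]; rfl
    rw [← QuotientGroup.mk_inv, QuotientGroup.eq] at h1
    obtain ⟨rfl, h2⟩ := hp a l _ (mul_mem m.2 h1) a'⁻¹ (by rw [← mul_assoc, ← hz]; simp)
    refine ⟨(ρ m : A)⁻¹ * a⁻¹, ?_, by simp [hρm, mul_assoc]⟩
    rw [QuotientGroup.mk_mul, QuotientGroup.mk_inv, QuotientGroup.mk_inv, h2,
      (QuotientGroup.eq_one_iff (ρ m : A)).2 (ρ m).2]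
    simp
  have hbnp : ∀ g, (∀ g', p g' ≠ g) → ρ (b g) = 1 := by
    intro g hg
    obtain ⟨a, l, m, hz, hρm⟩ := hgen g
    rw [hρm, if_neg]
    · simp
    · rintro rfl
      refine hg (a⁻¹ : A) ?_
      rw [hpι, ← hy g, ← inv_inv (y g), hz, S.s_base]
      simp [(QuotientGroup.eq_one_iff (m : G)).2 m.2]
  choose e he heb using hbp
  obtain ⟨Λ, hΛ, hΛ1⟩ : ∃ Λ : normalClosure {ι r} →* FreeGroup (A ⧸ normalClosure {r}),
      (∀ g, Λ (b (p g)) = FreeGroup.of g) ∧ ∀ g, (∀ g', p g' ≠ g) → Λ (b g) = 1 :=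
    ⟨b.lift (Function.extend p FreeGroup.of 1), fun g => by simp [hpinj.extend_apply],
      fun g hg => by simp [Function.extend_apply' _ _ _ (not_exists.2 hg)]⟩
  obtain ⟨κ, hκ⟩ : ∃ κ : normalClosure {r} →* normalClosure {ι r},
      ∀ n : normalClosure {r}, (κ n : G) = ι n := exists_hom_coe_eq ι hι
  have hΛl : ∀ l, l ≠ S.base → ∀ n ∈ normalClosure {r},
      ∀ h : (S.s l)⁻¹ * ι n * S.s l ∈ normalClosure {ι r}, Λ ⟨_, h⟩ = 1 := by
    intro l hl n hn h
    have hle : normalClosure {r} ≤ (Λ.ker.map (normalClosure {ι r}).subtype).comap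
        ((MulAut.conj (S.s l)⁻¹).toMonoidHom.comp ι) := by
      refine (closure_le _).2 fun x hx => ?_
      obtain ⟨r', hr', hc⟩ := Group.mem_conjugatesOfSet_iff.1 hx
      obtain rfl : r = r' := (Set.mem_singleton_iff.1 hr').symm
      obtain ⟨c, rfl⟩ := isConj_iff.1 hc
      set z : G := (S.s l)⁻¹ * ι c with hz
      have hg : ∀ g', p g' ≠ z := by
        intro g' hg'
        obtain ⟨a, rfl⟩ := QuotientGroup.mk_surjective g'
        rw [hpι] at hg'
        have h2 := congrArg (fun x => x⁻¹) hg'.symm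
        simp only [← QuotientGroup.mk_inv] at h2
        rw [QuotientGroup.eq] at h2
        exact hl (hp c⁻¹ l _ h2 a⁻¹ (by simp [hz, mul_assoc])).1
      have hm : z * (y z)⁻¹ ∈ normalClosure {ι r} := by
        rw [← QuotientGroup.eq_one_iff, QuotientGroup.mk_mul, QuotientGroup.mk_inv, hy,
          mul_inv_cancel]
      refine ⟨⟨_, hm⟩ * b z * ⟨_, hm⟩⁻¹, ?_, ?_⟩
      · simp [MonoidHom.mem_ker, hΛ1 _ hg]
      · simp [hby, hz, mul_assoc]
    obtain ⟨x, hx, h'⟩ := hle hn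
    obtain rfl : x = ⟨_, h⟩ := Subtype.ext (by simpa using h')
    exact hx
  have hΛρ : (Λ.comp κ).comp ρ = Λ := by
    have hle : closure {x | ∃ l, ∃ n ∈ normalClosure {r}, x = (S.s l)⁻¹ * ι n * S.s l} ≤
        (((Λ.comp κ).comp ρ).eqLocus Λ).map (normalClosure {ι r}).subtype := by
      rw [closure_le]
      rintro _ ⟨l, n, hn, rfl⟩
      have hmem : (S.s l)⁻¹ * ι n * S.s l ∈ normalClosure {ι r} := hM ▸ S.conj_mem l n hn
      refine ⟨⟨_, hmem⟩, ?_, rfl⟩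
      change Λ (κ (ρ _)) = Λ _
      rw [hρ l ⟨n, hn⟩ _ rfl]
      split_ifs with hl
      · congr 1
        exact Subtype.ext ((hκ _).trans (by simp [hl, S.s_base]))
      · simp only [MonoidHom.one_apply, map_one]
        exact (hΛl l hl n hn hmem).symm
    ext x
    obtain ⟨x', hx', h⟩ := hle (S.le_closure (by rw [hM]; exact x.2))
    rw [← show x' = x from Subtype.ext h]
    exact hx'
  refine of_hom e ⟨fun g g' h => by simpa [he] using h, fun g => ⟨g, he g⟩⟩ ?_ (Λ.comp κ)
    fun g => ?_
  · intro n hn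
    have hle : closure (Set.range fun g => (b g : G)) ≤
        ((closure (Set.range fun i => e i * r * (e i)⁻¹)).comap
          ((normalClosure {r}).subtype.comp ρ)).map (normalClosure {ι r}).subtype := by
      rw [closure_le]
      rintro _ ⟨g, rfl⟩
      refine ⟨b g, ?_, rfl⟩
      by_cases hg : ∃ g', p g' = g
      · obtain ⟨g', rfl⟩ := hg
        exact subset_closure ⟨g', (heb g').symm⟩
      · simp [hbnp g (not_exists.1 hg)]
    rw [FreeGroupBasis.closure_range_coe] at hle
    obtain ⟨x, hx, h⟩ := hle (hι n hn)
    obtain rfl : x = ⟨ι n, hι n hn⟩ := Subtype.ext h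
    simpa [hρι n hn] using hx
  · have : (⟨e g * r * (e g)⁻¹, conj_mem_normalClosure_singleton r _⟩ : normalClosure {r}) =
        ρ (b (p g)) := Subtype.ext (heb g).symm
    rw [this, ← hΛ]
    exact DFunLike.congr_fun hΛρ _

end CohenLyndon

namespace LetterSequence

variable {E : Type} (x : ℕ → E × ℤˣ)

/-- The product of the first `n` letters of `x`. -/
def word (n : ℕ) : FreeGroup E :=
  ((List.range n).map fun j => FreeGroup.of (x j).1 ^ ((x j).2 : ℤ)).prod

theorem word_zero : word x 0 = 1 := rfl

theorem word_succ (n : ℕ) :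
    word x (n + 1) = word x n * FreeGroup.of (x n).1 ^ ((x n).2 : ℤ) := by
  simp [word, List.range_succ]

theorem word_add (m n : ℕ) : word x (m + n) = word x m * word (fun j => x (m + j)) n := by
  induction n with
  | zero => simp [word_zero]
  | succ n ih => rw [← add_assoc, word_succ, ih, word_succ, mul_assoc]

theorem word_mul {d : ℕ} (hd : ∀ j, x (j + d) = x j) (m : ℕ) : word x (m * d) = word x d ^ m := by
  induction m with
  | zero => simp [word_zero]
  | succ m ih =>
    have : (fun j => x (d + j)) = x := funext fun j => by rw [add_comm, hd]
    rw [Nat.succ_mul, add_comm, word_add, this, ih, pow_succ']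

/-- The height of the word of the first `n` letters of `x`, where `e` has height `φ e`. -/
def height (φ : E → ℤ) (n : ℕ) : ℤ := ∑ j ∈ Finset.range n, ((x j).2 : ℤ) * φ (x j).1

theorem height_zero (φ : E → ℤ) : height x φ 0 = 0 := rfl

theorem height_succ (φ : E → ℤ) (n : ℕ) :
    height x φ (n + 1) = height x φ n + ((x n).2 : ℤ) * φ (x n).1 :=
  Finset.sum_range_succ ..

/-- The height of the lower end of the `j`-th letter of `x`. -/
def level (φ : E → ℤ) (j : ℕ) : ℤ :=
  if (x j).2 = 1 then height x φ j else height x φ (j + 1)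

variable {x}

theorem height_add_period {n : ℕ} (hper : ∀ j, x (j + n) = x j) {φ : E → ℤ}
    (hφ : height x φ n = 0) (j : ℕ) : height x φ (j + n) = height x φ j := by
  induction j with
  | zero => simp [hφ, height_zero]
  | succ j ih => rw [add_right_comm, height_succ, ih, height_succ, hper]

theorem level_add_period {n : ℕ} (hper : ∀ j, x (j + n) = x j) {φ : E → ℤ}
    (hφ : height x φ n = 0) (j : ℕ) : level x φ (j + n) = level x φ j := by
  simp only [level, hper, add_right_comm j n 1, height_add_period hper hφ]

theorem level_sub_of_eq {φ : E → ℤ} {i j : ℕ} (h : x i = x j) :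
    level x φ j - level x φ i = height x φ j - height x φ i := by
  simp only [level, height_succ, h]
  split_ifs <;> ring

theorem level_sub_of_ne {φ : E → ℤ} {i j : ℕ} (h : (x i).1 = (x j).1) (h' : (x i).2 ≠ (x j).2) :
    level x φ j - level x φ i = height x φ j - height x φ (i + 1) := by
  simp only [level, height_succ, h]
  rcases Int.units_eq_one_or (x i).2 with hi | hi <;>
  rcases Int.units_eq_one_or (x j).2 with hj | hj <;> simp_all; ring

/-- The height difference along a segment. -/
theorem height_sub_height (φ : E → ℤ) {p q : ℕ} (h : p ≤ q) :
    height x φ q - height x φ p = ∑ l ∈ Finset.Ico p q, ((x l).2 : ℤ) * φ (x l).1 :=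
  (Finset.sum_Ico_eq_sub _ h).symm

/-- All height functions which vanish on the word of the first `n` letters of `x` give occurrences
of the same letter the same level. -/
def NoSplit (x : ℕ → E × ℤˣ) (n : ℕ) : Prop :=
  ∀ φ : E → ℤ, height x φ n = 0 → ∀ i j, (x i).1 = (x j).1 → level x φ i = level x φ j

open Classical in
/-- The exponent sum of `a` in the word of the first `n` letters of `x`. -/
noncomputable def expSum (x : ℕ → E × ℤˣ) (n : ℕ) (a : E) : ℤ := height x (Pi.single a 1) n

open Classical in
theorem height_single_sub {p q : ℕ} (hinj : Set.InjOn (fun l => (x l).1) (Set.Ico p q))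
    {l : ℕ} (hl : l ∈ Set.Ico p q) :
    height x (Pi.single (x l).1 1) q - height x (Pi.single (x l).1 1) p = (x l).2 := by
  rw [height_sub_height _ (hl.1.trans hl.2.le), Finset.sum_eq_single l]
  · simp
  · intro l' hl' hne
    have : (x l').1 ≠ (x l).1 := fun h => hne (hinj (by simpa using hl') hl h)
    simp [this]
  · intro h
    exact absurd (Finset.mem_Ico.2 hl) h

theorem height_smul_sub_smul (φ ψ : E → ℤ) (c d : ℤ) (n : ℕ) :
    height x (c • φ - d • ψ) n = c * height x φ n - d * height x ψ n := by
  simp only [height, Finset.mul_sum, ← Finset.sum_sub_distrib]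
  exact Finset.sum_congr rfl fun _ _ => by simp; ring

/-- A segment with pairwise distinct letters at both ends of which all height functions vanishing
on the whole word agree consists of the letters with nonzero exponent sum. -/
theorem mem_segment_iff {n p q : ℕ} (hpq : p < q)
    (hinj : Set.InjOn (fun l => (x l).1) (Set.Ico p q))
    (hφ : ∀ φ : E → ℤ, height x φ n = 0 → height x φ q = height x φ p) (a : E) :
    (∃ l ∈ Set.Ico p q, (x l).1 = a) ↔ expSum x n a ≠ 0 := by
  classical
  have key : ∀ l ∈ Set.Ico p q, expSum x n (x l).1 ≠ 0 := by
    intro l hl h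
    have := height_single_sub hinj hl
    rw [hφ _ (by simpa [expSum] using h), sub_self] at this
    exact (x l).2.ne_zero this.symm
  refine ⟨?_, fun ha => ?_⟩
  · rintro ⟨l, hl, rfl⟩
    exact key l hl
  · by_contra! hne
    have hp : p ∈ Set.Ico p q := ⟨le_rfl, hpq⟩
    have h1 := hφ (expSum x n a • Pi.single (x p).1 1 - expSum x n (x p).1 • Pi.single a 1) (by
      rw [height_smul_sub_smul]; simp only [expSum]; ring)
    have h2 := height_single_sub hinj hp
    have h3 : height x (Pi.single a 1) q - height x (Pi.single a 1) p = 0 := by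
      rw [height_sub_height _ hpq.le]
      refine Finset.sum_eq_zero fun l hl => ?_
      simp [hne l (by simpa using hl)]
    rw [height_smul_sub_smul, height_smul_sub_smul] at h1
    have h4 : expSum x n a * ((x p).2 : ℤ) = 0 := by
      rw [← h2]
      linear_combination h1 + expSum x n (x p).1 * h3
    exact (mul_ne_zero ha (x p).2.ne_zero) h4

/-- If all height functions give repeated letters the same level, then the first repetition after
`p` ends a segment consisting of the letters with nonzero exponent sum. -/
theorem exists_first_repeat {n : ℕ} (hn : 0 < n) (hper : ∀ j, x (j + n) = x j)
    (hred : ∀ j, (x j).1 = (x (j + 1)).1 → (x j).2 = (x (j + 1)).2) (hns : NoSplit x n) (p : ℕ) :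
    ∃ i p' q, p ≤ i ∧ i ≤ p' ∧ p' < q ∧ (x i).1 = (x q).1 ∧ (p' = i → x i = x q) ∧
      Set.InjOn (fun l => (x l).1) (Set.Ico p q) ∧
      ∀ a, (∃ l ∈ Set.Ico p' q, (x l).1 = a) ↔ expSum x n a ≠ 0 := by
  classical
  have hex : ∃ q, ∃ i, p ≤ i ∧ i < q ∧ (x i).1 = (x q).1 :=
    ⟨p + n, p, le_rfl, by omega, by rw [hper]⟩
  obtain ⟨i, hpi, hiq, hi⟩ := Nat.find_spec hex
  set q := Nat.find hex with hq
  have hinj : Set.InjOn (fun l => (x l).1) (Set.Ico p q) := by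
    intro l hl l' hl' h
    by_contra hne
    rcases lt_or_gt_of_ne hne with hlt | hlt
    · exact Nat.find_min hex hl'.2 ⟨l, hl.1, hlt, h⟩
    · exact Nat.find_min hex hl.2 ⟨l', hl'.1, hlt, h.symm⟩
  by_cases hs : (x i).2 = (x q).2
  · refine ⟨i, i, q, hpi, le_rfl, hiq, hi, fun _ => Prod.ext hi hs, hinj, ?_⟩
    refine mem_segment_iff hiq (hinj.mono (Set.Ico_subset_Ico_left hpi)) fun φ hφ => ?_
    have := level_sub_of_eq (φ := φ) (Prod.ext hi hs)
    rw [hns φ hφ i q hi] at this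
    linarith
  · have hlt : i + 1 < q := by
      refine lt_of_le_of_ne hiq fun h => hs ?_
      rw [← h]
      exact hred i (by rw [h]; exact hi)
    refine ⟨i, i + 1, q, hpi, by omega, hlt, hi, by omega, hinj, ?_⟩
    refine mem_segment_iff hlt (hinj.mono (Set.Ico_subset_Ico_left (by omega))) fun φ hφ => ?_
    have := level_sub_of_ne (φ := φ) hi hs
    rw [hns φ hφ i q hi] at this
    linarith

theorem segment_succ {p q : ℕ} (hpq : p < q) (hx : x q = x p)
    (hinj : Set.InjOn (fun l => (x l).1) (Set.Ico p q)) :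
    Set.InjOn (fun l => (x l).1) (Set.Ico (p + 1) (q + 1)) ∧
      ∀ a, (∃ l ∈ Set.Ico (p + 1) (q + 1), (x l).1 = a) ↔ ∃ l ∈ Set.Ico p q, (x l).1 = a := by
  have hlt : ∀ l ∈ Set.Ico (p + 1) (q + 1), l ≠ q → l ∈ Set.Ico p q := fun l hl h =>
    ⟨by have := hl.1; omega, by have := hl.2; omega⟩
  have hp : p ∈ Set.Ico p q := ⟨le_rfl, hpq⟩
  refine ⟨fun l hl l' hl' h => ?_, fun a => ⟨?_, ?_⟩⟩
  · have h1 := hl.1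
    have h2 := hl'.1
    by_cases hlq : l = q <;> by_cases hlq' : l' = q
    · rw [hlq, hlq']
    · subst hlq
      have := hinj hp (hlt l' hl' hlq') (by simpa [hx] using h)
      omega
    · subst hlq'
      have := hinj (hlt l hl hlq) hp (by simpa [hx] using h)
      omega
    · exact hinj (hlt l hl hlq) (hlt l' hl' hlq') h
  · rintro ⟨l, hl, rfl⟩
    by_cases hlq : l = q
    · exact ⟨p, hp, by rw [hlq, hx]⟩
    · exact ⟨l, hlt l hl hlq, rfl⟩
  · rintro ⟨l, ⟨h1, h2⟩, rfl⟩
    by_cases hlp : l = p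
    · exact ⟨q, ⟨by omega, by omega⟩, by rw [hlp, hx]⟩
    · exact ⟨l, ⟨by omega, by omega⟩, rfl⟩

theorem eq_of_segment {n : ℕ} (hn : 0 < n) (hper : ∀ j, x (j + n) = x j)
    (hred : ∀ j, (x j).1 = (x (j + 1)).1 → (x j).2 = (x (j + 1)).2) (hns : NoSplit x n) {p q : ℕ}
    (hpq : p < q) (hinj : Set.InjOn (fun l => (x l).1) (Set.Ico p q))
    (hS : ∀ a, (∃ l ∈ Set.Ico p q, (x l).1 = a) ↔ expSum x n a ≠ 0) : x q = x p := by
  obtain ⟨i, p', q', hpi, hip, hpq', hi, hx, hinj', hS'⟩ :=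
    exists_first_repeat hn hper hred hns p
  obtain ⟨l, hl, hle⟩ := (hS' (x p).1).2 ((hS _).1 ⟨p, ⟨le_rfl, hpq⟩, rfl⟩)
  have hlp : l = p := hinj' ⟨by have := hl.1; omega, hl.2⟩ ⟨le_rfl, by omega⟩ hle
  have hp' : p' = p := by have := hl.1; omega
  have hip : i = p := by omega
  subst hp' hip
  have hqq : q ≤ q' := by
    by_contra! h
    exact absurd (hinj ⟨le_rfl, hpq⟩ ⟨by omega, h⟩ hi) (by omega)
  obtain ⟨l, hl, hle⟩ := (hS (x (q' - 1)).1).2 ((hS' _).1 ⟨q' - 1, ⟨by omega, by omega⟩, rfl⟩)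
  have := hinj' ⟨hl.1, hl.2.trans_le hqq⟩ ⟨by omega, by omega⟩ hle
  obtain rfl : q = q' := by have := hl.2; omega
  exact (hx rfl).symm

/-- A cyclically reduced word with a repeated letter which is not a proper power has a height
function distinguishing two occurrences of a letter. -/
theorem injOn_of_noSplit {n : ℕ} (hn : 0 < n) (hper : ∀ j, x (j + n) = x j)
    (hred : ∀ j, (x j).1 = (x (j + 1)).1 → (x j).2 = (x (j + 1)).2)
    (hnp : ∀ (w : FreeGroup E) (k : ℤ), word x n = w ^ k → |k| ≤ 1) (hns : NoSplit x n) :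
    Set.InjOn (fun l => (x l).1) (Set.Iio n) := by
  obtain ⟨i, p, q, -, hip, hpq, -, -, hinj, hS⟩ := exists_first_repeat hn hper hred hns 0
  have hinj : Set.InjOn (fun l => (x l).1) (Set.Ico p q) :=
    hinj.mono (Set.Ico_subset_Ico_left (Nat.zero_le _))
  obtain ⟨k, rfl⟩ := Nat.exists_eq_add_of_lt hpq
  set d := k + 1 with hd
  have hmul : ∀ m j, x (j + m * n) = x j := fun m j => by
    induction m with
    | zero => simp
    | succ m ih => rw [Nat.succ_mul, ← add_assoc, hper, ih]
  have hseg : ∀ l, Set.InjOn (fun l => (x l).1) (Set.Ico (p + l) (p + l + d)) ∧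
      ∀ a, (∃ l' ∈ Set.Ico (p + l) (p + l + d), (x l').1 = a) ↔ expSum x n a ≠ 0 := by
    intro l
    induction l with
    | zero => exact ⟨hinj, hS⟩
    | succ l ih =>
      have h := eq_of_segment hn hper hred hns (by omega) ih.1 ih.2
      have h' := segment_succ (by omega) h ih.1
      rw [add_right_comm (p + l) d 1, add_assoc p l 1] at h'
      exact ⟨h'.1, fun a => (h'.2 a).trans (ih.2 a)⟩
  have hk : ∀ j, x (j + d) = x j := by
    intro j
    have h := hseg (p * n - p + j)
    have hle : p ≤ p * n := Nat.le_mul_of_pos_right p hn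
    have e : p + (p * n - p + j) = j + p * n := by omega
    rw [e] at h
    have := eq_of_segment hn hper hred hns (by omega) h.1 h.2
    rwa [hmul, add_right_comm, hmul] at this
  have hmulk : ∀ m j, x (j + d * m) = x j := fun m j => by
    induction m with
    | zero => simp
    | succ m ih => rw [Nat.mul_succ, ← add_assoc, hk, ih]
  have hdn : d ≤ n := by
    by_contra! h
    have := hinj (x₁ := p) (x₂ := p + n) ⟨le_rfl, hpq⟩ ⟨by omega, by omega⟩ (by simp [hper])
    omega
  have hgcd : Nat.gcd d n = n := by
    by_contra hne
    have hlt : Nat.gcd d n < n :=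
      lt_of_le_of_ne (Nat.le_of_dvd hn (Nat.gcd_dvd_right d n)) hne
    obtain ⟨m, -, hm⟩ := Nat.exists_mul_mod_eq_gcd hlt
    have hg : ∀ j, x (j + Nat.gcd d n) = x j := fun j => by
      rw [← hmul (d * m / n), add_assoc, ← hm, mul_comm _ n, Nat.mod_add_div, hmulk]
    obtain ⟨c, hc⟩ := Nat.gcd_dvd_right d n
    have h1 := hnp (word x (Nat.gcd d n)) c (by
      rw [zpow_natCast, ← word_mul x hg, mul_comm, ← hc])
    have h2 : c ≤ 1 := by
      rw [Nat.abs_cast] at h1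
      exact_mod_cast h1
    rw [hc] at hlt hn
    interval_cases c <;> omega
  obtain rfl : d = n := le_antisymm hdn (Nat.le_of_dvd (by omega) (Nat.gcd_eq_right_iff_dvd.1 hgcd))
  intro l hl l' hl' h
  have hle : p ≤ p * d := Nat.le_mul_of_pos_right p hn
  have hshift := (hseg (p * d - p)).1
  rw [show p + (p * d - p) = p * d by omega] at hshift
  have := hshift (x₁ := l + p * d) (x₂ := l' + p * d) ⟨by omega, by have := Set.mem_Iio.1 hl; omega⟩
    ⟨by omega, by have := Set.mem_Iio.1 hl'; omega⟩ (by simpa [hmul] using h)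
  omega

end LetterSequence

section Primitive

variable {E : Type} {z : E}

theorem eq_one_of_mem_normalClosure_mul_of_zpow_mul {P Q w : FreeGroup E} (ε : ℤˣ)
    (hP : P ∈ closure (FreeGroup.of '' {z}ᶜ)) (hQ : Q ∈ closure (FreeGroup.of '' {z}ᶜ))
    (hw : w ∈ closure (FreeGroup.of '' {z}ᶜ))
    (hw' : w ∈ normalClosure {P * FreeGroup.of z ^ (ε : ℤ) * Q}) : w = 1 := by
  classical
  let ρ : FreeGroup E →* FreeGroup E :=
    FreeGroup.lift fun f => if f = z then (P⁻¹ * Q⁻¹) ^ (ε : ℤ) else FreeGroup.of f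
  have hρ : ∀ v ∈ closure (FreeGroup.of '' {z}ᶜ), ρ v = v := by
    intro v hv
    refine MonoidHom.eqOn_closure (f := ρ) (g := MonoidHom.id _) ?_ hv
    rintro _ ⟨f, hf, rfl⟩
    simp [ρ, show f ≠ z from hf]
  have hker : normalClosure {P * FreeGroup.of z ^ (ε : ℤ) * Q} ≤ ρ.ker := by
    refine normalClosure_le_normal (Set.singleton_subset_iff.2 ?_)
    have : ρ (FreeGroup.of z) = (P⁻¹ * Q⁻¹) ^ (ε : ℤ) := by simp [ρ]
    rw [SetLike.mem_coe, MonoidHom.mem_ker, map_mul, map_mul, map_zpow, this, hρ P hP, hρ Q hQ,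
      ← zpow_mul]
    simp
  rw [← hρ w hw]
  exact hker hw'

theorem conj_mem_closure_range_conj {G K : Type} [Group G] [Group K] (e : K →* G) (r : G) (k : K)
    {g : G} (hg : g ∈ closure (Set.range fun k => e k * r * (e k)⁻¹)) :
    e k * g * (e k)⁻¹ ∈ closure (Set.range fun k => e k * r * (e k)⁻¹) := by
  induction hg using closure_induction with
  | mem x hx =>
    obtain ⟨l, rfl⟩ := hx
    exact subset_closure ⟨k * l, by simp [mul_assoc]⟩
  | one => simp
  | mul x y _ _ hx hy => simpa [mul_assoc] using mul_mem hx hy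
  | inv x _ hx => simpa [mul_assoc] using inv_mem hx

theorem cohenLyndon_of_zpow_mul (ε : ℤˣ) {Q : FreeGroup E}
    (hQ : Q ∈ closure (FreeGroup.of '' {z}ᶜ)) :
    CohenLyndon (FreeGroup.of z ^ (ε : ℤ) * Q) := by
  classical
  set K := {f : E // f ≠ z}
  let e : FreeGroup K →* FreeGroup E := FreeGroup.map Subtype.val
  obtain ⟨q, rfl⟩ : ∃ q, e q = Q := by
    have : closure (FreeGroup.of '' {z}ᶜ) ≤ e.range := by
      rw [closure_le]
      rintro _ ⟨f, hf, rfl⟩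
      exact ⟨FreeGroup.of ⟨f, hf⟩, by simp [e]⟩
    exact this hQ
  set r := FreeGroup.of z ^ (ε : ℤ) * e q with hr
  have hrz : FreeGroup.of z = (r * (e q)⁻¹) ^ (ε : ℤ) := by
    rw [hr, mul_inv_cancel_right, ← zpow_mul]
    simp
  let ρ : FreeGroup E →* FreeGroup K :=
    FreeGroup.lift fun f => if h : f = z then q⁻¹ ^ (ε : ℤ) else FreeGroup.of ⟨f, h⟩
  have hρe : ∀ k, ρ (e k) = k := by
    refine DFunLike.congr_fun (f := ρ.comp e) (g := MonoidHom.id _) ?_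
    ext f
    simp [ρ, e, f.2]
  have hρr : ρ r = 1 := by
    have : ρ (FreeGroup.of z) = q⁻¹ ^ (ε : ℤ) := by simp [ρ]
    rw [hr, map_mul, map_zpow, this, hρe, ← zpow_mul]
    simp
  have hker : normalClosure {r} ≤ ρ.ker :=
    normalClosure_le_normal (Set.singleton_subset_iff.2 hρr)
  let π := QuotientGroup.mk' (normalClosure {r})
  have hπr : π r = 1 := (QuotientGroup.eq_one_iff _).2 (subset_normalClosure rfl)
  have hπ : (π.comp e).comp ρ = π := by
    ext f
    by_cases h : f = z
    · subst h
      simp only [MonoidHom.comp_apply]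
      rw [hrz, map_zpow, map_zpow, map_zpow, map_zpow, map_mul, map_mul, hρr, map_inv ρ, hρe]
      simp [hπr]
    · simp [ρ, e, h]
  let ψ : FreeGroup K →* MulAut (FreeGroup (FreeGroup K)) :=
    { toFun k := FreeGroup.freeGroupCongr (Equiv.mulLeft k)
      map_one' := by
        apply MulEquiv.toMonoidHom_injective
        ext
        simp
      map_mul' k l := by
        apply MulEquiv.toMonoidHom_injective
        ext
        simp [mul_assoc] }
  have hψ : ∀ k, ψ k (FreeGroup.of 1) = FreeGroup.of k := fun k => by simp [ψ]
  let Ω : FreeGroup E →* FreeGroup (FreeGroup K) ⋊[ψ] FreeGroup K := FreeGroup.lift fun f =>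
    if h : f = z then
      (SemidirectProduct.inl (FreeGroup.of 1) * (SemidirectProduct.inr q)⁻¹) ^ (ε : ℤ)
    else SemidirectProduct.inr (FreeGroup.of ⟨f, h⟩)
  have hΩe : ∀ k, Ω (e k) = SemidirectProduct.inr k := by
    refine DFunLike.congr_fun (f := Ω.comp e) (g := SemidirectProduct.inr) ?_
    ext f : 1
    simp [Ω, e, f.2]
  have hΩr : Ω r = SemidirectProduct.inl (FreeGroup.of 1) := by
    have : Ω (FreeGroup.of z) =
        (SemidirectProduct.inl (FreeGroup.of 1) * (SemidirectProduct.inr q)⁻¹) ^ (ε : ℤ) := by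
      simp [Ω]
    rw [hr, map_mul, map_zpow, this, hΩe, ← zpow_mul]
    simp
  have hright : ∀ g ∈ normalClosure {r}, (Ω g).right = 1 := by
    have : normalClosure {r} ≤ (SemidirectProduct.rightHom.comp Ω).ker :=
      normalClosure_le_normal (Set.singleton_subset_iff.2 (by simp [MonoidHom.mem_ker, hΩr]))
    exact this
  refine CohenLyndon.of_hom (I := FreeGroup K) e ⟨fun k l hkl => ?_, fun g => ?_⟩ ?_
    { toFun g := (Ω g).left
      map_one' := by simp
      map_mul' g h := by simp [hright g g.2] } fun k => ?_
  · have := hker (QuotientGroup.eq.1 hkl)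
    rw [MonoidHom.mem_ker, map_mul, map_inv, hρe, hρe] at this
    exact inv_mul_eq_one.1 this
  · obtain ⟨g, rfl⟩ := QuotientGroup.mk_surjective g
    exact ⟨ρ g, DFunLike.congr_fun hπ g⟩
  · set L := closure (Set.range fun k => e k * r * (e k)⁻¹)
    have hrL : r ∈ L := subset_closure ⟨1, by simp⟩
    have heL : ∀ k, e k ∈ normalizer (L : Set (FreeGroup E)) := fun k => by
      refine mem_normalizer_iff.2 fun g =>
        ⟨conj_mem_closure_range_conj e r k, fun hg => ?_⟩
      have := conj_mem_closure_range_conj e r k⁻¹ hg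
      rwa [map_inv, inv_inv, mul_assoc (e k), inv_mul_cancel_left, inv_mul_cancel_right] at this
    have hL : L.Normal := by
      rw [← normalizer_eq_top_iff, eq_top_iff, ← FreeGroup.closure_range_of, closure_le]
      rintro _ ⟨f, rfl⟩
      by_cases h : f = z
      · subst h
        rw [hrz]
        exact zpow_mem (mul_mem (le_normalizer hrL) (inv_mem (heL q))) _
      · have := heL (FreeGroup.of ⟨f, h⟩)
        simpa [e] using this
    exact normalClosure_le_normal (Set.singleton_subset_iff.2 hrL)
  · change (Ω (e k * r * (e k)⁻¹)).left = _
    rw [map_mul, map_mul, map_inv, hΩe, hΩr, ← map_inv, ← SemidirectProduct.inl_aut, hψ]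
    simp

end Primitive

/-- The letters of the infinite cyclic cover of the free group on `E` for which the levels of `z`
lie between `m` and `M`. -/
abbrev Slab {E : Type} (z : E) (m M : ℤ) : Type :=
  {q : E × ℤ // q.1 = z → m ≤ q.2 ∧ q.2 ≤ M}

namespace Slab

variable {E : Type} {z : E} {m M : ℤ} (φ : E → ℤ)

/-- The inclusion of the slab without the highest level. -/
def incl (q : Slab z m (M - 1)) : Slab z m M :=
  ⟨q.1, fun h => ⟨(q.2 h).1, by linarith [(q.2 h).2]⟩⟩

/-- The shift by one level. -/
def shift (q : Slab z m (M - 1)) : Slab z m M :=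
  ⟨(q.1.1, q.1.2 + 1), fun h => ⟨by linarith [(q.2 h).1], by linarith [(q.2 h).2]⟩⟩

theorem incl_injective : Function.Injective (incl : Slab z m (M - 1) → Slab z m M) :=
  fun _ _ h => Subtype.ext (congrArg Subtype.val h :)

theorem shift_injective : Function.Injective (shift : Slab z m (M - 1) → Slab z m M) := by
  rintro ⟨⟨f, i⟩, h⟩ ⟨⟨g, j⟩, h'⟩ heq
  have := congrArg Subtype.val heq
  simpa [shift] using this

/-- The map to the free group on `E` and a stable letter which sends the letter `e` at level `i` to
`e`, conjugated by the `i`-th power of the stable letter and corrected by `φ e`. -/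
def toFree : FreeGroup (Slab z m M) →* FreeGroup (Option E) :=
  FreeGroup.lift fun q => FreeGroup.of none ^ q.1.2 * FreeGroup.of (some q.1.1) *
    FreeGroup.of none ^ (-(q.1.2 + φ q.1.1))

theorem toFree_of (q : Slab z m M) :
    toFree φ (FreeGroup.of q) = FreeGroup.of none ^ q.1.2 * FreeGroup.of (some q.1.1) *
      FreeGroup.of none ^ (-(q.1.2 + φ q.1.1)) := by
  simp [toFree]

theorem conj_eq {W : Type} [Group W] (α : FreeGroup (Slab z m M) →* W) (τ : W) (hmM : m ≤ M)
    (h : ∀ q : Slab z m (M - 1),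
      τ * α (FreeGroup.of (incl q)) = α (FreeGroup.of (shift q)) * τ) (f : E) (i : ℤ)
    (hi : f = z → m ≤ i ∧ i ≤ M) :
    α (FreeGroup.of ⟨(f, i), hi⟩) =
      τ ^ (i - m) * α (FreeGroup.of ⟨(f, m), fun _ => ⟨le_rfl, hmM⟩⟩) * τ ^ (m - i) := by
  induction i using Int.inductionOn' (b := m) with
  | zero => simp
  | succ i hle ih =>
    have hi' : f = z → m ≤ i ∧ i ≤ M - 1 := fun hf => ⟨hle, by linarith [(hi hf).2]⟩
    have h1 := h ⟨(f, i), hi'⟩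
    simp only [incl, shift] at h1
    rw [eq_mul_inv_of_mul_eq h1.symm, ih fun hf => ⟨hle, by linarith [(hi' hf).2]⟩]
    rw [show i + 1 - m = 1 + (i - m) by ring, show m - (i + 1) = (m - i) + -1 by ring, zpow_add,
      zpow_add]
    simp [mul_assoc]
  | pred i hle ih =>
    have hne : f ≠ z := fun hf => by linarith [(hi hf).1]
    have h1 := h ⟨(f, i - 1), fun hf => absurd hf hne⟩
    simp only [incl, shift, sub_add_cancel] at h1
    rw [eq_inv_mul_of_mul_eq h1, ih fun hf => absurd hf hne]
    rw [show i - 1 - m = -1 + (i - m) by ring, show m - (i - 1) = (m - i) + 1 by ring, zpow_add,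
      zpow_add]
    simp [mul_assoc]

theorem isHNN_toFree (hmM : m ≤ M) :
    IsHNN (FreeGroup.map (incl (z := z) (m := m) (M := M))) (FreeGroup.map shift) (toFree φ)
      (FreeGroup.of none) where
  rel c := by
    induction c using FreeGroup.induction_on with
    | C1 => simp
    | of q =>
      rw [FreeGroup.map.of, FreeGroup.map.of, toFree_of, toFree_of]
      simp only [incl, shift]
      rw [add_comm q.1.2 1, add_assoc, neg_add_rev 1, zpow_add, zpow_add]
      simp [mul_assoc]
    | inv_of q ih =>
      rw [map_inv, map_inv, map_inv, map_inv, mul_inv_eq_iff_eq_mul, mul_assoc, ih,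
        inv_mul_cancel_left]
    | mul x y hx hy => rw [map_mul, map_mul, ← mul_assoc, hx, mul_assoc, hy, map_mul, map_mul,
        mul_assoc]
  gen := by
    rw [eq_top_iff, ← FreeGroup.closure_range_of, closure_le]
    set L := closure (insert (FreeGroup.of none) (Set.range (toFree φ (z := z) (m := m) (M := M))))
    have hs : FreeGroup.of none ∈ L := subset_closure (Set.mem_insert _ _)
    rintro _ ⟨f | f, rfl⟩
    · exact hs
    · have h1 := toFree_of φ (⟨(f, m), fun _ => ⟨le_rfl, hmM⟩⟩ : Slab z m M)
      rw [mul_assoc, ← inv_mul_eq_iff_eq_mul, ← mul_inv_eq_iff_eq_mul, mul_assoc] at h1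
      change FreeGroup.of (some f) ∈ L
      rw [← h1]
      exact mul_mem (inv_mem (zpow_mem hs _))
        (mul_mem (subset_closure (Set.mem_insert_of_mem _ ⟨_, rfl⟩)) (inv_mem (zpow_mem hs _)))
  lift W _ α τ h := by
    let β : FreeGroup (Option E) →* W := FreeGroup.lift fun o => o.elim τ fun f =>
      τ ^ (-m) * α (FreeGroup.of ⟨(f, m), fun _ => ⟨le_rfl, hmM⟩⟩) * τ ^ (m + φ f)
    refine ⟨β, DFunLike.congr_fun (f := β.comp (toFree φ)) (g := α) ?_, by simp [β]⟩
    ext ⟨⟨f, i⟩, hi⟩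
    rw [MonoidHom.comp_apply, toFree_of,
      conj_eq α τ hmM (fun q => by simpa using h (FreeGroup.of q)) f i hi]
    simp only [map_mul, map_zpow, β, FreeGroup.lift_apply_of, Option.elim]
    rw [sub_eq_add_neg, sub_eq_add_neg, zpow_add τ i, show m + -i = m + φ f + -(i + φ f) by ring,
      zpow_add τ (m + φ f)]
    simp only [mul_assoc]

end Slab

theorem isHNN_map_some {E : Type} :
    IsHNN (1 : Unit →* FreeGroup E) 1 (FreeGroup.map some) (FreeGroup.of none) where
  rel := by simp
  gen := by
    rw [eq_top_iff, ← FreeGroup.closure_range_of, closure_le]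
    rintro _ ⟨f | f, rfl⟩
    · exact subset_closure (Set.mem_insert _ _)
    · exact subset_closure (Set.mem_insert_of_mem _ ⟨FreeGroup.of f, by simp⟩)
  lift W _ α τ _ := by
    let β : FreeGroup (Option E) →* W :=
      FreeGroup.lift fun o => o.elim τ fun f => α (FreeGroup.of f)
    refine ⟨β, DFunLike.congr_fun (f := β.comp (FreeGroup.map some)) (g := α) ?_, by simp [β]⟩
    ext
    simp [β]

namespace LetterSequence

variable {E : Type} {x : ℕ → E × ℤˣ}

theorem map_word {E' : Type} (f : E → E') (n : ℕ) :
    FreeGroup.map f (word x n) = word (fun j => (f (x j).1, (x j).2)) n := by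
  induction n with
  | zero => simp [word_zero]
  | succ n ih => rw [word_succ, map_mul, ih, map_zpow, FreeGroup.map.of, word_succ]

theorem word_mem_closure {z : E} {n : ℕ} (h : ∀ j < n, (x j).1 ≠ z) :
    word x n ∈ closure (FreeGroup.of '' {z}ᶜ) := by
  induction n with
  | zero => exact Subgroup.one_mem _
  | succ n ih =>
    rw [word_succ]
    have : FreeGroup.of (x n).1 ∈ closure (FreeGroup.of '' {z}ᶜ) :=
      subset_closure ⟨_, h n n.lt_succ_self, rfl⟩
    exact mul_mem (ih fun j hj => h j (hj.trans n.lt_succ_self)) (zpow_mem this _)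

theorem freeGroupMap_mem_closure {E' : Type} {f : E → E'} {z : E'} (h : ∀ e, f e ≠ z)
    (w : FreeGroup E) :
    FreeGroup.map f w ∈ closure (FreeGroup.of '' {z}ᶜ) := by
  have : (⊤ : Subgroup (FreeGroup E)) ≤
      (closure (FreeGroup.of '' {z}ᶜ)).comap (FreeGroup.map f) := by
    rw [← FreeGroup.closure_range_of, closure_le]
    rintro _ ⟨e, rfl⟩
    exact subset_closure ⟨f e, h e, by simp⟩
  exact this (mem_top w)

/-- The word of the first `n` letters of `x` satisfies the Cohen–Lyndon theorem, and its normal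
closure intersects the subgroup generated by all letters but one of the word trivially. -/
def IsGoodRelator (x : ℕ → E × ℤˣ) (n : ℕ) : Prop :=
  CohenLyndon (word x n) ∧ ∀ j, ∀ w ∈ closure (FreeGroup.of '' {(x j).1}ᶜ),
    w ∈ normalClosure {word x n} → w = 1

theorem apply_mod {n : ℕ} (hper : ∀ j, x (j + n) = x j) (j : ℕ) : x (j % n) = x j :=
  (Function.Periodic.map_mod_nat hper j)

theorem isGoodRelator_of_injOn {n : ℕ} (hn : 0 < n) (hper : ∀ j, x (j + n) = x j)
    (hinj : Set.InjOn (fun l => (x l).1) (Set.Iio n)) : IsGoodRelator x n := by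
  have hword : ∀ j < n, word x n =
      word x j * FreeGroup.of (x j).1 ^ ((x j).2 : ℤ) * word (fun l => x (j + 1 + l)) (n - j - 1) ∧
      word x j ∈ closure (FreeGroup.of '' {(x j).1}ᶜ) ∧
      word (fun l => x (j + 1 + l)) (n - j - 1) ∈ closure (FreeGroup.of '' {(x j).1}ᶜ) := by
    refine fun j hj => ⟨?_, word_mem_closure fun l hl h => ?_, word_mem_closure fun l hl h => ?_⟩
    · rw [← word_succ, ← word_add]
      congr 1
      omega
    · exact hl.ne (hinj (hl.trans hj) hj h)
    · have := hinj (x₁ := j + 1 + l) (x₂ := j) (Set.mem_Iio.2 (by omega)) hj h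
      omega
  refine ⟨?_, fun j w hw hw' => ?_⟩
  · obtain ⟨h1, -, h3⟩ := hword 0 hn
    rw [h1, word_zero, one_mul]
    exact cohenLyndon_of_zpow_mul _ h3
  · obtain ⟨h1, h2, h3⟩ := hword (j % n) (Nat.mod_lt _ hn)
    rw [h1] at hw'
    rw [← apply_mod hper] at hw
    exact eq_one_of_mem_normalClosure_mul_of_zpow_mul _ h2 h3 hw hw'

theorem toFree_word {z : E} {m M : ℤ} (φ : E → ℤ) {y : ℕ → Slab z m M × ℤˣ}
    (hy : ∀ j, (y j).1.1 = ((x j).1, level x φ j)) (hy' : ∀ j, (y j).2 = (x j).2) (n : ℕ) :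
    Slab.toFree φ (word y n) =
      FreeGroup.map some (word x n) * FreeGroup.of none ^ (-height x φ n) := by
  induction n with
  | zero => simp [word_zero, height_zero]
  | succ n ih =>
    rw [word_succ, map_mul, map_zpow, Slab.toFree_of, ih, hy, hy', word_succ, map_mul, map_zpow,
      FreeGroup.map.of, height_succ]
    simp only [level]
    rcases Int.units_eq_one_or (x n).2 with h | h
    · simp [h, mul_assoc]
    · simp only [h, height_succ, mul_assoc, Units.val_neg, Units.val_one, zpow_neg_one]
      simp [mul_assoc, ← zpow_neg, add_comm]
      rw [zpow_neg, inv_mul_cancel_left]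

theorem exists_toFree_eq {z : E} {m M : ℤ} (φ : E → ℤ) {w : FreeGroup E}
    (hw : w ∈ closure (FreeGroup.of '' {z}ᶜ)) (h : ℤ) :
    ∃ k ∈ closure (FreeGroup.of '' {q : Slab z m M | q.1.1 ≠ z}),
      FreeGroup.of none ^ h * FreeGroup.map some w * FreeGroup.of none ^
        (-(h + (FreeGroup.lift (fun e => Multiplicative.ofAdd (φ e)) w).toAdd)) =
      Slab.toFree φ k := by
  induction hw using closure_induction generalizing h with
  | mem x hx =>
    obtain ⟨f, hf, rfl⟩ := hx
    exact ⟨FreeGroup.of ⟨(f, h), fun h => absurd h hf⟩, subset_closure ⟨_, hf, rfl⟩, by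
      simp [Slab.toFree_of]⟩
  | one => exact ⟨1, Subgroup.one_mem _, by simp⟩
  | mul x y _ _ hx hy =>
    obtain ⟨k, hk, hkx⟩ := hx h
    obtain ⟨l, hl, hly⟩ := hy
      (h + (FreeGroup.lift (fun e => Multiplicative.ofAdd (φ e)) x).toAdd)
    refine ⟨k * l, mul_mem hk hl, ?_⟩
    rw [map_mul (Slab.toFree φ), ← hkx, ← hly, map_mul, map_mul, toAdd_mul, ← add_assoc,
      zpow_neg _ (h + _)]
    group
  | inv x _ hx =>
    obtain ⟨k, hk, hkx⟩ := hx
      (h - (FreeGroup.lift (fun e => Multiplicative.ofAdd (φ e)) x).toAdd)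
    refine ⟨k⁻¹, inv_mem hk, ?_⟩
    rw [map_inv (Slab.toFree φ), ← hkx, map_inv, map_inv, toAdd_inv, sub_add_cancel,
      ← sub_eq_add_neg, zpow_neg, zpow_neg, mul_inv_rev, mul_inv_rev, inv_inv, mul_assoc]

theorem lift_word (φ : E → ℤ) (n : ℕ) :
    FreeGroup.lift (fun e => Multiplicative.ofAdd (φ e)) (word x n) =
      Multiplicative.ofAdd (height x φ n) := by
  induction n with
  | zero => simp [word_zero, height_zero]
  | succ n ih => rw [word_succ, map_mul, map_zpow, ih, height_succ, FreeGroup.lift_apply_of,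
      ofAdd_add, ← smul_eq_mul ((x n).2 : ℤ), ofAdd_zsmul]

/-- The inductive step of Magnus' method: a relator is good if its lift to the infinite cyclic
cover given by `φ` is good. -/
theorem isGoodRelator_lift {z : E} {m M : ℤ} {n : ℕ} {φ : E → ℤ} (hφ : height x φ n = 0)
    {y : ℕ → Slab z m M × ℤˣ} (hy : ∀ j, (y j).1.1 = ((x j).1, level x φ j))
    (hy' : ∀ j, (y j).2 = (x j).2) (hgood : IsGoodRelator y n) {a b : ℕ}
    (ha : (y a).1.1 = (z, m)) (hb : (y b).1.1 = (z, M)) :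
    CohenLyndon (word x n) ∧ ∀ w ∈ closure (FreeGroup.of '' {z}ᶜ),
      w ∈ normalClosure {word x n} → w = 1 := by
  have hmM : m ≤ M := by
    have := (y a).1.2 (by rw [ha])
    rw [ha] at this
    exact this.2
  have hword : Slab.toFree φ (word y n) = FreeGroup.map some (word x n) := by
    rw [toFree_word φ hy hy', hφ]
    simp
  obtain ⟨S⟩ := (Slab.isHNN_toFree φ hmM).nonempty_kernelSplitting (N := normalClosure {word y n})
    (fun c hc => FreeGroup.map_injective Slab.incl_injective (by
      rw [map_one]
      refine hgood.2 b _ (freeGroupMap_mem_closure (fun q hq => ?_) c) hc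
      have h1 := hq ▸ hb
      have := (q.2 (congrArg Prod.fst h1)).2
      rw [show q.1.2 = M from congrArg Prod.snd h1] at this
      linarith))
    (fun c hc => FreeGroup.map_injective Slab.shift_injective (by
      rw [map_one]
      refine hgood.2 a _ (freeGroupMap_mem_closure (fun q hq => ?_) c) hc
      have h1 := hq ▸ ha
      have := (q.2 (congrArg Prod.fst h1)).1
      have h2 : q.1.2 + 1 = m := congrArg Prod.snd h1
      linarith))
  refine ⟨?_, fun w hw hw' => ?_⟩
  · obtain ⟨T⟩ := (isHNN_map_some (E := E)).nonempty_kernelSplitting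
      (N := normalClosure {word x n}) (fun _ _ => rfl) fun _ _ => rfl
    have := hgood.1.map S
    rw [hword] at this
    exact this.comap T
  · have hker : normalClosure {word x n} ≤
        (FreeGroup.lift fun e => Multiplicative.ofAdd (φ e)).ker :=
      normalClosure_le_normal (Set.singleton_subset_iff.2 (by
        simp [MonoidHom.mem_ker, lift_word, hφ]))
    obtain ⟨k, hk, hkw⟩ := exists_toFree_eq (m := m) (M := M) φ hw 0
    rw [MonoidHom.mem_ker.1 (hker hw')] at hkw
    have hkw : FreeGroup.map some w = Slab.toFree φ k := by simpa using hkw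
    have hkN : Slab.toFree φ k ∈ normalClosure
        (Slab.toFree φ '' (normalClosure {word y n} : Set (FreeGroup (Slab z m M)))) := by
      rw [normalClosure_image_normalClosure, hword, ← hkw,
        ← normalClosure_image_normalClosure]
      exact subset_normalClosure ⟨w, hw', rfl⟩
    have h1 := (S.rep_unique 1 S.base k S.base _ hkN (by simp [S.s_base])).2
    rw [inv_one, one_mul] at h1
    have h2 := hgood.2 a k (closure_mono (Set.image_mono fun q hq => ?_) hk) h1
    · rw [h2, map_one] at hkw
      exact FreeGroup.map_injective (Option.some_injective E) (hkw.trans (map_one _).symm)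
    · rintro rfl
      exact hq (by rw [ha])

theorem isGoodRelator {n : ℕ} (hn : 0 < n) {E : Type} {x : ℕ → E × ℤˣ}
    (hper : ∀ j, x (j + n) = x j)
    (hred : ∀ j, (x j).1 = (x (j + 1)).1 → (x j).2 = (x (j + 1)).2)
    (hnp : ∀ (w : FreeGroup E) (k : ℤ), word x n = w ^ k → |k| ≤ 1) : IsGoodRelator x n := by
  classical
  induction h : n - ((fun j => (x j).1) '' Set.Iio n).ncard using Nat.strong_induction_on
    generalizing E with
  | _ d ih =>
  by_cases hinj : Set.InjOn (fun j => (x j).1) (Set.Iio n)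
  · exact isGoodRelator_of_injOn hn hper hinj
  have hns : ¬ NoSplit x n := fun hns => hinj (injOn_of_noSplit hn hper hred hnp hns)
  simp only [NoSplit, not_forall] at hns
  obtain ⟨φ, hφ, i, j, hij, hne⟩ := hns
  have hlevel : ∀ l, level x φ (l % n) = level x φ l := fun l =>
    Function.Periodic.map_mod_nat (level_add_period hper hφ) l
  have key : ∀ c < n, CohenLyndon (word x n) ∧ ∀ w ∈ closure (FreeGroup.of '' {(x c).1}ᶜ),
      w ∈ normalClosure {word x n} → w = 1 := by
    intro c hc
    set s := (Finset.range n).filter fun l => (x l).1 = (x c).1 with hs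
    have hmem : ∀ l, (x l).1 = (x c).1 → l % n ∈ s := fun l hl =>
      Finset.mem_filter.2 ⟨Finset.mem_range.2 (Nat.mod_lt _ hn), by rwa [apply_mod hper]⟩
    have hsne : s.Nonempty := ⟨_, hmem c rfl⟩
    obtain ⟨a, ha, hmin⟩ := s.exists_min_image (level x φ) hsne
    obtain ⟨b, hb, hmax⟩ := s.exists_max_image (level x φ) hsne
    let y : ℕ → Slab (x c).1 (level x φ a) (level x φ b) × ℤˣ := fun l =>
      (⟨((x l).1, level x φ l), fun hl =>
        ⟨hlevel l ▸ hmin _ (hmem l hl), hlevel l ▸ hmax _ (hmem l hl)⟩⟩, (x l).2)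
    have himage : (fun l => (x l).1) '' Set.Iio n =
        (fun q => q.1.1) '' ((fun l => (y l).1) '' Set.Iio n) := by
      simp only [Set.image_image, y]
    have hfin : ((fun l => (y l).1) '' Set.Iio n).Finite := (Set.finite_Iio n).image _
    have hcard : ((fun l => (x l).1) '' Set.Iio n).ncard <
        ((fun l => (y l).1) '' Set.Iio n).ncard := by
      rw [himage]
      refine lt_of_le_of_ne (Set.ncard_image_le hfin) fun heq => hne ?_
      have := Set.injOn_of_ncard_image_eq heq hfin ⟨i % n, Nat.mod_lt _ hn, rfl⟩
        ⟨j % n, Nat.mod_lt _ hn, rfl⟩ (by simpa [y, apply_mod hper] using hij)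
      rw [← hlevel i, ← hlevel j]
      exact congrArg (fun q => q.1.2) this
    have hle : ((fun l => (y l).1) '' Set.Iio n).ncard ≤ n :=
      (Set.ncard_image_le (Set.finite_Iio n)).trans (by simp)
    refine isGoodRelator_lift hφ (y := y) (fun _ => rfl) (fun _ => rfl)
      (ih _ (by omega) (fun l => ?_) (fun l hl => ?_) (fun w k hw => ?_) rfl) (a := a) (b := b)
      (Prod.ext (Finset.mem_filter.1 ha).2 rfl) (Prod.ext (Finset.mem_filter.1 hb).2 rfl)
    · have h1 : (y (l + n)).1 = (y l).1 := Subtype.ext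
        (Prod.ext (congrArg (fun p => p.1) (hper l)) (level_add_period hper hφ l))
      exact Prod.ext h1 (congrArg (fun p => p.2) (hper l))
    · exact hred l (congrArg (fun q => q.1.1) hl)
    · refine hnp (FreeGroup.map (fun q => q.1.1) w) k ?_
      rw [← map_zpow, ← hw, map_word]
  exact ⟨(key 0 hn).1, fun c => apply_mod hper c ▸ (key _ (Nat.mod_lt c hn)).2⟩

end LetterSequence

theorem CohenLyndon.conj {G : Type} [Group G] {r : G} (h : CohenLyndon r) (g : G) :
    CohenLyndon (g * r * g⁻¹) := by
  have hN : normalClosure {g * r * g⁻¹} = normalClosure {r} := by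
    refine le_antisymm (normalClosure_le_normal ?_) (normalClosure_le_normal ?_) <;>
      rw [Set.singleton_subset_iff]
    · exact conj_mem_normalClosure_singleton r g
    · simpa [mul_assoc] using conj_mem_normalClosure_singleton (g * r * g⁻¹) g⁻¹
  obtain ⟨b, hb⟩ := h
  unfold CohenLyndon
  rw [hN]
  refine ⟨b.reindex (Equiv.mulRight (g⁻¹ : G ⧸ normalClosure {r})), fun q => ?_⟩
  obtain ⟨x, hx, hbx⟩ := hb (q * g)
  refine ⟨x * g⁻¹, ?_, ?_⟩
  · rw [QuotientGroup.mk_mul, hx, QuotientGroup.mk_inv, mul_inv_cancel_right]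
  · rw [FreeGroupBasis.reindex_apply]
    simpa [mul_assoc] using hbx

open LetterSequence in
theorem exists_periodic_word {E : Type} {L : List (E × Bool)} (hL : FreeGroup.IsCyclicallyReduced L)
    (hne : L ≠ []) : ∃ x : ℕ → E × ℤˣ, (∀ j, x (j + L.length) = x j) ∧
      (∀ j, (x j).1 = (x (j + 1)).1 → (x j).2 = (x (j + 1)).2) ∧
      word x L.length = FreeGroup.mk L := by
  have hlen : 0 < L.length := List.length_pos_iff.2 hne
  let l : ℕ → E × Bool := fun j => L[j % L.length]'(Nat.mod_lt _ hlen)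
  have hl : ∀ j (hj : j < L.length), l j = L[j] := fun j hj => by simp [l, Nat.mod_eq_of_lt hj]
  have hred : ∀ j, (l j).1 = (l (j + 1)).1 → (l j).2 = (l (j + 1)).2 := by
    intro j
    rcases (Nat.succ_le_of_lt (Nat.mod_lt j hlen)).lt_or_eq with h | h
    · have h1 : (j + 1) % L.length = j % L.length + 1 := by
        rw [← Nat.mod_add_mod, Nat.mod_eq_of_lt h]
      simp only [l, h1]
      exact List.isChain_iff_getElem.1 hL.1 _ h
    · have h1 : (j + 1) % L.length = 0 := by
        rw [← Nat.mod_add_mod, ← Nat.succ_eq_add_one, h, Nat.mod_self]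
      have h2 : j % L.length = L.length - 1 := by omega
      simp only [l, h1, h2]
      exact hL.2 _ (by simp [List.getLast?_eq_getElem?]) _ (by simp [List.head?_eq_getElem?])
  refine ⟨fun j => ((l j).1, if (l j).2 then 1 else -1), fun j => by simp [l],
    fun j h => by simp [hred j h], ?_⟩
  have key : ∀ k ≤ L.length, word (fun j => ((l j).1, if (l j).2 then (1 : ℤˣ) else -1)) k =
      FreeGroup.mk (L.take k) := by
    intro k
    induction k with
    | zero => intro; rfl
    | succ k ih =>
      intro hk
      rw [word_succ, ih (by omega), List.take_add_one, List.getElem?_eq_getElem (by omega),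
        ← FreeGroup.mul_mk]
      simp only [hl k (by omega)]
      rcases L[k] with ⟨e, _ | _⟩ <;> simp [FreeGroup.of, FreeGroup.invRev]
  simpa using key L.length le_rfl

open LetterSequence in
theorem CohenLyndon.of_not_properPower {E : Type} {r : FreeGroup E} (hr : r ≠ 1)
    (hnp : ∀ (w : FreeGroup E) (k : ℤ), r = w ^ k → |k| ≤ 1) : CohenLyndon r := by
  classical
  set L := FreeGroup.reduceCyclically r.toWord
  set c := FreeGroup.mk (FreeGroup.reduceCyclically.conjugator r.toWord)
  have hc : c * FreeGroup.mk L * c⁻¹ = r := by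
    rw [FreeGroup.inv_mk, FreeGroup.mul_mk, FreeGroup.mul_mk,
      FreeGroup.reduceCyclically.conj_conjugator_reduceCyclically, FreeGroup.mk_toWord]
  have hne : L ≠ [] := fun h => hr (by rw [← hc, h, ← FreeGroup.one_eq_mk]; simp)
  obtain ⟨x, hper, hred, hx⟩ := exists_periodic_word
    (FreeGroup.reduceCyclically.isCyclicallyReduced FreeGroup.isReduced_toWord) hne
  have := (isGoodRelator (List.length_pos_iff.2 hne) hper hred fun w k hw =>
    hnp (c * w * c⁻¹) k (by rw [conj_zpow, ← hw, hx, hc])).1.conj c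
  rwa [hx, hc] at this

/-- **Proposition 4.1, first part (Cohen–Lyndon-type basis).**
Let `F` be a free group of finite rank at least 2 and let `B ∈ F` be a nontrivial element
which is not a proper power.  Let `N = ⟪B⟫` be the normal closure of `B` in `F`, `π = F/N`
and `p : F → π` the quotient map.  Then `N` is a free group; moreover, there exists a
section `s : π → F` of `p` such that the family `(s g · B · (s g)⁻¹)`, indexed by `g ∈ π`,
is a free basis of the group `N`. -/
theorem normalClosure_isFree_with_conjugate_basis
    (r : ℕ) (hr : 2 ≤ r) (B : FreeGroup (Fin r)) (hB : B ≠ 1)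
    (hBnp : ∀ (w : FreeGroup (Fin r)) (k : ℤ), B = w ^ k → |k| ≤ 1) :
    IsFreeGroup (Subgroup.normalClosure {B} : Subgroup (FreeGroup (Fin r))) ∧
    ∃ s : (FreeGroup (Fin r) ⧸ Subgroup.normalClosure {B}) → FreeGroup (Fin r),
      (∀ g, QuotientGroup.mk' (Subgroup.normalClosure {B}) (s g) = g) ∧
      ∃ b : FreeGroupBasis (FreeGroup (Fin r) ⧸ Subgroup.normalClosure {B})
          (Subgroup.normalClosure {B} : Subgroup (FreeGroup (Fin r))),
        ∀ g, (b g : FreeGroup (Fin r)) = s g * B * (s g)⁻¹ := by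
  obtain ⟨b, hb⟩ := CohenLyndon.of_not_properPower hB hBnp
  choose s hs hbs using hb
  exact ⟨b.isFreeGroup, s, hs, b, hbs⟩
end

section
/- There exists a surjective group homomorphism q_N from N to the additive group of the integral group ring ℤ[π] whose kernel is the commutator subgroup [N,N] and which satisfies q_N(u·B·u⁻¹) = ū for every u ∈ F; consequently q_N(∏_{i=1}^{r} (u_i B u_i⁻¹)^{n_i}) = Σ_{i=1}^{r} n_i·ū_i for all u_i ∈ F, n_i ∈ ℤ. In particular the abelianization N/[N,N] is isomorphic to the free abelian group (ℤ[π],+). (Proposition 4.1, second part.) -/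
section MagnusOrder

variable {α : Type*} [LinearOrder α]

/-- Left multiplication by `1 + X s` on formal power series in noncommuting variables indexed by
`α`, a power series being given by its coefficients on words. -/
def magnusLeft (s : α) : Equiv.Perm (List α → ℤ) where
  toFun a w := a w + if w.head? = some s then a w.tail else 0
  invFun a := List.rec (a []) fun x t y => a (x :: t) - if x = s then y else 0
  left_inv a := by
    funext w
    induction w with
    | nil => simp
    | cons x t ih => simp only at ih ⊢; rw [ih]; simp
  right_inv a := by
    funext w
    cases w <;> simp

/-- Reversal of the words of a noncommutative power series. -/
def reverseSeries : Equiv.Perm (List α → ℤ) where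
  toFun a w := a w.reverse
  invFun a w := a w.reverse
  left_inv a := by simp
  right_inv a := by simp

/-- The Magnus representation of a free group by left multiplications. -/
def magnusRep : FreeGroup α →* Equiv.Perm (List α → ℤ) := FreeGroup.lift magnusLeft

/-- The representation of a free group by right multiplications, obtained from `magnusRep`
by reversing words. -/
def magnusRepRight : FreeGroup α →* Equiv.Perm (List α → ℤ) :=
  (MulAut.conj reverseSeries).toMonoidHom.comp magnusRep

theorem magnusRep_of_apply (s : α) (a : List α → ℤ) (w : List α) :
    magnusRep (FreeGroup.of s) a w = a w + if w.head? = some s then a w.tail else 0 := by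
  simp [magnusRep, magnusLeft]

theorem magnusRepRight_of_apply (s : α) (a : List α → ℤ) (w : List α) :
    magnusRepRight (FreeGroup.of s) a w =
      a w + if w.getLast? = some s then a w.dropLast else 0 := by
  have : magnusRepRight (FreeGroup.of s) a w =
    magnusRep (FreeGroup.of s) (fun v => a v.reverse) w.reverse := rfl
  rw [this, magnusRep_of_apply]
  simp [List.head?_reverse, List.tail_reverse]

theorem commute_magnusRep_of (s t : α) :
    Commute (magnusRep (FreeGroup.of s)) (magnusRepRight (FreeGroup.of t)) := by
  refine Equiv.ext fun a => funext fun w => ?_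
  simp only [Equiv.Perm.mul_apply, magnusRep_of_apply, magnusRepRight_of_apply]
  rcases w with - | ⟨x, - | ⟨y, w⟩⟩
  · simp
  · simp only [List.head?_cons, List.getLast?_singleton, List.tail_cons, List.dropLast_singleton,
      Option.some.injEq, List.getLast?_nil, List.head?_nil, reduceCtorEq, if_false, add_zero]
    exact add_right_comm _ _ _
  · by_cases hs : x = s <;> by_cases ht : (y :: w).getLast? = some t <;>
      simp only [List.head?_cons, List.tail_cons, List.getLast?_cons_cons, List.dropLast_cons_cons,
        Option.some.injEq, hs, ht, if_true, if_false] <;> ring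

theorem commute_magnusRep (g h : FreeGroup α) : Commute (magnusRep g) (magnusRepRight h) := by
  induction g using FreeGroup.induction_on with
  | C1 => simp
  | of s =>
    induction h using FreeGroup.induction_on with
    | C1 => simp
    | of t => exact commute_magnusRep_of s t
    | inv_of t ih => rw [map_inv]; exact ih.inv_right
    | mul x y hx hy => rw [map_mul]; exact hx.mul_right hy
  | inv_of t ih => rw [map_inv]; exact ih.inv_left
  | mul x y hx hy => rw [map_mul]; exact hx.mul_left hy

/-- The Magnus expansion of an element of a free group. -/
def magnusSeries (g : FreeGroup α) : List α → ℤ := magnusRep g (Pi.single [] 1)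

theorem magnusSeries_of_eq (s : α) :
    magnusRepRight (FreeGroup.of s) (Pi.single [] 1) =
      magnusRep (FreeGroup.of s) (Pi.single [] 1) := by
  funext w
  rw [magnusRep_of_apply, magnusRepRight_of_apply]
  rcases w with - | ⟨x, - | ⟨y, w⟩⟩ <;> simp

theorem magnusSeries_conj_of (s : α) (g : FreeGroup α) :
    magnusSeries (FreeGroup.of s * g * (FreeGroup.of s)⁻¹) =
      magnusRep (FreeGroup.of s) (magnusRepRight (FreeGroup.of s)⁻¹ (magnusSeries g)) := by
  have key : magnusRep (FreeGroup.of s)⁻¹ (Pi.single [] 1) =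
      magnusRepRight (FreeGroup.of s)⁻¹ (Pi.single [] 1) := by
    have h := magnusSeries_of_eq s
    have hc := DFunLike.congr_fun (commute_magnusRep (FreeGroup.of s) (FreeGroup.of s)⁻¹).eq
      (Pi.single [] 1)
    rw [Equiv.Perm.mul_apply, Equiv.Perm.mul_apply, ← h, map_inv magnusRepRight,
      Equiv.Perm.inv_def, Equiv.symm_apply_apply] at hc
    rw [map_inv, map_inv, Equiv.Perm.inv_eq_iff_eq]
    exact hc.symm
  have hc := DFunLike.congr_fun (commute_magnusRep g (FreeGroup.of s)⁻¹).eq (Pi.single [] 1)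
  simp only [Equiv.Perm.mul_apply] at hc
  rw [magnusSeries, magnusSeries, map_mul, map_mul, Equiv.Perm.mul_apply, Equiv.Perm.mul_apply,
    key, hc]

/-- The lexicographic order on power series, words being ordered by length first. -/
def SeriesLT (a b : List α → ℤ) : Prop :=
  Pi.Lex (List.Shortlex (· < ·)) (fun {_} x y => x < y) a b

theorem magnusRep_of_lt (s : α) {a b : List α → ℤ} (h : SeriesLT a b) :
    SeriesLT (magnusRep (FreeGroup.of s) a) (magnusRep (FreeGroup.of s) b) := by
  obtain ⟨w, hw, hlt⟩ := h
  have key : ∀ v : List α, v.length ≤ w.length → v.head? = some s → a v.tail = b v.tail := by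
    intro v hv hs
    rcases v with - | ⟨x, t⟩
    · simp at hs
    · exact hw _ (List.Shortlex.of_length_lt (by simp at hv ⊢; omega))
  refine ⟨w, fun v hv => ?_, ?_⟩
  · have hl : v.length ≤ w.length := by
      rcases List.shortlex_def.1 hv with h | h <;> omega
    simp only [magnusRep_of_apply, hw v hv]
    split_ifs with hs
    · rw [key v hl hs]
    · rfl
  · simp only [magnusRep_of_apply]
    split_ifs with hs
    · rw [key w le_rfl hs]; simpa using hlt
    · simpa using hlt

theorem magnusRepRight_of_lt (s : α) {a b : List α → ℤ} (h : SeriesLT a b) :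
    SeriesLT (magnusRepRight (FreeGroup.of s) a) (magnusRepRight (FreeGroup.of s) b) := by
  obtain ⟨w, hw, hlt⟩ := h
  have key : ∀ v : List α, v.length ≤ w.length → v.getLast? = some s →
      a v.dropLast = b v.dropLast := by
    intro v hv hs
    rcases v with - | ⟨x, t⟩
    · simp at hs
    · exact hw _ (List.Shortlex.of_length_lt (by simp at hv ⊢; omega))
  refine ⟨w, fun v hv => ?_, ?_⟩
  · have hl : v.length ≤ w.length := by
      rcases List.shortlex_def.1 hv with h | h <;> omega
    simp only [magnusRepRight_of_apply, hw v hv]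
    split_ifs with hs
    · rw [key v hl hs]
    · rfl
  · simp only [magnusRepRight_of_apply]
    split_ifs with hs
    · rw [key w le_rfl hs]; simpa using hlt
    · simpa using hlt

theorem SeriesLT.irrefl (a : List α → ℤ) : ¬ SeriesLT a a := by
  rintro ⟨w, -, h⟩
  exact lt_irrefl _ h

theorem isWellOrder_shortlex [WellFoundedLT α] :
    IsWellOrder (List α) (List.Shortlex (· < ·)) where
  wf := List.Shortlex.wf wellFounded_lt

theorem SeriesLT.trans [WellFoundedLT α] {a b c : List α → ℤ} (h₁ : SeriesLT a b)
    (h₂ : SeriesLT b c) : SeriesLT a c := by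
  have := isWellOrder_shortlex (α := α)
  obtain ⟨v, hv, hav⟩ := h₁
  obtain ⟨w, hw, hbw⟩ := h₂
  rcases trichotomous_of (List.Shortlex (· < ·)) v w with h | rfl | h
  · exact ⟨v, fun u hu => (hv u hu).trans (hw u (_root_.trans hu h)), hav.trans_eq (hw v h)⟩
  · exact ⟨v, fun u hu => (hv u hu).trans (hw u hu), hav.trans hbw⟩
  · exact ⟨w, fun u hu => (hv u (_root_.trans hu h)).trans (hw u hu), (hv w h).trans_lt hbw⟩

theorem SeriesLT.trichotomous [WellFoundedLT α] (a b : List α → ℤ) :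
    SeriesLT a b ∨ a = b ∨ SeriesLT b a := by
  have := Pi.trichotomous_lex (ι := List α) (β := fun _ => ℤ) (s := fun {_} x y => x < y)
    (r := List.Shortlex (· < ·)) (wf := List.Shortlex.wf (r := fun x y : α => x < y) wellFounded_lt)
  exact @trichotomous_of _ SeriesLT this a b

theorem SeriesLT.of_map [WellFoundedLT α] {f : Equiv.Perm (List α → ℤ)}
    (hf : ∀ {a b}, SeriesLT a b → SeriesLT (f a) (f b)) {a b : List α → ℤ}
    (h : SeriesLT (f a) (f b)) : SeriesLT a b := by
  rcases SeriesLT.trichotomous a b with h' | rfl | h'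
  · exact h'
  · exact (SeriesLT.irrefl _ h).elim
  · exact (SeriesLT.irrefl _ (h.trans (hf h'))).elim

theorem magnusSeries_conj_of_lt [WellFoundedLT α] (s : α) {g h : FreeGroup α} :
    SeriesLT (magnusSeries (FreeGroup.of s * g * (FreeGroup.of s)⁻¹))
      (magnusSeries (FreeGroup.of s * h * (FreeGroup.of s)⁻¹)) ↔
    SeriesLT (magnusSeries g) (magnusSeries h) := by
  rw [magnusSeries_conj_of, magnusSeries_conj_of]
  refine ⟨fun H => ?_, fun H => magnusRep_of_lt s ?_⟩
  · have := magnusRepRight_of_lt s (SeriesLT.of_map (magnusRep_of_lt s) H)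
    simpa using this
  · exact SeriesLT.of_map (magnusRepRight_of_lt s) (by simpa using H)

theorem magnusSeries_conj_lt [WellFoundedLT α] (u : FreeGroup α) : ∀ {g h : FreeGroup α},
    SeriesLT (magnusSeries (u * g * u⁻¹)) (magnusSeries (u * h * u⁻¹)) ↔
      SeriesLT (magnusSeries g) (magnusSeries h) := by
  induction u using FreeGroup.induction_on with
  | C1 => simp
  | of s => exact magnusSeries_conj_of_lt s
  | inv_of s ih =>
    intro g h
    rw [← magnusSeries_conj_of_lt s]
    simp [mul_assoc]
  | mul x y hx hy =>
    intro g h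
    have hconj : ∀ z, x * y * z * (x * y)⁻¹ = x * (y * z * y⁻¹) * x⁻¹ := fun z => by group
    rw [hconj, hconj, hx, hy]

theorem magnusRep_zpow_apply (s : α) (k : ℤ) (t : List α) (ht : t.head? ≠ some s) :
    ∀ a : List α → ℤ, magnusRep (FreeGroup.of s ^ k) a (s :: t) = a (s :: t) + k * a t ∧
      magnusRep (FreeGroup.of s ^ k) a t = a t := by
  induction k using Int.induction_on with
  | zero => simp
  | succ n ih =>
    intro a
    rw [zpow_add_one, map_mul, Equiv.Perm.mul_apply, (ih _).1, (ih _).2]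
    simp only [magnusRep_of_apply, ht]
    refine ⟨?_, by simp⟩
    simp only [List.head?_cons, List.tail_cons, if_true, if_false]
    ring
  | pred n ih =>
    intro a
    obtain ⟨b, rfl⟩ := (magnusRep (FreeGroup.of s)).surjective a
    have h := ih b
    rw [zpow_sub_one, ← Equiv.Perm.mul_apply, ← map_mul, inv_mul_cancel_right, h.1, h.2]
    simp only [magnusRep_of_apply, ht]
    refine ⟨?_, by simp⟩
    simp only [List.head?_cons, List.tail_cons, if_true, if_false]
    ring

theorem magnusSeries_word (w : Monoid.CoprodI.Word fun _ : α => FreeGroup Unit) :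
    magnusSeries (freeGroupEquivCoprodI.symm w.prod) (w.toList.map Sigma.fst) ≠ 0 ∧
      ∀ l : List α, l.IsChain (· ≠ ·) → w.toList.length < l.length →
        magnusSeries (freeGroupEquivCoprodI.symm w.prod) l = 0 := by
  induction w using Monoid.CoprodI.Word.consRecOn with
  | empty =>
    rw [Monoid.CoprodI.Word.prod_empty, map_one]
    refine ⟨by simp [magnusSeries, Monoid.CoprodI.Word.empty], fun l _ hl => ?_⟩
    have : l ≠ [] := by rintro rfl; simp at hl
    simp [magnusSeries, this]
  | cons s m w hw hm ih =>
    obtain ⟨k, rfl⟩ : ∃ k : ℤ, m = FreeGroup.of () ^ k :=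
      ⟨_, (FreeGroup.freeGroupUnitEquivInt.symm_apply_apply m).symm⟩
    have hk : k ≠ 0 := by rintro rfl; simp at hm
    have hprod : freeGroupEquivCoprodI.symm
        (Monoid.CoprodI.of (i := s) (FreeGroup.of () ^ k) * w.prod) =
        FreeGroup.of s ^ k * freeGroupEquivCoprodI.symm w.prod := by
      simp
    have hc := (Monoid.CoprodI.Word.cons (M := fun _ : α => FreeGroup Unit)
      (FreeGroup.of () ^ k) w hw hm).chain_ne
    rw [Monoid.CoprodI.Word.prod_cons, hprod]
    set g := freeGroupEquivCoprodI.symm w.prod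
    have hmul : magnusSeries (FreeGroup.of s ^ k * g) =
        magnusRep (FreeGroup.of s ^ k) (magnusSeries g) := by
      rw [magnusSeries, map_mul]; rfl
    have hhead : (w.toList.map Sigma.fst).head? ≠ some s := by
      rw [List.head?_map]; exact hw
    have hchain : (s :: w.toList.map Sigma.fst).IsChain (· ≠ ·) := by
      have := (List.isChain_map (R := fun x y : α => x ≠ y) Sigma.fst).2 hc
      exact this
    rw [hmul]
    refine ⟨?_, fun l hl hlen => ?_⟩
    · have h := (magnusRep_zpow_apply s k _ hhead (magnusSeries g)).1
      have h0 := ih.2 _ hchain (by simp)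
      rw [h0, zero_add] at h
      exact h ▸ mul_ne_zero hk ih.1
    · have hlen' : w.toList.length + 1 < l.length := hlen
      by_cases hs : l.head? = some s
      · obtain ⟨t, rfl⟩ : ∃ t, l = s :: t := by
          cases l with
          | nil => simp at hs
          | cons x t => simp at hs; exact ⟨t, by rw [hs]⟩
        have ht : t.head? ≠ some s := by
          cases t with
          | nil => simp
          | cons y t =>
            have := (List.isChain_cons_cons.1 hl).1
            simpa using this.symm
        rw [(magnusRep_zpow_apply s k t ht _).1, ih.2 _ hl (by omega),
          ih.2 t hl.tail (by simp at hlen'; omega)]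
        simp
      · rw [(magnusRep_zpow_apply s k l hs _).2, ih.2 l hl (by omega)]

theorem magnusSeries_injective : Function.Injective (magnusSeries (α := α)) := by
  have key : ∀ g : FreeGroup α, magnusSeries g = Pi.single [] 1 → g = 1 := by
    intro g hg
    obtain ⟨w, hw⟩ := Monoid.CoprodI.Word.equiv.symm.surjective (freeGroupEquivCoprodI g)
    have hw' : freeGroupEquivCoprodI.symm w.prod = g := by
      rw [MulEquiv.symm_apply_eq]; exact hw
    have h := (magnusSeries_word w).1
    rw [hw', hg] at h
    have hnil : w.toList = [] := by
      by_contra hne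
      exact h (Pi.single_eq_of_ne (by simpa using hne) _)
    have : w = Monoid.CoprodI.Word.empty := Monoid.CoprodI.Word.ext hnil
    rw [← hw', this, Monoid.CoprodI.Word.prod_empty, map_one]
  intro g h hgh
  refine (inv_mul_eq_one.1 (key (g⁻¹ * h) ?_))
  rw [magnusSeries, map_mul, Equiv.Perm.mul_apply]
  change magnusRep g⁻¹ (magnusSeries h) = _
  rw [← hgh, map_inv]
  exact Equiv.symm_apply_apply _ _

end MagnusOrder

/-- A free group on a well-ordered set is bi-orderable. -/
theorem FreeGroup.exists_linearOrder_conj_lt (α : Type*) [LinearOrder α] [WellFoundedLT α] :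
    ∃ _ : LinearOrder (FreeGroup α), ∀ u g h : FreeGroup α,
      u * g * u⁻¹ < u * h * u⁻¹ ↔ g < h := by
  let r : FreeGroup α → FreeGroup α → Prop := fun g h => SeriesLT (magnusSeries g) (magnusSeries h)
  have : IsStrictTotalOrder (FreeGroup α) r :=
    { irrefl := fun g => SeriesLT.irrefl _
      trans := fun _ _ _ => SeriesLT.trans
      trichotomous := fun g h h₁ h₂ => magnusSeries_injective <| by
        rcases SeriesLT.trichotomous (magnusSeries g) (magnusSeries h) with h | h | h
        exacts [(h₁ h).elim, h, (h₂ h).elim] }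
  classical exact ⟨linearOrderOfSTO r, fun u g h => magnusSeries_conj_lt u⟩


section Stacking

open Finset

/-- The counting argument for stackings: closed strands indexed by `C`, each with `n` vertices and
`n` edges, are mapped to vertices and edges of a graph, in such a way that the strands through
each vertex, and through each edge, are linearly ordered by the ranks `ρ`. If no edge is covered
only once, then the image has at least `#C` more edges than vertices. -/
theorem card_vertices_add_card_le_card_edges {K E V Λ : Type*} [DecidableEq E] [DecidableEq V]
    [LinearOrder Λ] {n : ℕ} [NeZero n] (C : Finset K) (e : K → ZMod n → E) (p : K → ZMod n → V)
    (ρ : ZMod n → Λ) (src tgt : ZMod n → ZMod n) (hρ : Function.Injective ρ)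
    (hst : ∀ i, (src i = i ∧ tgt i = i + 1) ∨ (src i = i + 1 ∧ tgt i = i))
    (hp : ∀ i k k', p k i = p k' i → k = k')
    (hsrc : ∀ k k' i j, e k i = e k' j → p k (src i) = p k' (src j))
    (htgt : ∀ k k' i j, e k i = e k' j → p k (tgt i) = p k' (tgt j))
    (hlt : ∀ k k' i j, e k i = e k' j → (ρ (src i) < ρ (src j) ↔ ρ (tgt i) < ρ (tgt j)))
    (hinj : ∀ k k' i j, e k i = e k' j → src i = src j → i = j)
    (hfree : ∀ k ∈ C, ∀ i, ∃ k' ∈ C, ∃ j, (k', j) ≠ (k, i) ∧ e k' j = e k i) :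
    #((C ×ˢ univ).image fun x : K × ZMod n => p x.1 x.2) + #C ≤
      #((C ×ˢ univ).image fun x : K × ZMod n => e x.1 x.2) := by
  classical
  let AV : K → Finset (ZMod n) := fun k =>
    univ.filter fun i => ∀ k' ∈ C, ∀ j, p k' j = p k i → ρ j ≤ ρ i
  let AE : K → Finset (ZMod n) := fun k =>
    univ.filter fun i => ∀ k' ∈ C, ∀ j, e k' j = e k i → ρ (src j) ≤ ρ (src i)
  have mem_AV : ∀ {k i}, i ∈ AV k ↔ ∀ k' ∈ C, ∀ j, p k' j = p k i → ρ j ≤ ρ i := by simp [AV]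
  have mem_AE : ∀ {k i}, i ∈ AE k ↔ ∀ k' ∈ C, ∀ j, e k' j = e k i → ρ (src j) ≤ ρ (src i) := by
    simp [AE]
  have hV : #((C ×ˢ univ).image fun x : K × ZMod n => p x.1 x.2) ≤ ∑ k ∈ C, #(AV k) := by
    rw [← Finset.card_sigma]
    refine (Finset.card_le_card (t := (C.sigma AV).image fun x => p x.1 x.2) ?_).trans
      Finset.card_image_le
    intro v hv
    obtain ⟨⟨k, i⟩, hki, rfl⟩ := Finset.mem_image.1 hv
    obtain ⟨⟨k', j⟩, hk', hmax⟩ := Finset.exists_max_image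
      ((C ×ˢ univ).filter fun x : K × ZMod n => p x.1 x.2 = p k i) (fun x => ρ x.2)
      ⟨(k, i), by simpa using hki⟩
    simp only [mem_filter, mem_product, mem_univ, and_true] at hk' hmax
    refine Finset.mem_image.2 ⟨⟨k', j⟩, Finset.mem_sigma.2 ⟨hk'.1, mem_AV.2 ?_⟩, hk'.2⟩
    exact fun k'' hk'' j' h => hmax (k'', j') ⟨hk'', h.trans hk'.2⟩
  have hE : ∑ k ∈ C, #(AE k) ≤ #((C ×ˢ univ).image fun x : K × ZMod n => e x.1 x.2) := by
    rw [← Finset.card_sigma]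
    refine Finset.card_le_card_of_injOn (fun x => e x.1 x.2) ?_ ?_
    · rintro ⟨k, i⟩ h
      exact Finset.mem_coe.2 (Finset.mem_image.2 ⟨(k, i),
        by simpa using (Finset.mem_sigma.1 h).1, rfl⟩)
    · rintro ⟨k, i⟩ h ⟨k', j⟩ h' heq
      have hk := Finset.mem_sigma.1 (Finset.mem_coe.1 h)
      have hk' := Finset.mem_sigma.1 (Finset.mem_coe.1 h')
      have heq : e k i = e k' j := heq
      have h1 : src i = src j := hρ (le_antisymm (mem_AE.1 hk'.2 k hk.1 i heq)
        (mem_AE.1 hk.2 k' hk'.1 j heq.symm))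
      have h2 := hsrc _ _ _ _ heq
      obtain rfl := hinj _ _ _ _ heq h1
      obtain rfl := hp _ _ _ h2
      rfl
  have hle : ∀ {k k' i j}, e k' j = e k i →
      (ρ (src j) ≤ ρ (src i) ↔ ρ (tgt j) ≤ ρ (tgt i)) := fun h => by
    rw [← not_lt, ← not_lt, hlt _ _ _ _ h.symm]
  have hsrcAE : ∀ k i, src i ∈ AV k → i ∈ AE k := fun k i h => mem_AE.2 fun k' hk' j hj =>
    mem_AV.1 h k' hk' _ (hsrc _ _ _ _ hj)
  have htgtAE : ∀ k i, tgt i ∈ AV k → i ∈ AE k := fun k i h => mem_AE.2 fun k' hk' j hj =>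
    (hle hj).2 (mem_AV.1 h k' hk' _ (htgt _ _ _ _ hj))
  have hcard : ∀ k ∈ C, #(AV k) + 1 ≤ #(AE k) := by
    intro k hk
    have hsub : AV k ⊆ AE k := fun i hi => by
      rcases hst i with h | h
      · exact hsrcAE k i (h.1.symm ▸ hi)
      · exact htgtAE k i (h.2.symm ▸ hi)
    by_contra hlt'
    have heq : AV k = AE k := Finset.eq_of_subset_of_card_le hsub (by omega)
    have hstep : ∀ i, i + 1 ∈ AV k → i ∈ AV k := fun i hi => by
      rw [heq]
      rcases hst i with h | h
      · exact htgtAE k i (h.2.symm ▸ hi)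
      · exact hsrcAE k i (h.1.symm ▸ hi)
    obtain ⟨m, -, hm⟩ := Finset.exists_max_image (univ : Finset (ZMod n)) ρ univ_nonempty
    have hall : ∀ d : ℕ, m - d ∈ AV k := by
      intro d
      induction d with
      | zero => exact mem_AV.2 fun k' _ j _ => by simpa using hm j (mem_univ j)
      | succ d ih => exact hstep _ (by push_cast; convert ih using 1; ring)
    obtain ⟨l, -, hl⟩ := Finset.exists_min_image (univ : Finset (ZMod n)) ρ univ_nonempty
    have hlAV : l ∈ AV k := by
      have := hall (m - l).val
      simpa using this
    obtain ⟨k', hk', j, hne, hj⟩ := hfree k hk l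
    have huniq : ∀ j', p k' j' = p k l → j' = l ∧ k' = k := fun j' h => by
      have : j' = l := hρ (le_antisymm (mem_AV.1 hlAV k' hk' j' h) (hl j' (mem_univ j')))
      subst this
      exact ⟨rfl, hp _ _ _ h⟩
    have : src j = src l ∧ k' = k := by
      rcases hst l with h | h
      · have := huniq (src j) (by rw [hsrc _ _ _ _ hj, h.1])
        exact ⟨this.1.trans h.1.symm, this.2⟩
      · have := huniq (tgt j) (by rw [htgt _ _ _ _ hj, h.2])
        have ht : tgt j = tgt l := this.1.trans h.2.symm
        refine ⟨hρ (le_antisymm ((hle hj).2 (by rw [ht])) ((hle hj.symm).2 (by rw [ht]))), this.2⟩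
    exact hne (by rw [this.2, hinj _ _ _ _ hj this.1])
  calc _ ≤ ∑ k ∈ C, #(AV k) + #C := by gcongr
    _ = ∑ k ∈ C, (#(AV k) + 1) := by simp [Finset.sum_add_distrib]
    _ ≤ ∑ k ∈ C, #(AE k) := Finset.sum_le_sum hcard
    _ ≤ _ := hE

end Stacking

section CellBoundaries

open Finset

/-- The boundary map of a directed graph with source map `s` and target map `t`. -/
noncomputable def graphBoundary {E V : Type*} (s t : E → V) : (E →₀ ℚ) →ₗ[ℚ] (V →₀ ℚ) :=
  Finsupp.linearCombination ℚ fun x => Finsupp.single (t x) 1 - Finsupp.single (s x) 1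

theorem card_edges_lt {E V : Type*} [DecidableEq V] (s t : E → V) (A : Finset E) (W : Finset V)
    (hW : W.Nonempty) (hs : ∀ x ∈ A, s x ∈ W) (ht : ∀ x ∈ A, t x ∈ W) (D : Finset (E →₀ ℚ))
    (hD : ∀ z : E →₀ ℚ, z.support ⊆ A → graphBoundary s t z = 0 →
      z ∈ Submodule.span ℚ (D : Set (E →₀ ℚ))) :
    #A < #W + #D := by
  classical
  let S : Submodule ℚ (E →₀ ℚ) := Finsupp.supported ℚ ℚ (A : Set E)
  have hS : Module.finrank ℚ S = #A := by
    rw [LinearEquiv.finrank_eq (Finsupp.supportedEquivFinsupp (M := ℚ) (R := ℚ) (A : Set E))]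
    simp
  have : FiniteDimensional ℚ S :=
    (Finsupp.supportedEquivFinsupp (M := ℚ) (R := ℚ) (A : Set E)).symm.finiteDimensional
  let T : Submodule ℚ (V →₀ ℚ) := Finsupp.supported ℚ ℚ (W : Set V)
  have hT : Module.finrank ℚ T = #W := by
    rw [LinearEquiv.finrank_eq (Finsupp.supportedEquivFinsupp (M := ℚ) (R := ℚ) (W : Set V))]
    simp
  have : FiniteDimensional ℚ T :=
    (Finsupp.supportedEquivFinsupp (M := ℚ) (R := ℚ) (W : Set V)).symm.finiteDimensional
  let f : S →ₗ[ℚ] (V →₀ ℚ) := (graphBoundary s t).domRestrict S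
  have hrank := LinearMap.finrank_range_add_finrank_ker f
  have hker : Module.finrank ℚ (LinearMap.ker f) ≤ #D := by
    have h1 : (LinearMap.ker f).map S.subtype ≤ Submodule.span ℚ (D : Set (E →₀ ℚ)) := by
      rintro _ ⟨z, hz, rfl⟩
      exact hD _ (Finset.coe_subset.1 ((Finsupp.mem_supported ℚ _).1 z.2)) hz
    rw [(Submodule.equivMapOfInjective S.subtype S.injective_subtype
      (LinearMap.ker f)).finrank_eq]
    exact (Submodule.finrank_mono h1).trans (finrank_span_finset_le_card D)
  have hrange : Module.finrank ℚ (LinearMap.range f) < #W := by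
    rw [← hT]
    apply Submodule.finrank_lt_finrank_of_lt
    have hle : ∀ x ∈ A, Finsupp.single (t x) (1 : ℚ) - Finsupp.single (s x) 1 ∈
        T ⊓ LinearMap.ker (Finsupp.linearCombination ℚ fun _ : V => (1 : ℚ)) := by
      intro x hx
      refine ⟨T.sub_mem (Finsupp.single_mem_supported ℚ _ (ht x hx))
        (Finsupp.single_mem_supported ℚ _ (hs x hx)), ?_⟩
      simp
    have hle' : LinearMap.range f ≤
        T ⊓ LinearMap.ker (Finsupp.linearCombination ℚ fun _ : V => (1 : ℚ)) := by
      rintro _ ⟨z, rfl⟩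
      change graphBoundary s t z.1 ∈ _
      rw [graphBoundary, Finsupp.linearCombination_apply]
      refine Submodule.sum_mem _ fun x hx => Submodule.smul_mem _ _ (hle x ?_)
      exact (Finsupp.mem_supported ℚ _).1 z.2 hx
    refine lt_of_le_of_lt hle' (lt_of_le_of_ne inf_le_left fun heq => ?_)
    obtain ⟨v, hv⟩ := hW
    have h1 : Finsupp.single v (1 : ℚ) ∈ T := Finsupp.single_mem_supported ℚ _ hv
    rw [← heq] at h1
    simpa using h1.2
  omega

theorem linearIndepOn_cellBoundary {K E V Λ : Type*} [DecidableEq E] [DecidableEq V]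
    [LinearOrder Λ] {n : ℕ} [NeZero n] (s t : E → V) (e : K → ZMod n → E) (p : K → ZMod n → V)
    (ρ : ZMod n → Λ) (src tgt : ZMod n → ZMod n) (hρ : Function.Injective ρ)
    (hst : ∀ i, (src i = i ∧ tgt i = i + 1) ∨ (src i = i + 1 ∧ tgt i = i))
    (hp : ∀ i k k', p k i = p k' i → k = k')
    (hs : ∀ k i, s (e k i) = p k (src i)) (ht : ∀ k i, t (e k i) = p k (tgt i))
    (hlt : ∀ k k' i j, e k i = e k' j → (ρ (src i) < ρ (src j) ↔ ρ (tgt i) < ρ (tgt j)))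
    (hinj : ∀ k k' i j, e k i = e k' j → src i = src j → i = j)
    (sgn : ZMod n → ℚ) (hsgn : ∀ i, sgn i ≠ 0) (C : Finset K)
    (hC : ∀ z : E →₀ ℚ, z.support ⊆ ((C ×ˢ univ).image fun x : K × ZMod n => e x.1 x.2) →
      graphBoundary s t z = 0 →
      z ∈ Submodule.span ℚ ((fun k => ∑ i, Finsupp.single (e k i) (sgn i)) '' C)) :
    LinearIndepOn ℚ (fun k => ∑ i, Finsupp.single (e k i) (sgn i)) (C : Set K) := by
  classical
  induction hc : #C generalizing C with
  | zero =>
    rw [Finset.card_eq_zero.1 hc, Finset.coe_empty]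
    exact linearIndepOn_empty ℚ _
  | succ m ih =>
    set d : K → E →₀ ℚ := fun k => ∑ i, Finsupp.single (e k i) (sgn i) with hd
    by_cases hfree : ∀ k ∈ C, ∀ i, ∃ k' ∈ C, ∃ j, (k', j) ≠ (k, i) ∧ e k' j = e k i
    · exfalso
      have h1 := card_vertices_add_card_le_card_edges C e p ρ src tgt hρ hst hp
        (fun k k' i j h => by rw [← hs, ← hs, h]) (fun k k' i j h => by rw [← ht, ← ht, h])
        hlt hinj hfree
      have hne : C.Nonempty := Finset.card_pos.1 (by omega)
      have h2 := card_edges_lt s t ((C ×ˢ univ).image fun x : K × ZMod n => e x.1 x.2)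
        ((C ×ˢ univ).image fun x : K × ZMod n => p x.1 x.2)
        ((hne.product univ_nonempty).image _)
        (by
          intro x hx
          obtain ⟨⟨k, i⟩, hki, rfl⟩ := Finset.mem_image.1 hx
          refine Finset.mem_image.2 ⟨(k, src i), ?_, (hs k i).symm⟩
          simpa using hki)
        (by
          intro x hx
          obtain ⟨⟨k, i⟩, hki, rfl⟩ := Finset.mem_image.1 hx
          refine Finset.mem_image.2 ⟨(k, tgt i), ?_, (ht k i).symm⟩
          simpa using hki)
        (C.image d) (by rw [Finset.coe_image]; exact hC)
      have h3 : #(C.image d) ≤ #C := Finset.card_image_le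
      omega
    · push Not at hfree
      obtain ⟨k, hk, i, hki⟩ := hfree
      have hki : ∀ k' ∈ C, ∀ j, e k' j = e k i → (k', j) = (k, i) := fun k' hk' j h => by
        by_contra hne
        exact hki k' hk' j hne h
      have hdk : d k (e k i) = sgn i := by
        rw [hd, Finsupp.finsetSum_apply, Finset.sum_eq_single i]
        · simp
        · intro j _ hj
          refine Finsupp.single_eq_of_ne fun h => hj ?_
          exact (Prod.ext_iff.1 (hki k hk j h.symm)).2
        · simp
      have hdk' : ∀ k' ∈ C.erase k, d k' (e k i) = 0 := by
        intro k' hk'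
        rw [hd, Finsupp.finsetSum_apply]
        refine Finset.sum_eq_zero fun j _ => Finsupp.single_eq_of_ne fun h => ?_
        exact (Finset.mem_erase.1 hk').1
          (Prod.ext_iff.1 (hki k' (Finset.mem_erase.1 hk').2 j h.symm)).1
      have hspan : ∀ z ∈ Submodule.span ℚ (d '' (C.erase k : Finset K)), z (e k i) = 0 := by
        intro z hz
        have : Submodule.span ℚ (d '' (C.erase k : Finset K)) ≤
            LinearMap.ker (Finsupp.lapply (R := ℚ) (M := ℚ) (e k i)) := by
          rw [Submodule.span_le]
          rintro _ ⟨k', hk', rfl⟩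
          exact hdk' k' hk'
        exact this hz
      have hins : (C : Set K) = insert k ((C.erase k : Finset K) : Set K) := by
        rw [← Finset.coe_insert, Finset.insert_erase hk]
      rw [hins, linearIndepOn_insert (by simp)]
      refine ⟨ih _ (fun z hz hz0 => ?_) (by rw [Finset.card_erase_of_mem hk, hc]; rfl), fun h => ?_⟩
      · have h1 := hC z (hz.trans (Finset.image_subset_image
          (Finset.product_subset_product_left (Finset.erase_subset _ _)))) hz0
        rw [hins, Set.image_insert_eq, Submodule.mem_span_insert] at h1
        obtain ⟨a, y, hy, rfl⟩ := h1
        have h2 : (a • d k + y) (e k i) = 0 := by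
          rw [← Finsupp.notMem_support_iff]
          intro hmem
          obtain ⟨⟨k', j⟩, hk'j, h⟩ := Finset.mem_image.1 (hz hmem)
          have hk' := (Finset.mem_product.1 hk'j).1
          exact (Finset.mem_erase.1 hk').1
            (Prod.ext_iff.1 (hki k' (Finset.mem_erase.1 hk').2 j h)).1
        rw [Finsupp.add_apply, hspan y hy, Finsupp.smul_apply, hdk, add_zero, smul_eq_mul] at h2
        have ha : a = 0 := (mul_eq_zero.1 h2).resolve_right (hsgn i)
        rw [ha, zero_smul, zero_add]
        exact hy
      · exact hsgn i (hdk.symm.trans (hspan _ h))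

end CellBoundaries

section PathChains

variable {α V : Type*} [MulAction (FreeGroup α) V]

/-- The permutation recording the passage along an edge with label `s` in the Schreier graph of an
action of the free group, whose edges `(v, s)` run from `v` to `s • v`. -/
noncomputable def edgeStep (V : Type*) [MulAction (FreeGroup α) V] (s : α) :
    Equiv.Perm (V × (V × α →₀ ℚ)) where
  toFun x := (FreeGroup.of s • x.1, x.2 + Finsupp.single (x.1, s) 1)
  invFun x := ((FreeGroup.of s)⁻¹ • x.1,
    x.2 - Finsupp.single ((FreeGroup.of s)⁻¹ • x.1, s) 1)
  left_inv x := by simp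
  right_inv x := by simp

/-- The chain of the path in the Schreier graph which starts at `v` and reads `g`. -/
noncomputable def pathChain (g : FreeGroup α) (v : V) : V × α →₀ ℚ :=
  (FreeGroup.lift (edgeStep V) g (v, 0)).2

theorem lift_edgeStep_apply (g : FreeGroup α) (v : V) (z : V × α →₀ ℚ) :
    FreeGroup.lift (edgeStep V) g (v, z) = (g • v, z + pathChain g v) := by
  suffices h : ∀ v : V, ∃ c, ∀ z, FreeGroup.lift (edgeStep V) g (v, z) = (g • v, z + c) by
    obtain ⟨c, hc⟩ := h v
    rw [pathChain, hc, hc, zero_add]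
  clear v z
  induction g using FreeGroup.induction_on with
  | C1 => exact fun v => ⟨0, fun z => by simp⟩
  | of s => exact fun v => ⟨Finsupp.single (v, s) 1, fun z => by simp [edgeStep]⟩
  | inv_of s _ =>
    refine fun v => ⟨-Finsupp.single ((FreeGroup.of s)⁻¹ • v, s) 1, fun z => ?_⟩
    rw [map_inv, FreeGroup.lift_apply_of, ← sub_eq_add_neg]
    rfl
  | mul g h hg hh =>
    intro v
    obtain ⟨c, hc⟩ := hh v
    obtain ⟨c', hc'⟩ := hg (h • v)
    exact ⟨c + c', fun z => by rw [map_mul, Equiv.Perm.mul_apply, hc, hc', mul_smul, add_assoc]⟩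

theorem pathChain_one (v : V) : pathChain (1 : FreeGroup α) v = 0 := by
  simp [pathChain]

theorem pathChain_mul (g h : FreeGroup α) (v : V) :
    pathChain (g * h) v = pathChain h v + pathChain g (h • v) := by
  rw [pathChain, map_mul, Equiv.Perm.mul_apply, lift_edgeStep_apply, lift_edgeStep_apply, zero_add]

theorem pathChain_of (s : α) (v : V) :
    pathChain (FreeGroup.of s) v = Finsupp.single (v, s) 1 := by
  simp [pathChain, edgeStep]

theorem pathChain_inv (g : FreeGroup α) (v : V) : pathChain g⁻¹ v = -pathChain g (g⁻¹ • v) := by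
  rw [eq_neg_iff_add_eq_zero, ← pathChain_mul, mul_inv_cancel, pathChain_one]

/-- The cycles in a connected Schreier graph are spanned by the loops at a base point which read
generators of the stabilizer of that point. -/
theorem mem_span_pathChain_of_graphBoundary_eq_zero (v₀ : V) (hv₀ : ∀ v : V, ∃ g : FreeGroup α,
    g • v₀ = v) (U : Set (FreeGroup α)) (hU : Subgroup.closure U = MulAction.stabilizer _ v₀)
    (z : V × α →₀ ℚ)
    (hz : graphBoundary (fun x => x.1) (fun x => FreeGroup.of x.2 • x.1) z = 0) :
    z ∈ Submodule.span ℚ ((fun g => pathChain g v₀) '' U) := by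
  set S := Submodule.span ℚ ((fun g => pathChain g v₀) '' U) with hS
  have hloop : ∀ g : FreeGroup α, g • v₀ = v₀ → pathChain g v₀ ∈ S := by
    intro g hg
    have hfix : ∀ g ∈ Subgroup.closure U, g • v₀ = v₀ := fun g hg =>
      MulAction.mem_stabilizer_iff.1 (hU ▸ hg)
    have hgU : g ∈ Subgroup.closure U := hU ▸ MulAction.mem_stabilizer_iff.2 hg
    clear hg
    induction hgU using Subgroup.closure_induction with
    | mem x hx => exact Submodule.subset_span ⟨x, hx, rfl⟩
    | one => rw [pathChain_one]; exact S.zero_mem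
    | mul x y hx hy ihx ihy =>
      rw [pathChain_mul, hfix y hy]
      exact S.add_mem ihy ihx
    | inv x hx ihx =>
      rw [pathChain_inv, hfix _ (inv_mem hx)]
      exact S.neg_mem ihx
  choose σ hσ using hv₀
  let ψ : (V →₀ ℚ) →ₗ[ℚ] (V × α →₀ ℚ) :=
    Finsupp.linearCombination ℚ fun v => pathChain (σ v) v₀
  have key : ∀ y : V × α →₀ ℚ,
      y - ψ (graphBoundary (fun x => x.1) (fun x => FreeGroup.of x.2 • x.1) y) ∈ S := by
    intro y
    induction y using Finsupp.induction_linear with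
    | zero => simp
    | add y y' hy hy' =>
      rw [map_add, map_add, add_sub_add_comm]
      exact S.add_mem hy hy'
    | single x c =>
      obtain ⟨v, s⟩ := x
      have h1 := hloop ((σ (FreeGroup.of s • v))⁻¹ * (FreeGroup.of s * σ v))
        (by rw [mul_smul, mul_smul, hσ, inv_smul_eq_iff, hσ])
      rw [pathChain_mul, pathChain_inv, pathChain_mul, mul_smul, hσ, pathChain_of] at h1
      rw [inv_smul_eq_iff.2 (hσ (FreeGroup.of s • v)).symm] at h1
      have h2 := S.smul_mem c h1
      convert h2 using 1
      rw [graphBoundary, Finsupp.linearCombination_single, map_smul, map_sub]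
      simp only [ψ, Finsupp.linearCombination_single, one_smul, smul_add, smul_sub, smul_neg,
        Finsupp.smul_single, smul_eq_mul, mul_one]
      abel
  simpa [hz] using key z

end PathChains

section CyclicWords

theorem List.exists_eq_flatten_replicate_of_append_comm {β : Type*} (p q : List β)
    (h : p ++ q = q ++ p) :
    ∃ (z : List β) (a b : ℕ), p = (List.replicate a z).flatten ∧
      q = (List.replicate b z).flatten := by
  induction hk : p.length + q.length using Nat.strong_induction_on generalizing p q with
  | _ k ih =>
    wlog hle : p.length ≤ q.length generalizing p q
    · obtain ⟨z, a, b, h1, h2⟩ := this q p h.symm (by omega) (by omega)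
      exact ⟨z, b, a, h2, h1⟩
    rcases Nat.eq_zero_or_pos p.length with hp | hp
    · exact ⟨q, 0, 1, by simpa using hp, by simp⟩
    · obtain ⟨q', rfl⟩ : p <+: q :=
        List.prefix_of_prefix_length_le (List.prefix_append p q) (h ▸ List.prefix_append q p) hle
      rw [List.append_assoc, List.append_cancel_left_eq] at h
      obtain ⟨z, a, b, h1, h2⟩ := ih (p.length + q'.length)
        (by rw [List.length_append] at hk; omega) p q' h rfl
      exact ⟨z, a, a + b, h1, by rw [List.replicate_add, List.flatten_append, ← h1, ← h2]⟩

namespace FreeGroup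

variable {α : Type*}

theorem mk_flatten_replicate (z : List (α × Bool)) (a : ℕ) :
    mk (List.replicate a z).flatten = mk z ^ a := by
  induction a with
  | zero => rfl
  | succ a ih => rw [List.replicate_succ, List.flatten_cons, ← mul_mk, ih, pow_succ']

theorem IsCyclicallyReduced.isReduced_rotate {L : List (α × Bool)} (hL : IsCyclicallyReduced L)
    {i : ℕ} (hi : i < L.length) : IsReduced (L.rotate i) := by
  rw [List.rotate_eq_drop_append_take hi.le]
  rcases Nat.eq_zero_or_pos i with rfl | hi0
  · simpa using hL.isReduced
  · refine List.isChain_append.2 ⟨hL.isReduced.drop i, hL.isReduced.take i, fun a ha b hb => ?_⟩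
    refine hL.2 a ?_ b ?_
    · rwa [List.getLast?_drop, if_neg (by omega)] at ha
    · rwa [List.head?_take, if_neg (by omega)] at hb

theorem rotate_ne_rotate_of_not_power {L : List (α × Bool)}
    (hnp : ∀ (w : FreeGroup α) (k : ℤ), mk L = w ^ k → |k| ≤ 1) {i j : ℕ} (hij : i < j)
    (hj : j < L.length) : L.rotate i ≠ L.rotate j := by
  intro h
  obtain ⟨d, rfl⟩ := Nat.exists_eq_add_of_lt hij
  have h1 : L = L.rotate (d + 1) := by
    apply List.rotate_injective i
    change L.rotate i = (L.rotate (d + 1)).rotate i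
    rw [List.rotate_rotate, h]
    congr 1
    omega
  rw [List.rotate_eq_drop_append_take (by omega)] at h1
  nth_rewrite 1 [← List.take_append_drop (d + 1) L] at h1
  obtain ⟨z, a, b, ha, hb⟩ := List.exists_eq_flatten_replicate_of_append_comm _ _ h1
  have h2 : mk L = mk z ^ ((a + b : ℕ) : ℤ) := by
    rw [zpow_natCast, ← mk_flatten_replicate, List.replicate_add, List.flatten_append, ← ha, ← hb,
      List.take_append_drop]
  have h3 := hnp _ _ h2
  have ha0 : a ≠ 0 := by
    rintro rfl
    have := congr_arg List.length ha
    simp only [List.length_take, List.replicate_zero, List.flatten_nil, List.length_nil] at this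
    omega
  have hb0 : b ≠ 0 := by
    rintro rfl
    have := congr_arg List.length hb
    simp only [List.length_drop, List.replicate_zero, List.flatten_nil, List.length_nil] at this
    omega
  rw [abs_of_nonneg (by positivity)] at h3
  omega

theorem mk_rotate (L : List (α × Bool)) {i : ℕ} (hi : i ≤ L.length) :
    mk (L.rotate i) = (mk (L.take i))⁻¹ * mk L * mk (L.take i) := by
  rw [List.rotate_eq_drop_append_take hi, ← mul_mk]
  congr 1
  rw [eq_inv_mul_iff_mul_eq, mul_mk, List.take_append_drop]

end FreeGroup

end CyclicWords

section CyclicWordLoops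

open Finset

theorem ZMod.val_add_one_or {n : ℕ} [NeZero n] (i : ZMod n) :
    (i + 1).val = i.val + 1 ∨ i.val + 1 = n ∧ i + 1 = 0 := by
  have hcast : i + 1 = ((i.val + 1 : ℕ) : ZMod n) := by
    rw [Nat.cast_add, ZMod.natCast_zmod_val, Nat.cast_one]
  rcases Nat.lt_or_ge (i.val + 1) n with h | h
  · exact Or.inl (by rw [hcast, ZMod.val_cast_of_lt h])
  · have hi : i.val + 1 = n := le_antisymm i.val_lt h
    exact Or.inr ⟨hi, by rw [hcast, hi, ZMod.natCast_self]⟩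

namespace FreeGroup

variable {α : Type*} (L : List (α × Bool)) [NeZero L.length]

/-- The `i`-th letter of the cyclic word `L`. -/
def cyclicLetter (i : ZMod L.length) : α × Bool := L[i.val]'i.val_lt

/-- The element of the free group given by the first `i` letters of the cyclic word `L`. -/
def cyclicPrefix (i : ZMod L.length) : FreeGroup α := mk (L.take i.val)

theorem mk_take_succ (i : ZMod L.length) :
    mk (L.take (i.val + 1)) = cyclicPrefix L i * mk [cyclicLetter L i] := by
  rw [cyclicPrefix, cyclicLetter, mul_mk, List.take_append_getElem]

theorem cyclicPrefix_mul_letter (i : ZMod L.length) :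
    cyclicPrefix L i * mk [cyclicLetter L i] = cyclicPrefix L (i + 1) ∨
      cyclicPrefix L i * mk [cyclicLetter L i] = mk L * cyclicPrefix L (i + 1) := by
  rw [← mk_take_succ, cyclicPrefix]
  rcases ZMod.val_add_one_or i with h | ⟨h, h0⟩
  · exact Or.inl (by rw [h])
  · right
    rw [h0, ZMod.val_zero, List.take_zero, ← one_eq_mk, mul_one, h, List.take_length]

theorem cyclicPrefix_succ_inv_smul {V : Type*} [MulAction (FreeGroup α) V] {v : V}
    (hv : mk L • v = v) (i : ZMod L.length) :
    (cyclicPrefix L (i + 1))⁻¹ • v = (mk [cyclicLetter L i])⁻¹ • (cyclicPrefix L i)⁻¹ • v := by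
  rw [smul_smul, ← mul_inv_rev]
  rcases cyclicPrefix_mul_letter L i with h | h
  · rw [h]
  · rw [h, mul_inv_rev, mul_smul, inv_smul_eq_iff.2 hv.symm]

theorem cyclicPrefix_succ_conj (i : ZMod L.length) :
    (cyclicPrefix L (i + 1))⁻¹ * mk L * cyclicPrefix L (i + 1) =
      (mk [cyclicLetter L i])⁻¹ * ((cyclicPrefix L i)⁻¹ * mk L * cyclicPrefix L i) *
        mk [cyclicLetter L i] := by
  have h1 : (mk [cyclicLetter L i])⁻¹ * ((cyclicPrefix L i)⁻¹ * mk L * cyclicPrefix L i) *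
      mk [cyclicLetter L i] = (cyclicPrefix L i * mk [cyclicLetter L i])⁻¹ * mk L *
        (cyclicPrefix L i * mk [cyclicLetter L i]) := by group
  rw [h1]
  rcases cyclicPrefix_mul_letter L i with h | h
  · rw [h]
  · rw [h]
    group

variable {L} in
theorem IsCyclicallyReduced.cyclicLetter_snd_eq (hL : IsCyclicallyReduced L) (i : ZMod L.length)
    (h : (cyclicLetter L i).1 = (cyclicLetter L (i + 1)).1) :
    (cyclicLetter L i).2 = (cyclicLetter L (i + 1)).2 := by
  rcases ZMod.val_add_one_or i with h1 | ⟨h1, h0⟩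
  · have h2 := (List.isChain_iff_getElem.1 hL.isReduced) i.val (h1 ▸ (i + 1).val_lt)
    simp only [cyclicLetter, h1] at h ⊢
    exact h2 h
  · refine hL.2 _ ?_ _ ?_ h
    · rw [List.getLast?_eq_getElem?, Nat.sub_eq_of_eq_add h1.symm, cyclicLetter, Option.mem_def,
        List.getElem?_eq_getElem]
    · rw [h0, cyclicLetter, Option.mem_def, List.head?_eq_getElem?, List.getElem?_eq_some_iff]
      exact ⟨Nat.pos_of_neZero _, by simp only [ZMod.val_zero]⟩

theorem pathChain_mk_eq_sum {V : Type*} [MulAction (FreeGroup α) V] {v : V}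
    (hv : mk L • v = v) :
    pathChain (mk L) v =
      ∑ i, pathChain (mk [cyclicLetter L i]) ((cyclicPrefix L (i + 1))⁻¹ • v) := by
  have key : ∀ k ≤ L.length, pathChain (mk (L.take k)) ((mk (L.take k))⁻¹ • v) =
      ∑ i : ZMod L.length with i.val < k,
        pathChain (mk [cyclicLetter L i]) ((cyclicPrefix L (i + 1))⁻¹ • v) := by
    intro k hk
    induction k with
    | zero => simp [← one_eq_mk, pathChain_one]
    | succ k ih =>
      have hval : (k : ZMod L.length).val = k := ZMod.val_cast_of_lt hk
      have hfilter : (univ.filter fun i : ZMod L.length => i.val < k + 1) =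
          insert (k : ZMod L.length) (univ.filter fun i : ZMod L.length => i.val < k) := by
        ext i
        have : i = k ↔ i.val = k := by
          rw [← (ZMod.val_injective _).eq_iff, hval]
        simp only [mem_filter, mem_univ, true_and, mem_insert, this]
        omega
      rw [hfilter, sum_insert (by simp [hval]), ← ih (by omega)]
      have h1 := mk_take_succ L k
      rw [hval] at h1
      rw [h1, pathChain_mul, mul_inv_rev, mul_smul, cyclicPrefix_succ_inv_smul L hv, smul_inv_smul,
        cyclicPrefix, hval]
  have h1 := key _ le_rfl
  rw [List.take_length, inv_smul_eq_iff.2 hv.symm] at h1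
  rw [h1]
  congr 1
  ext i
  simp [i.val_lt]

variable {L} in
theorem cyclicPrefix_conj_injective (hL : IsCyclicallyReduced L)
    (hnp : ∀ (w : FreeGroup α) (k : ℤ), mk L = w ^ k → |k| ≤ 1) :
    Function.Injective fun i => (cyclicPrefix L i)⁻¹ * mk L * cyclicPrefix L i := by
  classical
  intro i j h
  simp only [cyclicPrefix] at h
  rw [← mk_rotate L i.val_lt.le, ← mk_rotate L j.val_lt.le] at h
  have h1 := reduce.sound h
  rw [(hL.isReduced_rotate i.val_lt).reduce_eq, (hL.isReduced_rotate j.val_lt).reduce_eq] at h1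
  by_contra hne
  rcases lt_or_gt_of_ne (fun h => hne (ZMod.val_injective _ h)) with hlt | hlt
  · exact rotate_ne_rotate_of_not_power hnp hlt j.val_lt h1
  · exact rotate_ne_rotate_of_not_power hnp hlt i.val_lt h1.symm

/-- Loops in a Schreier graph which read a cyclically reduced word are linearly independent if they
span the cycles which they support. -/
theorem linearIndepOn_pathChain {V : Type*} [MulAction (FreeGroup α) V]
    [LinearOrder (FreeGroup α)] (hconj : ∀ u g h : FreeGroup α, u * g * u⁻¹ < u * h * u⁻¹ ↔ g < h)
    (hL : IsCyclicallyReduced L) (hnp : ∀ (w : FreeGroup α) (k : ℤ), mk L = w ^ k → |k| ≤ 1)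
    (C : Finset {v : V // mk L • v = v})
    (hC : ∀ z : V × α →₀ ℚ,
      graphBoundary (fun x => x.1) (fun x => FreeGroup.of x.2 • x.1) z = 0 →
      z ∈ Submodule.span ℚ ((fun v : {v : V // mk L • v = v} => pathChain (mk L) v.1) '' C)) :
    LinearIndepOn ℚ (fun v : {v : V // mk L • v = v} => pathChain (mk L) v.1) C := by
  classical
  let src : ZMod L.length → ZMod L.length := fun i => if (cyclicLetter L i).2 then i + 1 else i
  let tgt : ZMod L.length → ZMod L.length := fun i => if (cyclicLetter L i).2 then i else i + 1
  let p : {v : V // mk L • v = v} → ZMod L.length → V := fun v i => (cyclicPrefix L i)⁻¹ • v.1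
  let ρ : ZMod L.length → FreeGroup α := fun i => (cyclicPrefix L i)⁻¹ * mk L * cyclicPrefix L i
  let e : {v : V // mk L • v = v} → ZMod L.length → V × α :=
    fun v i => (p v (src i), (cyclicLetter L i).1)
  let sgn : ZMod L.length → ℚ := fun i => if (cyclicLetter L i).2 then 1 else -1
  have hletter : ∀ i, mk [cyclicLetter L i] = if (cyclicLetter L i).2 then
      of (cyclicLetter L i).1 else (of (cyclicLetter L i).1)⁻¹ := by
    intro i
    rcases cyclicLetter L i with ⟨s, _ | _⟩ <;> rfl
  have htgt : ∀ v i, of (cyclicLetter L i).1 • p v (src i) = p v (tgt i) := by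
    intro v i
    have h := cyclicPrefix_succ_inv_smul L v.2 i
    rw [hletter] at h
    by_cases hb : (cyclicLetter L i).2
    · simp only [hb, if_true, p, src, tgt] at h ⊢
      rw [h, smul_inv_smul]
    · simp only [hb, p, src, tgt] at h ⊢
      simp [h]
  have hρtgt : ∀ i, ρ (tgt i) =
      of (cyclicLetter L i).1 * ρ (src i) * (of (cyclicLetter L i).1)⁻¹ := by
    intro i
    have h := cyclicPrefix_succ_conj L i
    rw [hletter] at h
    by_cases hb : (cyclicLetter L i).2
    · simp only [hb, if_true, ρ, src, tgt] at h ⊢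
      rw [h]
      group
    · simp only [Bool.not_eq_true] at hb
      simp only [hb, ρ, src, tgt] at h ⊢
      simpa using h
  have hd : (fun v : {v : V // mk L • v = v} => pathChain (mk L) v.1) =
      fun v => ∑ i, Finsupp.single (e v i) (sgn i) := by
    funext v
    rw [pathChain_mk_eq_sum L v.2]
    refine sum_congr rfl fun i _ => ?_
    have h := cyclicPrefix_succ_inv_smul L v.2 i
    rw [hletter] at h ⊢
    by_cases hb : (cyclicLetter L i).2
    · simp only [hb, if_true, e, p, src, sgn, pathChain_of]
    · simp only [Bool.not_eq_true] at hb
      simp only [hb, e, p, src, sgn] at h ⊢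
      simp [h, pathChain_inv, pathChain_of]
  have hst : ∀ i, src i = i ∧ tgt i = i + 1 ∨ src i = i + 1 ∧ tgt i = i := by
    intro i
    by_cases hb : (cyclicLetter L i).2 <;> simp [src, tgt, hb]
  have hlt : ∀ v v' i j, e v i = e v' j → (ρ (src i) < ρ (src j) ↔ ρ (tgt i) < ρ (tgt j)) := by
    intro v v' i j h
    have h1 : (cyclicLetter L i).1 = (cyclicLetter L j).1 := (Prod.ext_iff.1 h).2
    rw [hρtgt, hρtgt, h1, hconj]
  have hinj : ∀ v v' i j, e v i = e v' j → src i = src j → i = j := by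
    intro v v' i j h h'
    have h1 : (cyclicLetter L i).1 = (cyclicLetter L j).1 := (Prod.ext_iff.1 h).2
    have hL' := hL.cyclicLetter_snd_eq
    by_cases hi : (cyclicLetter L i).2 <;> by_cases hj : (cyclicLetter L j).2
    · simpa [src, hi, hj] using h'
    · obtain rfl : i + 1 = j := by simpa [src, hi, hj] using h'
      exact absurd (hL' i h1 ▸ hi) hj
    · obtain rfl : i = j + 1 := by simpa [src, hi, hj] using h'
      exact absurd (hL' j h1.symm ▸ hj) hi
    · simpa [src, hi, hj] using h'
  have hsgn : ∀ i, sgn i ≠ 0 := by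
    intro i
    by_cases hb : (cyclicLetter L i).2 <;> simp [sgn, hb]
  rw [hd] at hC ⊢
  have key := linearIndepOn_cellBoundary (fun x : V × α => x.1) (fun x => of x.2 • x.1) e p ρ src
    tgt (cyclicPrefix_conj_injective hL hnp) hst
    (fun i v v' h => Subtype.ext (MulAction.injective _ h)) (fun v i => rfl)
    (fun v i => htgt v i) hlt hinj sgn hsgn C
  exact key fun z _ hz => hC z hz

end FreeGroup

end CyclicWordLoops

section Identities

namespace FreeGroup

variable {α : Type*}

/-- The homomorphism from the free group on the set `G` to `G` which sends the generator `u` to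
`u * b * u⁻¹`. -/
def conjLift {G : Type*} [Group G] (b : G) : FreeGroup G →* G :=
  lift fun u => u * b * u⁻¹

/-- The homomorphism from the free group on the set `G` to the free abelian group on `G ⧸ N` which
sends the generator `u` to the class of `u`. -/
noncomputable def classLift {G : Type*} [Group G] (N : Subgroup G) :
    FreeGroup G →* Multiplicative (G ⧸ N →₀ ℤ) :=
  lift fun u => Multiplicative.ofAdd (Finsupp.single (u : G ⧸ N) 1)

theorem exists_finset_mem_closure_of {β : Type*} (m : FreeGroup β) :
    ∃ U : Finset β, m ∈ Subgroup.closure (of '' (U : Set β)) := by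
  classical
  induction m using FreeGroup.induction_on with
  | C1 => exact ⟨∅, one_mem _⟩
  | of u => exact ⟨{u}, Subgroup.subset_closure ⟨u, by simp⟩⟩
  | inv_of u h => exact h.imp fun U hU => inv_mem hU
  | mul g h hg hh =>
    obtain ⟨U, hU⟩ := hg
    obtain ⟨U', hU'⟩ := hh
    refine ⟨U ∪ U', mul_mem (Subgroup.closure_mono ?_ hU) (Subgroup.closure_mono ?_ hU')⟩
    · exact Set.image_mono (by simp)
    · exact Set.image_mono (by simp)

/-- The identity theorem for a cyclically reduced relator. -/
theorem classLift_eq_one_of_isCyclicallyReduced [LinearOrder α] [WellFoundedLT α]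
    (L : List (α × Bool)) (hL0 : L ≠ []) (hL : IsCyclicallyReduced L)
    (hnp : ∀ (w : FreeGroup α) (k : ℤ), mk L = w ^ k → |k| ≤ 1)
    (N : Subgroup (FreeGroup α)) [N.Normal] (hN : mk L ∈ N) (m : FreeGroup (FreeGroup α))
    (hm : conjLift (mk L) m = 1) : classLift N m = 1 := by
  classical
  have : NeZero L.length := ⟨fun h => hL0 (List.length_eq_zero_iff.1 h)⟩
  obtain ⟨_, hconj⟩ := FreeGroup.exists_linearOrder_conj_lt α
  obtain ⟨U, hU⟩ := exists_finset_mem_closure_of m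
  set H : Subgroup (FreeGroup α) :=
    Subgroup.closure ((fun u => u * mk L * u⁻¹) '' (U : Set (FreeGroup α))) with hH
  have hHN : H ≤ N := by
    rw [hH, Subgroup.closure_le]
    rintro _ ⟨u, -, rfl⟩
    exact Subgroup.Normal.conj_mem ‹_› _ hN u
  set v₀ : FreeGroup α ⧸ H := ((1 : FreeGroup α) : FreeGroup α ⧸ H) with hv₀
  have hstab : MulAction.stabilizer (FreeGroup α) v₀ = H := MulAction.stabilizer_quotient H
  have htrans : ∀ v : FreeGroup α ⧸ H, ∃ g : FreeGroup α, g • v₀ = v := by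
    intro v
    induction v using QuotientGroup.induction_on with
    | H g => exact ⟨g, by rw [hv₀, MulAction.Quotient.smul_coe, smul_eq_mul, mul_one]⟩
  have hfix : ∀ u ∈ U, mk L • u⁻¹ • v₀ = u⁻¹ • v₀ := by
    intro u hu
    have h1 : u * mk L * u⁻¹ ∈ H := Subgroup.subset_closure ⟨u, hu, rfl⟩
    rw [← hstab, MulAction.mem_stabilizer_iff, mul_smul, mul_smul] at h1
    exact eq_inv_smul_iff.2 h1
  have hloop : ∀ u ∈ U, pathChain (u * mk L * u⁻¹) v₀ = pathChain (mk L) (u⁻¹ • v₀) := by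
    intro u hu
    rw [pathChain_mul, pathChain_mul, pathChain_inv, hfix u hu]
    abel
  set C : Finset {v : FreeGroup α ⧸ H // mk L • v = v} :=
    (U.image fun u => u⁻¹ • v₀).subtype _ with hC
  have hindep := linearIndepOn_pathChain L hconj hL hnp C (by
    intro z hz
    refine Submodule.span_mono ?_ (mem_span_pathChain_of_graphBoundary_eq_zero v₀ htrans _
      hstab.symm z hz)
    rintro _ ⟨_, ⟨u, hu, rfl⟩, rfl⟩
    refine ⟨⟨u⁻¹ • v₀, hfix u hu⟩, ?_, (hloop u hu).symm⟩
    exact Finset.mem_subtype.2 (Finset.mem_image_of_mem _ hu))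
  let κ : FreeGroup (FreeGroup α) →*
      Multiplicative ({v : FreeGroup α ⧸ H // mk L • v = v} →₀ ℚ) :=
    lift fun u => Multiplicative.ofAdd
      (if h : mk L • u⁻¹ • v₀ = u⁻¹ • v₀ then Finsupp.single ⟨u⁻¹ • v₀, h⟩ 1 else 0)
  have hκ : ∀ u, ∀ hu : u ∈ U, (κ (of u)).toAdd = Finsupp.single ⟨u⁻¹ • v₀, hfix u hu⟩ 1 := by
    intro u hu
    simp only [κ, lift_apply_of, toAdd_ofAdd, dif_pos (hfix u hu)]
  have hstabm : ∀ x ∈ Subgroup.closure (of '' (U : Set (FreeGroup α))),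
      conjLift (mk L) x • v₀ = v₀ := by
    intro x hx
    suffices h : Subgroup.closure (of '' (U : Set (FreeGroup α))) ≤
      (MulAction.stabilizer (FreeGroup α) v₀).comap (conjLift (mk L)) from h hx
    rw [Subgroup.closure_le]
    rintro _ ⟨u, hu, rfl⟩
    rw [SetLike.mem_coe, Subgroup.mem_comap, hstab, conjLift, lift_apply_of]
    exact Subgroup.subset_closure ⟨u, hu, rfl⟩
  have hsupp : (κ m).toAdd ∈ Finsupp.supported ℚ ℚ (C : Set _) := by
    suffices h : Subgroup.closure (of '' (U : Set (FreeGroup α))) ≤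
      (AddSubgroup.toSubgroup (Finsupp.supported ℚ ℚ (C : Set _)).toAddSubgroup).comap κ from h hU
    rw [Subgroup.closure_le]
    rintro _ ⟨u, hu, rfl⟩
    change (κ (of u)).toAdd ∈ Finsupp.supported ℚ ℚ (C : Set _)
    rw [hκ u hu]
    exact Finsupp.single_mem_supported _ _
      (Finset.mem_subtype.2 (Finset.mem_image_of_mem _ hu))
  have hchain : pathChain (conjLift (mk L) m) v₀ = Finsupp.linearCombination ℚ
      (fun v : {v : FreeGroup α ⧸ H // mk L • v = v} => pathChain (mk L) v.1) (κ m).toAdd := by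
    clear hm hsupp
    induction hU using Subgroup.closure_induction with
    | mem x hx =>
      obtain ⟨u, hu, rfl⟩ := hx
      rw [hκ u hu, Finsupp.linearCombination_single, one_smul, conjLift, lift_apply_of, hloop u hu]
    | one => rw [_root_.map_one, _root_.map_one, pathChain_one, toAdd_one, map_zero]
    | mul x y hx hy ihx ihy =>
      rw [_root_.map_mul, _root_.map_mul, toAdd_mul, map_add, pathChain_mul, hstabm y hy, ihx,
        ihy, add_comm]
    | inv x hx ihx =>
      rw [_root_.map_inv, _root_.map_inv, toAdd_inv, map_neg, pathChain_inv, ← _root_.map_inv,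
        hstabm _ (inv_mem hx), ihx]
  have hκm : (κ m).toAdd = 0 := by
    refine linearIndepOn_iff.1 hindep _ hsupp ?_
    rw [← hchain, hm, pathChain_one]
  have hclass : Finsupp.mapDomain (fun v : {v : FreeGroup α ⧸ H // mk L • v = v} =>
      (Subgroup.quotientMapOfLE hHN v.1)⁻¹) (κ m).toAdd =
        Finsupp.mapRange.addMonoidHom (Int.castAddHom ℚ) (classLift N m).toAdd := by
    clear hm hsupp hchain hκm
    induction hU using Subgroup.closure_induction with
    | mem x hx =>
      obtain ⟨u, hu, rfl⟩ := hx
      rw [hκ u hu, Finsupp.mapDomain_single, classLift, lift_apply_of]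
      simp [hv₀]
    | one => simp
    | mul x y hx hy ihx ihy =>
      rw [_root_.map_mul κ, _root_.map_mul (classLift N), toAdd_mul, toAdd_mul, map_add,
        Finsupp.mapDomain_add, ihx, ihy]
    | inv x hx ihx =>
      rw [_root_.map_inv κ, _root_.map_inv (classLift N), toAdd_inv, toAdd_inv, map_neg, ← ihx]
      exact map_neg (Finsupp.mapDomain.addMonoidHom _) _
  rw [hκm, Finsupp.mapDomain_zero] at hclass
  refine Multiplicative.toAdd.injective
    (Finsupp.mapRange_injective (Int.castAddHom ℚ) (map_zero _) Int.cast_injective ?_)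
  exact hclass.symm.trans Finsupp.mapRange_zero.symm

/-- **The identity theorem** for a relator which is not a proper power. -/
theorem classLift_eq_one [LinearOrder α] [WellFoundedLT α] (b : FreeGroup α) (hb : b ≠ 1)
    (hnp : ∀ (w : FreeGroup α) (k : ℤ), b = w ^ k → |k| ≤ 1)
    (N : Subgroup (FreeGroup α)) [N.Normal] (hN : b ∈ N) (m : FreeGroup (FreeGroup α))
    (hm : conjLift b m = 1) : classLift N m = 1 := by
  set c := mk (reduceCyclically.conjugator b.toWord) with hc
  set L := reduceCyclically b.toWord with hL
  have hbL : b = c * mk L * c⁻¹ := by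
    rw [hc, hL, inv_mk, mul_mk, mul_mk, reduceCyclically.conj_conjugator_reduceCyclically,
      mk_toWord]
  have hL0 : L ≠ [] := fun h => hb (by rw [hbL, h, ← one_eq_mk, mul_one, mul_inv_cancel])
  have hnpL : ∀ (w : FreeGroup α) (k : ℤ), mk L = w ^ k → |k| ≤ 1 := fun w k h =>
    hnp (c * w * c⁻¹) k (by rw [conj_zpow, ← h, hbL])
  have hLN : mk L ∈ N := by
    have h := Subgroup.Normal.conj_mem ‹_› _ hN c⁻¹
    rwa [hbL, show c⁻¹ * (c * mk L * c⁻¹) * c⁻¹⁻¹ = mk L by group] at h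
  have h1 := classLift_eq_one_of_isCyclicallyReduced L hL0
    (reduceCyclically.isCyclicallyReduced isReduced_toWord) hnpL N hLN (map (· * c) m) (by
      rw [← hm]
      suffices h : (conjLift (mk L)).comp (map (· * c)) = conjLift b from DFunLike.congr_fun h m
      ext u
      simp [conjLift, hbL, mul_assoc])
  have h2 : (classLift N (map (· * c) m)).toAdd =
      Finsupp.mapDomain (· * (c : FreeGroup α ⧸ N)) (classLift N m).toAdd := by
    suffices h : (classLift N).comp (map (· * c)) = (AddMonoidHom.toMultiplicative
        (Finsupp.mapDomain.addMonoidHom (· * (c : FreeGroup α ⧸ N)))).comp (classLift N) from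
      DFunLike.congr_fun h m
    refine FreeGroup.ext_hom _ _ fun u => ?_
    simp [classLift]
  rw [h1, toAdd_one] at h2
  exact Multiplicative.toAdd.injective (Finsupp.mapDomain_injective (mul_left_injective _)
    (h2.symm.trans Finsupp.mapDomain_zero.symm))

end FreeGroup

end Identities

section RelationModule

variable {G : Type*} [Group G]

theorem FreeGroup.range_conjLift (b : G) :
    (FreeGroup.conjLift b).range = Subgroup.normalClosure {b} := by
  rw [FreeGroup.conjLift, FreeGroup.range_lift_eq_closure, Subgroup.normalClosure]
  congr 1
  ext x
  rw [Group.conjugatesOfSet, Set.biUnion_singleton]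
  exact isConj_iff.symm

/-- If `N` is the normal closure of `b`, then there is a homomorphism from the free abelian group on
`G ⧸ N` to the abelianization of `N` which sends the class of `u` to that of `u * b * u⁻¹`. -/
theorem exists_abelianization_classMap (b : G) :
    ∃ ψ : (G ⧸ Subgroup.normalClosure {b} →₀ ℤ) →+
        Additive (Abelianization (Subgroup.normalClosure {b})),
      ∀ (u : G) (hu : u * b * u⁻¹ ∈ Subgroup.normalClosure {b}),
        ψ (Finsupp.single (u : G ⧸ Subgroup.normalClosure {b}) 1) =
          Additive.ofMul (Abelianization.of ⟨u * b * u⁻¹, hu⟩) := by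
  have hb : b ∈ Subgroup.normalClosure {b} := Subgroup.subset_normalClosure rfl
  have hmem (u : G) : u * b * u⁻¹ ∈ Subgroup.normalClosure {b} :=
    Subgroup.normalClosure_normal.conj_mem _ hb u
  let f : G ⧸ Subgroup.normalClosure {b} → Additive (Abelianization (Subgroup.normalClosure {b})) :=
    Quotient.lift (fun u => Additive.ofMul (Abelianization.of ⟨u * b * u⁻¹, hmem u⟩)) (by
      intro u v h
      have hn : u * v⁻¹ ∈ Subgroup.normalClosure {b} := by
        have h1 := Subgroup.normalClosure_normal.conj_mem _
          (inv_mem (QuotientGroup.leftRel_apply.1 h)) u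
        rwa [show u * (u⁻¹ * v)⁻¹ * u⁻¹ = u * v⁻¹ by group] at h1
      have h2 : (⟨u * b * u⁻¹, hmem u⟩ : Subgroup.normalClosure {b}) =
          ⟨u * v⁻¹, hn⟩ * ⟨v * b * v⁻¹, hmem v⟩ * ⟨u * v⁻¹, hn⟩⁻¹ :=
        Subtype.ext (by simp [mul_assoc])
      refine congrArg Additive.ofMul ?_
      rw [h2, map_mul, map_mul, map_inv, mul_inv_cancel_comm])
  refine ⟨Finsupp.liftAddHom fun x => (zmultiplesHom _ (f x)), fun u hu => ?_⟩
  rw [Finsupp.liftAddHom_apply_single, zmultiplesHom_apply, one_zsmul]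
  rfl

end RelationModule

/-- **Proposition 4.1, second part.**
Let `F` be a free group of finite rank at least 2, `B ∈ F` nontrivial and not a proper
power, `N = ⟪B⟫` its normal closure, `π = F/N` and `p : F → π` the quotient map.
Then there is a surjective group homomorphism `q_N` from `N` to the additive group of the
integral group ring `ℤ[π]` whose kernel is the commutator subgroup `[N,N]` and which sends
`u·B·u⁻¹` to `ū` for every `u ∈ F`; consequently it sends `∏ (uᵢ B uᵢ⁻¹)^(nᵢ)` to
`∑ nᵢ • ūᵢ`.  In particular the abelianization of `N` is isomorphic to `(ℤ[π], +)`. -/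
theorem normalClosure_abelianization_eq_groupRing
    (r : ℕ) (hr : 2 ≤ r) (B : FreeGroup (Fin r)) (hB : B ≠ 1)
    (hBnp : ∀ (w : FreeGroup (Fin r)) (k : ℤ), B = w ^ k → |k| ≤ 1) :
    ∃ qN : (Subgroup.normalClosure {B} : Subgroup (FreeGroup (Fin r))) →*
        Multiplicative (MonoidAlgebra ℤ (FreeGroup (Fin r) ⧸ Subgroup.normalClosure {B})),
      Function.Surjective qN ∧
      qN.ker = commutator ↥(Subgroup.normalClosure {B}) ∧
      (∀ (u : FreeGroup (Fin r)) (hu : u * B * u⁻¹ ∈ Subgroup.normalClosure {B}),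
        qN ⟨u * B * u⁻¹, hu⟩ = Multiplicative.ofAdd
          (MonoidAlgebra.of ℤ (FreeGroup (Fin r) ⧸ Subgroup.normalClosure {B})
            (QuotientGroup.mk' (Subgroup.normalClosure {B}) u))) ∧
      (∀ (k : ℕ) (u : Fin k → FreeGroup (Fin r)) (n : Fin k → ℤ)
        (hprod : (List.ofFn fun i => (u i * B * (u i)⁻¹) ^ (n i)).prod ∈
          Subgroup.normalClosure {B}),
        qN ⟨(List.ofFn fun i => (u i * B * (u i)⁻¹) ^ (n i)).prod, hprod⟩ =
          Multiplicative.ofAdd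
            (∑ i, n i • MonoidAlgebra.of ℤ (FreeGroup (Fin r) ⧸ Subgroup.normalClosure {B})
              (QuotientGroup.mk' (Subgroup.normalClosure {B}) (u i)))) ∧
      Nonempty (Abelianization ↥(Subgroup.normalClosure {B}) ≃*
        Multiplicative (MonoidAlgebra ℤ (FreeGroup (Fin r) ⧸ Subgroup.normalClosure {B}))) := by
  set N := Subgroup.normalClosure {B} with hN
  have hBN : B ∈ N := Subgroup.subset_normalClosure rfl
  have hmem (u : FreeGroup (Fin r)) : u * B * u⁻¹ ∈ N :=
    Subgroup.normalClosure_normal.conj_mem _ hBN u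
  let θ : FreeGroup (FreeGroup (Fin r)) →* N := (FreeGroup.conjLift B).codRestrict N fun m => by
    rw [hN, ← FreeGroup.range_conjLift]
    exact ⟨m, rfl⟩
  have hθof (u : FreeGroup (Fin r)) : θ (FreeGroup.of u) = ⟨u * B * u⁻¹, hmem u⟩ :=
    Subtype.ext (FreeGroup.lift_apply_of)
  have hθ : Function.Surjective θ := by
    rintro ⟨x, hx⟩
    have hx' := hx
    rw [hN, ← FreeGroup.range_conjLift] at hx'
    exact hx'.imp fun m hm => Subtype.ext hm
  let e : (FreeGroup (Fin r) ⧸ N →₀ ℤ) ≃+ MonoidAlgebra ℤ (FreeGroup (Fin r) ⧸ N) :=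
    MonoidAlgebra.coeffAddEquiv.symm
  let q₀ : N →* Multiplicative (FreeGroup (Fin r) ⧸ N →₀ ℤ) :=
    θ.liftOfSurjective hθ ⟨FreeGroup.classLift N, fun m hm =>
      FreeGroup.classLift_eq_one B hB hBnp N hBN m (congrArg Subtype.val hm)⟩
  have hq₀ (m) : q₀ (θ m) = FreeGroup.classLift N m :=
    MonoidHom.liftOfRightInverse_comp_apply _ _ _ _ _
  have hq₀of (u : FreeGroup (Fin r)) (hu : u * B * u⁻¹ ∈ N) : q₀ ⟨u * B * u⁻¹, hu⟩ =
      Multiplicative.ofAdd (Finsupp.single (u : FreeGroup (Fin r) ⧸ N) 1) := by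
    rw [← hθof, hq₀, FreeGroup.classLift, FreeGroup.lift_apply_of]
  have hq₀surj : Function.Surjective q₀ := by
    rw [← MonoidHom.range_eq_top, eq_top_iff]
    suffices h : ∀ x : FreeGroup (Fin r) ⧸ N →₀ ℤ, Multiplicative.ofAdd x ∈ q₀.range from
      fun x _ => h x.toAdd
    intro x
    induction x using Finsupp.induction_linear with
    | zero => exact one_mem _
    | add f g hf hg => exact mul_mem hf hg
    | single a n =>
      induction a using QuotientGroup.induction_on with
      | H u =>
        rw [← mul_one n, ← smul_eq_mul, ← Finsupp.smul_single, ofAdd_zsmul]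
        exact zpow_mem (MonoidHom.mem_range.2 ⟨_, hq₀of u (hmem u)⟩) n
  have hker : q₀.ker = commutator N := by
    refine le_antisymm (fun x hx => ?_) (Abelianization.commutator_subset_ker q₀)
    obtain ⟨ψ, hψ⟩ := exists_abelianization_classMap B
    obtain ⟨m, rfl⟩ := hθ x
    have h : (AddMonoidHom.toMultiplicativeLeft ψ).comp (FreeGroup.classLift N) =
        Abelianization.of.comp θ := by
      refine FreeGroup.ext_hom _ _ fun u => ?_
      rw [MonoidHom.comp_apply, MonoidHom.comp_apply, hθof, FreeGroup.classLift,
        FreeGroup.lift_apply_of]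
      exact hψ u (hmem u)
    rw [MonoidHom.mem_ker, hq₀] at hx
    have h1 := DFunLike.congr_fun h m
    rw [MonoidHom.comp_apply, hx, map_one] at h1
    exact (QuotientGroup.eq_one_iff _).1 h1.symm
  let q := (AddEquiv.toMultiplicative e).toMonoidHom.comp q₀
  have hqof (u : FreeGroup (Fin r)) (hu : u * B * u⁻¹ ∈ N) : q ⟨u * B * u⁻¹, hu⟩ =
      Multiplicative.ofAdd (MonoidAlgebra.of ℤ (FreeGroup (Fin r) ⧸ N)
        (QuotientGroup.mk' N u)) := by
    rw [MonoidHom.comp_apply, hq₀of]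
    rfl
  have hqsurj : Function.Surjective q := (AddEquiv.toMultiplicative e).surjective.comp hq₀surj
  have hqker : q.ker = commutator N := by
    rw [← hker]
    ext x
    simp [q, MonoidHom.mem_ker]
  refine ⟨q, hqsurj, hqker, hqof, fun k u n hprod => ?_, ⟨?_⟩⟩
  · have h : (⟨(List.ofFn fun i => (u i * B * (u i)⁻¹) ^ (n i)).prod, hprod⟩ : N) =
        (List.ofFn fun i => (⟨u i * B * (u i)⁻¹, hmem (u i)⟩ : N) ^ (n i)).prod := by
      refine Subtype.ext ?_
      rw [← N.coe_subtype, map_list_prod, List.map_ofFn]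
      rfl
    rw [h, map_list_prod, List.map_ofFn, List.prod_ofFn, ofAdd_sum]
    refine Finset.prod_congr rfl fun i _ => ?_
    rw [Function.comp_apply, map_zpow, hqof, ofAdd_zsmul]
  · exact (QuotientGroup.quotientMulEquivOfEq hqker.symm).trans
      (QuotientGroup.quotientKerEquivOfSurjective q hqsurj)
end

section
/- The quotient N/[F,N] is infinite cyclic. More precisely, there is a surjective group homomorphism φ : N → ℤ whose kernel is [F,N] and which satisfies φ(u·B^c·u⁻¹) = c for all u ∈ F and c ∈ ℤ (φ is the composition of the homomorphism q_N : N → ℤ[π] with q_N(uBu⁻¹) = ū and the augmentation ℤ[π] → ℤ). In particular an element ∏_{i} u_i B^{c_i} u_i⁻¹ lies in [F,N] if and only if Σ_i c_i = 0. (Proposition 4.7.) -/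
/-! ### The generic cyclic quotient -/

section CyclicQuotient

open scoped commutatorElement

variable {G Q : Type*} [Group G] [Group Q] {B : G} {q : G →* Q}

theorem map_conj_zpow_of_commutator_normalClosure_le_ker
    (hq : ⁅(⊤ : Subgroup G), Subgroup.normalClosure {B}⁆ ≤ q.ker) (u : G) (c : ℤ) :
    q (u * B ^ c * u⁻¹) = q B ^ c := by
  have h : ⁅u, B ^ c⁆ ∈ q.ker :=
    hq (Subgroup.commutator_mem_commutator (Subgroup.mem_top u)
      (zpow_mem (Subgroup.subset_normalClosure (Set.mem_singleton B)) c))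
  rw [MonoidHom.mem_ker, commutatorElement_def, map_mul, map_inv, mul_inv_eq_one, map_zpow] at h
  exact h

theorem exists_map_eq_zpow_of_commutator_normalClosure_le_ker
    (hq : ⁅(⊤ : Subgroup G), Subgroup.normalClosure {B}⁆ ≤ q.ker) {x : G}
    (hx : x ∈ Subgroup.normalClosure {B}) : ∃ c : ℤ, q x = q B ^ c := by
  rw [Subgroup.normalClosure] at hx
  induction hx using Subgroup.closure_induction with
  | mem y hy =>
    obtain ⟨b, rfl, hb⟩ := Group.mem_conjugatesOfSet_iff.1 hy
    obtain ⟨u, rfl⟩ := isConj_iff.1 hb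
    exact ⟨1, by simpa using map_conj_zpow_of_commutator_normalClosure_le_ker hq u 1⟩
  | one => exact ⟨0, by simp⟩
  | mul y z _ _ hy hz =>
    obtain ⟨a, ha⟩ := hy
    obtain ⟨b, hb⟩ := hz
    exact ⟨a + b, by rw [map_mul, ha, hb, zpow_add]⟩
  | inv y _ hy =>
    obtain ⟨a, ha⟩ := hy
    exact ⟨-a, by rw [map_inv, ha, zpow_neg]⟩

theorem exists_normalClosure_hom_of_zpow_mem_commutator
    (hB : ∀ c : ℤ, B ^ c ∈ ⁅(⊤ : Subgroup G), Subgroup.normalClosure {B}⁆ → c = 0) :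
    ∃ φ : (Subgroup.normalClosure {B} : Subgroup G) →* Multiplicative ℤ,
      Function.Surjective φ ∧
      φ.ker = (⁅(⊤ : Subgroup G), Subgroup.normalClosure {B}⁆).subgroupOf
        (Subgroup.normalClosure {B}) ∧
      (∀ (u : G) (c : ℤ) (hu : u * B ^ c * u⁻¹ ∈ Subgroup.normalClosure {B}),
        φ ⟨u * B ^ c * u⁻¹, hu⟩ = Multiplicative.ofAdd c) ∧
      (∀ (k : ℕ) (u : Fin k → G) (c : Fin k → ℤ),
        (List.ofFn fun i => u i * B ^ (c i) * (u i)⁻¹).prod ∈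
            ⁅(⊤ : Subgroup G), Subgroup.normalClosure {B}⁆ ↔
          ∑ i, c i = 0) := by
  obtain ⟨q, hone⟩ : ∃ q : G →* G ⧸ ⁅(⊤ : Subgroup G), Subgroup.normalClosure {B}⁆,
      ∀ x, q x = 1 ↔ x ∈ ⁅(⊤ : Subgroup G), Subgroup.normalClosure {B}⁆ :=
    ⟨QuotientGroup.mk' _, fun x => QuotientGroup.eq_one_iff x⟩
  have hq : ⁅(⊤ : Subgroup G), Subgroup.normalClosure {B}⁆ ≤ q.ker := fun x hx => (hone x).2 hx
  have hinj : Function.Injective fun c : ℤ => q B ^ c := by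
    intro a b hab
    have h : q (B ^ (a - b)) = 1 := by
      rw [map_zpow, zpow_sub, mul_inv_eq_one]
      exact hab
    exact sub_eq_zero.1 (hB _ ((hone _).1 h))
  choose e he using fun x : (Subgroup.normalClosure {B} : Subgroup G) =>
    exists_map_eq_zpow_of_commutator_normalClosure_le_ker hq x.2
  have heq : ∀ x c, q x.1 = q B ^ c → e x = c := fun x c h => hinj ((he x).symm.trans h)
  refine ⟨MonoidHom.mk' (fun x => Multiplicative.ofAdd (e x)) fun x y => ?_, ?_, ?_, ?_, ?_⟩
  · rw [← ofAdd_add]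
    congr 1
    apply heq
    rw [zpow_add, ← he, ← he]
    exact map_mul q x.1 y.1
  · intro c
    refine ⟨⟨B ^ c.toAdd, zpow_mem (Subgroup.subset_normalClosure (Set.mem_singleton B)) _⟩, ?_⟩
    exact congrArg Multiplicative.ofAdd (heq _ _ (map_zpow q B _))
  · ext x
    rw [MonoidHom.mem_ker, Subgroup.mem_subgroupOf, ← hone, MonoidHom.mk'_apply, ofAdd_eq_one]
    constructor
    · intro h
      rw [he x, h, zpow_zero]
    · intro h
      exact heq x 0 (by rw [h, zpow_zero])
  · intro u c hu
    exact congrArg Multiplicative.ofAdd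
      (heq _ _ (map_conj_zpow_of_commutator_normalClosure_le_ker hq u c))
  · intro k u c
    have hprod : q (List.ofFn fun i => u i * B ^ (c i) * (u i)⁻¹).prod = q B ^ ∑ i, c i := by
      induction k with
      | zero => simp
      | succ k ih =>
        rw [List.ofFn_succ, List.prod_cons, map_mul, Fin.sum_univ_succ, zpow_add, ih,
          map_conj_zpow_of_commutator_normalClosure_le_ker hq]
    rw [← hone, hprod]
    constructor
    · intro h
      exact hinj (h.trans (zpow_zero _).symm)
    · intro h
      rw [h, zpow_zero]

end CyclicQuotient

/-! ### Congruence subgroups of a filtered ring -/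

/-- A descending multiplicative filtration of a ring by additive subgroups. -/
structure MulFiltration (R : Type*) [Ring R] where
  /-- The terms of the filtration. -/
  level : ℕ → AddSubgroup R
  one_mem : 1 ∈ level 0
  mul_mem : ∀ {m n : ℕ} {a b : R}, a ∈ level m → b ∈ level n → a * b ∈ level (m + n)
  anti : Antitone level

namespace MulFiltration

open scoped commutatorElement

variable {R : Type*} [Ring R] (I : MulFiltration R)

/-- The units congruent to `1`, together with their inverses, modulo the `n`-th term. -/
def congruenceSubgroup (n : ℕ) : Subgroup Rˣ where
  carrier := {u | (u : R) - 1 ∈ I.level n ∧ ((u⁻¹ : Rˣ) : R) - 1 ∈ I.level n}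
  one_mem' := by simp [zero_mem]
  inv_mem' := fun h => ⟨h.2, by simpa using h.1⟩
  mul_mem' := by
    have key : ∀ a b : R, a - 1 ∈ I.level n → b - 1 ∈ I.level n → a * b - 1 ∈ I.level n := by
      intro a b ha hb
      have h : a * b - 1 = (a - 1) * (b - 1) + (a - 1) + (b - 1) := by noncomm_ring
      rw [h]
      exact add_mem (add_mem (I.anti (Nat.le_add_left n n) (I.mul_mem ha hb)) ha) hb
    intro u v hu hv
    refine ⟨key _ _ hu.1 hv.1, ?_⟩
    rw [mul_inv_rev]
    exact key _ _ hv.2 hu.2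

theorem congruenceSubgroup_anti : Antitone I.congruenceSubgroup :=
  fun _ _ h _ hu => ⟨I.anti h hu.1, I.anti h hu.2⟩

theorem coe_mem_level_zero {n : ℕ} {u : Rˣ} (hu : u ∈ I.congruenceSubgroup n) :
    (u : R) ∈ I.level 0 := by
  simpa using add_mem (I.anti (Nat.zero_le n) hu.1) I.one_mem

theorem commutator_congruenceSubgroup_le (m n : ℕ) :
    ⁅I.congruenceSubgroup m, I.congruenceSubgroup n⁆ ≤ I.congruenceSubgroup (m + n) := by
  have key : ∀ {m n : ℕ} {u v : Rˣ}, u ∈ I.congruenceSubgroup m → v ∈ I.congruenceSubgroup n →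
      ((⁅u, v⁆ : Rˣ) : R) - 1 ∈ I.level (m + n) := by
    intro m n u v hu hv
    have h : ((⁅u, v⁆ : Rˣ) : R) - 1 =
        (((u : R) - 1) * ((v : R) - 1) - ((v : R) - 1) * ((u : R) - 1)) *
          (((u⁻¹ : Rˣ) : R) * ((v⁻¹ : Rˣ) : R)) := by
      have h1 : ((u : R) - 1) * ((v : R) - 1) - ((v : R) - 1) * ((u : R) - 1) =
          u * v - v * u := by noncomm_ring
      rw [h1, sub_mul, commutatorElement_def]
      simp [mul_assoc]
    rw [h]
    refine I.mul_mem (n := 0) (sub_mem (I.mul_mem hu.1 hv.1) ?_)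
      (I.mul_mem (I.coe_mem_level_zero (inv_mem hu)) (I.coe_mem_level_zero (inv_mem hv)))
    change _ ∈ I.level (m + n)
    rw [add_comm m n]
    exact I.mul_mem hv.1 hu.1
  rw [Subgroup.commutator_le]
  intro u hu v hv
  refine ⟨key hu hv, ?_⟩
  rw [commutatorElement_inv, add_comm m n]
  exact key hv hu

theorem pow_sub_one_sub_nsmul_mem {n : ℕ} (hn : 1 ≤ n) {a : R} (ha : a - 1 ∈ I.level n) (k : ℕ) :
    a ^ k - 1 - k • (a - 1) ∈ I.level (n + 1) := by
  have hnn : n + 1 ≤ n + n := by omega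
  induction k with
  | zero => simp [zero_mem]
  | succ k ih =>
    have hk : a ^ k - 1 ∈ I.level n := by
      have := add_mem (I.anti (Nat.le_succ n) ih) (nsmul_mem ha k)
      rwa [sub_add_cancel] at this
    have h : a ^ (k + 1) - 1 - (k + 1) • (a - 1) =
        (a ^ k - 1) * (a - 1) + (a ^ k - 1 - k • (a - 1)) := by
      rw [pow_succ, succ_nsmul]
      noncomm_ring
    rw [h]
    exact add_mem (I.anti hnn (I.mul_mem hk ha)) ih

variable {G : Type*} [Group G]

/-- If `ρ` maps a group into the units congruent to `1` modulo the first term of a separated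
filtration with torsion-free quotients, and `ρ B ≠ 1`, then `B` has infinite order modulo
`[G, ⟪B⟫]`. -/
theorem eq_zero_of_zpow_mem_commutator_normalClosure
    (hsep : ∀ a, (∀ n, a ∈ I.level n) → a = 0)
    (htf : ∀ (n k : ℕ) (a : R), k ≠ 0 → k • a ∈ I.level n → a ∈ I.level n)
    (ρ : G →* Rˣ) (hρ : ∀ g, ρ g ∈ I.congruenceSubgroup 1) {B : G} (hB : ρ B ≠ 1) {c : ℤ}
    (hc : B ^ c ∈ ⁅(⊤ : Subgroup G), Subgroup.normalClosure {B}⁆) : c = 0 := by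
  classical
  have hex : ∃ n, (ρ B : R) - 1 ∉ I.level n := by
    by_contra! h
    exact hB (Units.ext (sub_eq_zero.1 (hsep _ h)))
  obtain ⟨n, hn, hn1, hlt⟩ : ∃ n, 1 ≤ n ∧ (ρ B : R) - 1 ∉ I.level (n + 1) ∧
      (ρ B : R) - 1 ∈ I.level n := by
    have hspec := Nat.find_spec hex
    have h2 : 2 ≤ Nat.find hex := by
      by_contra! h
      exact hspec (I.anti (by omega) (hρ B).1)
    refine ⟨Nat.find hex - 1, by omega, ?_, ?_⟩
    · rwa [Nat.sub_add_cancel (by omega)]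
    · by_contra h
      have := Nat.find_min' hex h
      omega
  have hcomm : ∀ (g h : G), ρ h ∈ I.congruenceSubgroup n →
      ρ ⁅g, h⁆ ∈ I.congruenceSubgroup (n + 1) := by
    intro g h hh
    rw [map_commutatorElement, add_comm]
    exact I.commutator_congruenceSubgroup_le 1 n (Subgroup.commutator_mem_commutator (hρ g) hh)
  have hBmem : ρ B ∈ I.congruenceSubgroup n := by
    refine ⟨hlt, ?_⟩
    have h : ((ρ B)⁻¹ : Rˣ) - (1 : R) = -((((ρ B)⁻¹ : Rˣ) : R) * ((ρ B : R) - 1)) := by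
      rw [mul_sub, Units.inv_mul, mul_one, neg_sub]
    rw [h]
    have := I.mul_mem (I.coe_mem_level_zero (inv_mem (hρ B))) hlt
    rw [zero_add] at this
    exact neg_mem this
  have hnormal : ((I.congruenceSubgroup n).comap ρ).Normal := by
    refine ⟨fun h hh g => ?_⟩
    have h1 := I.congruenceSubgroup_anti (Nat.le_succ n) (hcomm g h hh)
    have h2 := Subgroup.mul_mem _ h1 (Subgroup.mem_comap.1 hh)
    rw [← map_mul, commutatorElement_def, inv_mul_cancel_right] at h2
    exact h2
  have hN : Subgroup.normalClosure {B} ≤ (I.congruenceSubgroup n).comap ρ :=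
    Subgroup.normalClosure_le_normal (Set.singleton_subset_iff.2 hBmem)
  have hle : ⁅(⊤ : Subgroup G), Subgroup.normalClosure {B}⁆ ≤
      (I.congruenceSubgroup (n + 1)).comap ρ :=
    Subgroup.commutator_le.2 fun g _ h hh => hcomm g h (hN hh)
  have hpow : ρ (B ^ c.natAbs) ∈ I.congruenceSubgroup (n + 1) := by
    refine hle ?_
    rcases Int.natAbs_eq c with h | h
    · rwa [h, zpow_natCast] at hc
    · rw [h, zpow_neg, zpow_natCast] at hc
      exact inv_mem_iff.1 hc
  by_contra hc0
  refine hn1 (htf _ c.natAbs _ (Int.natAbs_ne_zero.2 hc0) ?_)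
  have h1 := hpow.1
  rw [map_pow, Units.val_pow_eq_pow_val] at h1
  have := sub_mem h1 (I.pow_sub_one_sub_nsmul_mem hn hlt c.natAbs)
  rwa [sub_sub_cancel] at this

end MulFiltration

/-! ### A square-zero Magnus representation of the free group -/

namespace SquareZeroMagnus

variable {α : Type*}

/-- Endomorphisms of the functions on words which raise the order of vanishing by at least `n`. -/
def orderFiltration (α : Type*) : MulFiltration (Module.End ℤ (List α → ℤ)) where
  level n :=
    { carrier := {T | ∀ (m : ℕ) (f : List α → ℤ), (∀ w, w.length < m → f w = 0) →
        ∀ w, w.length < m + n → T f w = 0}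
      zero_mem' := fun _ _ _ _ _ => rfl
      add_mem' := fun {S T} hS hT m f hf w hw => by
        rw [LinearMap.add_apply, Pi.add_apply, hS m f hf w hw, hT m f hf w hw, add_zero]
      neg_mem' := fun {S} hS m f hf w hw => by
        rw [LinearMap.neg_apply, Pi.neg_apply, hS m f hf w hw, neg_zero] }
  one_mem := fun _ _ hf w hw => hf w hw
  mul_mem := fun {k n S T} hS hT m f hf w hw =>
    hS (m + n) (T f) (hT m f hf) w (by omega)
  anti := fun _ _ h _ hT m f hf w hw => hT m f hf w (by omega)

theorem eq_zero_of_forall_mem_orderFiltration (T : Module.End ℤ (List α → ℤ))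
    (hT : ∀ n, T ∈ (orderFiltration α).level n) : T = 0 := by
  ext f w
  exact hT (w.length + 1) 0 f (fun _ h => absurd h (Nat.not_lt_zero _)) w (by omega)

theorem mem_orderFiltration_of_nsmul_mem (n k : ℕ) (T : Module.End ℤ (List α → ℤ)) (hk : k ≠ 0)
    (hT : k • T ∈ (orderFiltration α).level n) : T ∈ (orderFiltration α).level n := by
  intro m f hf w hw
  have h := hT m f hf w hw
  rw [LinearMap.smul_apply, Pi.smul_apply, smul_eq_zero] at h
  exact h.resolve_left hk

variable [DecidableEq α]

/-- Left multiplication by the letter `i`, in the algebra where squares of letters vanish. -/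
def letterMul (i : α) : Module.End ℤ (List α → ℤ) where
  toFun f
    | [] => 0
    | j :: w => if i = j ∧ w.head? ≠ some i then f w else 0
  map_add' f g := by
    ext w
    cases w <;> simp [ite_add_ite]
  map_smul' c f := by
    ext w
    cases w <;> simp

@[simp]
theorem letterMul_nil (i : α) (f : List α → ℤ) : letterMul i f [] = 0 := rfl

@[simp]
theorem letterMul_cons (i j : α) (f : List α → ℤ) (w : List α) :
    letterMul i f (j :: w) = if i = j ∧ w.head? ≠ some i then f w else 0 := rfl

theorem letterMul_of_head?_ne {i : α} {w : List α} (hw : w.head? ≠ some i) (f : List α → ℤ) :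
    letterMul i f w = 0 := by
  cases w with
  | nil => rfl
  | cons j w =>
    have h : ¬ i = j := fun h => hw (by simp [h])
    simp [h]

theorem letterMul_mul_self (i : α) : letterMul i * letterMul i = 0 := by
  ext f w
  cases w with
  | nil => rfl
  | cons j w =>
    rw [Module.End.mul_apply, letterMul_cons]
    split_ifs with h
    · exact letterMul_of_head?_ne h.2 f
    · rfl

theorem letterMul_mem_orderFiltration (i : α) : letterMul i ∈ (orderFiltration α).level 1 := by
  intro m f hf w hw
  cases w with
  | nil => rfl
  | cons j w =>
    rw [List.length_cons] at hw
    rw [letterMul_cons, hf w (by omega), ite_self]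

/-- The unit `1 + i`, with inverse `1 - i`. -/
def letterUnit (i : α) : (Module.End ℤ (List α → ℤ))ˣ where
  val := 1 + letterMul i
  inv := 1 - letterMul i
  val_inv := by simp [mul_sub, add_mul, letterMul_mul_self]
  inv_val := by simp [mul_add, sub_mul, letterMul_mul_self]

/-- The representation of the free group sending the generator `i` to `1 + i`. -/
def rep (α : Type*) [DecidableEq α] : FreeGroup α →* (Module.End ℤ (List α → ℤ))ˣ :=
  FreeGroup.lift letterUnit

theorem rep_mem_congruenceSubgroup (g : FreeGroup α) :
    rep α g ∈ (orderFiltration α).congruenceSubgroup 1 := by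
  have h : (rep α).range ≤ (orderFiltration α).congruenceSubgroup 1 := by
    refine FreeGroup.range_lift_le ?_
    rintro _ ⟨i, rfl⟩
    refine ⟨?_, ?_⟩
    · simpa [letterUnit] using letterMul_mem_orderFiltration i
    · simpa [letterUnit] using neg_mem (letterMul_mem_orderFiltration i)
  exact h ⟨g, rfl⟩

/-- The sign of a letter of a free group word. -/
def sgn (b : Bool) : ℤ := if b then 1 else -1

theorem rep_mk_cons_apply (i : α) (b : Bool) (L : List (α × Bool)) (f : List α → ℤ)
    (w : List α) :
    (rep α (FreeGroup.mk ((i, b) :: L)) : Module.End ℤ (List α → ℤ)) f w =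
      (rep α (FreeGroup.mk L) : Module.End ℤ (List α → ℤ)) f w +
        sgn b * letterMul i ((rep α (FreeGroup.mk L) : Module.End ℤ (List α → ℤ)) f) w := by
  have h : FreeGroup.mk ((i, b) :: L) = FreeGroup.mk [(i, b)] * FreeGroup.mk L := by
    rw [FreeGroup.mul_mk, List.singleton_append]
  have hi : (rep α (FreeGroup.mk [(i, b)]) : Module.End ℤ (List α → ℤ)) =
      1 + sgn b • letterMul i := by
    cases b
    · simp [rep, sgn, letterUnit, FreeGroup.lift_mk, sub_eq_add_neg]
    · simp [rep, sgn, letterUnit, FreeGroup.lift_mk]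
  rw [h, map_mul, Units.val_mul, hi]
  simp [Module.End.mul_apply]

theorem sgn_mul_self (b : Bool) : sgn b * sgn b = 1 := by cases b <;> rfl

/-- The image of the empty word under a nonempty reduced word has a top-length coefficient. -/
theorem exists_leading_coefficient (i : α) (b : Bool) (L : List (α × Bool))
    (hL : FreeGroup.IsReduced ((i, b) :: L)) :
    ∃ t : List α, t.head? ≠ some i ∧
      0 < sgn b *
        (rep α (FreeGroup.mk ((i, b) :: L)) : Module.End ℤ (List α → ℤ)) (Pi.single [] 1) (i :: t) *
        (rep α (FreeGroup.mk ((i, b) :: L)) : Module.End ℤ (List α → ℤ)) (Pi.single [] 1) t ∧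
      ∀ w, t.length < w.length → (t.length + 1 < w.length ∨ w.head? ≠ some i) →
        (rep α (FreeGroup.mk ((i, b) :: L)) : Module.End ℤ (List α → ℤ)) (Pi.single [] 1) w = 0 := by
  induction L generalizing i b with
  | nil =>
    refine ⟨[], by simp, ?_, ?_⟩
    · simp [rep_mk_cons_apply, ← FreeGroup.one_eq_mk, sgn_mul_self]
    · intro w hw hw'
      match w, hw, hw' with
      | [k], _, hw' =>
        have hk : i ≠ k := by simpa [eq_comm] using hw'
        simp [rep_mk_cons_apply, ← FreeGroup.one_eq_mk, hk]
      | _ :: _ :: _, _, _ => simp [rep_mk_cons_apply, ← FreeGroup.one_eq_mk]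
  | cons p L ih =>
    obtain ⟨j, d⟩ := p
    rw [FreeGroup.IsReduced, List.isChain_cons_cons] at hL
    obtain ⟨t, ht, hpos, hzero⟩ := ih j d hL.2
    simp only [rep_mk_cons_apply i b ((j, d) :: L)]
    set f := (rep α (FreeGroup.mk ((j, d) :: L)) : Module.End ℤ (List α → ℤ)) (Pi.single [] 1)
    by_cases hij : i = j
    · subst hij
      obtain rfl : b = d := hL.1 rfl
      refine ⟨t, ht, ?_, ?_⟩
      · rw [letterMul_of_head?_ne ht, letterMul_cons, if_pos ⟨rfl, ht⟩]
        nlinarith [sgn_mul_self b, mul_self_nonneg (f t)]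
      · intro w hw hw'
        rw [hzero w hw hw', zero_add]
        cases w with
        | nil => simp at hw
        | cons k w =>
          rw [letterMul_cons]
          split_ifs with hk
          · obtain ⟨rfl, hhead⟩ := hk
            simp only [List.length_cons, List.head?_cons, ne_eq, not_true, or_false] at hw'
            rw [hzero w (by omega) (Or.inr hhead), mul_zero]
          · exact mul_zero _
    · have hhead : (j :: t).head? ≠ some i := by simpa using Ne.symm hij
      refine ⟨j :: t, hhead, ?_, ?_⟩
      · rw [letterMul_of_head?_ne hhead, letterMul_cons, if_pos ⟨rfl, hhead⟩,
          hzero (i :: j :: t) (by simp) (Or.inl (by simp))]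
        have hne : f (j :: t) ≠ 0 := by
          intro h
          simp [h] at hpos
        have := mul_self_pos.2 hne
        nlinarith [sgn_mul_self b]
      · intro w hw hw'
        rw [List.length_cons] at hw hw'
        rw [hzero w (by omega) (Or.inl hw), zero_add]
        rcases hw' with hw' | hw'
        · cases w with
          | nil => simp at hw
          | cons k w =>
            rw [List.length_cons] at hw'
            rw [letterMul_cons, hzero w (by omega) (Or.inl (by omega)), ite_self, mul_zero]
        · rw [letterMul_of_head?_ne hw', mul_zero]

theorem rep_ne_one {g : FreeGroup α} (hg : g ≠ 1) : rep α g ≠ 1 := by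
  intro h
  have hred : FreeGroup.IsReduced g.toWord := FreeGroup.isReduced_toWord
  rcases hw : g.toWord with _ | ⟨⟨i, b⟩, L⟩
  · exact hg (FreeGroup.toWord_eq_nil_iff.1 hw)
  · rw [hw] at hred
    obtain ⟨t, -, hpos, -⟩ := exists_leading_coefficient i b L hred
    rw [← hw, FreeGroup.mk_toWord, h] at hpos
    simp at hpos

end SquareZeroMagnus


/-- **Proposition 4.7.**
Let `F` be a free group of finite rank at least 2, `B ∈ F` nontrivial and not a proper
power, `N = ⟪B⟫` its normal closure.  Then `N/[F,N]` is infinite cyclic: there is a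
surjective group homomorphism `φ : N → ℤ` with kernel `[F,N]` satisfying
`φ(u · B^c · u⁻¹) = c` for all `u ∈ F`, `c ∈ ℤ`.  In particular an element
`∏ uᵢ B^(cᵢ) uᵢ⁻¹` lies in `[F,N]` if and only if `∑ cᵢ = 0`. -/
theorem normalClosure_quot_commutatorWithFree_infinite_cyclic
    (r : ℕ) (hr : 2 ≤ r) (B : FreeGroup (Fin r)) (hB : B ≠ 1)
    (hBnp : ∀ (w : FreeGroup (Fin r)) (k : ℤ), B = w ^ k → |k| ≤ 1) :
    ∃ φ : (Subgroup.normalClosure {B} : Subgroup (FreeGroup (Fin r))) →* Multiplicative ℤ,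
      Function.Surjective φ ∧
      φ.ker = (⁅(⊤ : Subgroup (FreeGroup (Fin r))), Subgroup.normalClosure {B}⁆).subgroupOf
        (Subgroup.normalClosure {B}) ∧
      (∀ (u : FreeGroup (Fin r)) (c : ℤ) (hu : u * B ^ c * u⁻¹ ∈ Subgroup.normalClosure {B}),
        φ ⟨u * B ^ c * u⁻¹, hu⟩ = Multiplicative.ofAdd c) ∧
      (∀ (k : ℕ) (u : Fin k → FreeGroup (Fin r)) (c : Fin k → ℤ),
        (List.ofFn fun i => u i * B ^ (c i) * (u i)⁻¹).prod ∈
            ⁅(⊤ : Subgroup (FreeGroup (Fin r))), Subgroup.normalClosure {B}⁆ ↔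
          ∑ i, c i = 0) := by
  exact exists_normalClosure_hom_of_zpow_mem_commutator fun _ hc =>
    (SquareZeroMagnus.orderFiltration (Fin r)).eq_zero_of_zpow_mem_commutator_normalClosure
      SquareZeroMagnus.eq_zero_of_forall_mem_orderFiltration
      SquareZeroMagnus.mem_orderFiltration_of_nsmul_mem (SquareZeroMagnus.rep (Fin r))
      SquareZeroMagnus.rep_mem_congruenceSubgroup (SquareZeroMagnus.rep_ne_one hB) hc
end

section
/- (a) If x ∈ N and y, v ∈ F₂ satisfy the quadratic equation x·y·x^{−δ}·y⁻¹ = v·B^{θ}·v⁻¹·B in F₂, then in the group ring ℤ[π] the first derived equation holds: (1 − δ·p(y))·q_N(x) = 1 + θ·p(v). (b) For any v̄ ∈ π, every pair (x̃, ȳ) ∈ ℤ[π] × π satisfying (1 − δ·ȳ)·x̃ = 1 + θ·v̄ in ℤ[π] has the property that there exists k ∈ ℤ with v̄ = ȳ^k and θ·δ^k = −1. (Theorem 5.1.) -/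
namespace Stmt8

/-- The free group of rank 2, `F₂ = ⟨α, β⟩`. -/
abbrev F2 : Type := FreeGroup (Fin 2)

/-- The generator `α`. -/
def fα : F2 := FreeGroup.of 0

/-- The generator `β`. -/
def fβ : F2 := FreeGroup.of 1

/-- The relator `B = αβα^{-ε}β⁻¹`. -/
def B (ε : ℤˣ) : F2 := fα * fβ * fα ^ (-(ε : ℤ)) * fβ⁻¹

/-- The normal closure `N = ⟪B⟫`. -/
abbrev N (ε : ℤˣ) : Subgroup F2 := Subgroup.normalClosure {B ε}

/-- The surface group `π = F₂/N`. -/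
abbrev piGrp (ε : ℤˣ) := F2 ⧸ N ε

/-- The canonical projection `p : F₂ → π`. -/
abbrev p (ε : ℤˣ) : F2 →* piGrp ε := QuotientGroup.mk' (N ε)

/-- A function `f` on a group with `f (y g) = δ f g` extends additively to the integral group ring
and kills the right multiples of `1 - δ y`; if `1 + θ v` is such a multiple and `f 1 = 1`, then
`1 + θ f v = 0`. -/
theorem one_add_eq_zero_of_semiinvariant {G R : Type*} [Group G] [CommRing R] (δ θ : ℤˣ)
    {x : MonoidAlgebra ℤ G} {y v : G} {f : G → R}
    (hf : ∀ g, f (y * g) = ((δ : ℤ) : R) * f g) (hf1 : f 1 = 1)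
    (h : ((1 : MonoidAlgebra ℤ G) -
        ((δ : ℤ) : MonoidAlgebra ℤ G) * MonoidAlgebra.of ℤ G y) * x =
      1 + ((θ : ℤ) : MonoidAlgebra ℤ G) * MonoidAlgebra.of ℤ G v) :
    1 + ((θ : ℤ) : R) * f v = 0 := by
  let φ : MonoidAlgebra ℤ G →+ R := MonoidAlgebra.liftNC (Int.castAddHom R) f
  have hφ (g : G) (a : ℤ) : φ (MonoidAlgebra.single g a) = (a : R) * f g := by
    simp [φ]
  have hφz (a : ℤ) (z : MonoidAlgebra ℤ G) :
      φ ((a : MonoidAlgebra ℤ G) * z) = (a : R) * φ z := by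
    rw [← zsmul_eq_mul, map_zsmul, zsmul_eq_mul]
  have hy (z : MonoidAlgebra ℤ G) :
      φ (MonoidAlgebra.of ℤ G y * z) = ((δ : ℤ) : R) * φ z := by
    induction z using MonoidAlgebra.induction_linear with
    | zero => simp
    | add a b ha hb => rw [mul_add, map_add, map_add, ha, hb, mul_add]
    | single g a =>
      rw [MonoidAlgebra.of_apply, MonoidAlgebra.single_mul_single, hφ, hφ, hf, one_mul,
        mul_left_comm]
  have hδ : ((δ : ℤ) : R) * ((δ : ℤ) : R) = 1 := by
    rw [← Int.cast_mul, Int.units_coe_mul_self, Int.cast_one]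
  have key := congrArg φ h
  rw [sub_mul, one_mul, map_sub, mul_assoc, hφz, hy, map_add, hφz, MonoidAlgebra.of_apply, hφ,
    MonoidAlgebra.one_def, hφ, hf1, ← mul_assoc, hδ] at key
  simpa using key.symm

/-- In an integral group ring, with signs `δ` and `θ`, if `1 + θ v` is a right multiple of
`1 - δ y` then `v` is a power `y ^ k` with `θ δ ^ k = -1`. -/
theorem exists_eq_zpow_of_one_sub_mul_eq {G : Type*} [Group G] (δ θ : ℤˣ)
    {x : MonoidAlgebra ℤ G} {y v : G}
    (h : ((1 : MonoidAlgebra ℤ G) -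
        ((δ : ℤ) : MonoidAlgebra ℤ G) * MonoidAlgebra.of ℤ G y) * x =
      1 + ((θ : ℤ) : MonoidAlgebra ℤ G) * MonoidAlgebra.of ℤ G v) :
    ∃ k : ℤ, v = y ^ k ∧ θ * δ ^ k = -1 := by
  classical
  by_cases hord : ∀ n : ℤ, y ^ n = 1 → δ ^ n = 1
  · let f : G → ℤ := fun g => if hg : ∃ k : ℤ, g = y ^ k then ((δ ^ hg.choose : ℤˣ) : ℤ) else 0
    have hfz (k : ℤ) : f (y ^ k) = ((δ ^ k : ℤˣ) : ℤ) := by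
      have hg : ∃ j : ℤ, y ^ k = y ^ j := ⟨k, rfl⟩
      have : δ ^ (hg.choose - k) = 1 := hord _ <| by
        rw [zpow_sub, ← hg.choose_spec, mul_inv_cancel]
      rw [zpow_sub, mul_inv_eq_one] at this
      simp only [f, dif_pos hg, this]
    have hf0 (g : G) (hg : ¬ ∃ k : ℤ, g = y ^ k) : f g = 0 := dif_neg hg
    have hv := one_add_eq_zero_of_semiinvariant δ θ (f := f) (fun g => by
      by_cases hg : ∃ k : ℤ, g = y ^ k
      · obtain ⟨k, rfl⟩ := hg
        rw [← zpow_one_add, hfz, hfz, zpow_one_add]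
        simp
      · rw [hf0 g hg, hf0, mul_zero]
        rintro ⟨k, hk⟩
        exact hg ⟨-1 + k, by rw [zpow_add, ← hk]; simp⟩) (by simpa using hfz 0) h
    by_cases hg : ∃ k : ℤ, v = y ^ k
    · obtain ⟨k, rfl⟩ := hg
      refine ⟨k, rfl, Units.ext ?_⟩
      rw [hfz] at hv
      push_cast at hv ⊢
      linarith
    · simp [hf0 v hg] at hv
  · push Not at hord
    obtain ⟨n, hn, hδn⟩ := hord
    have hδn' : δ ^ n = -1 := (Int.units_eq_one_or _).resolve_left hδn
    have hodd (u : ℤˣ) : ((u : ℤ) : ZMod 2) = 1 := by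
      rcases Int.units_eq_one_or u with rfl | rfl
      · simp
      · decide
    have hv := one_add_eq_zero_of_semiinvariant (R := ZMod 2) δ θ
      (f := fun g => if g ∈ Subgroup.zpowers y then 1 else 0) (fun g => by
        simp [hodd, Subgroup.mul_mem_cancel_left _ (Subgroup.mem_zpowers y)])
      (if_pos (one_mem _)) h
    have hmem : v ∈ Subgroup.zpowers y := by
      by_contra hg
      simp [hg] at hv
    obtain ⟨k, rfl⟩ := Subgroup.mem_zpowers_iff.mp hmem
    rcases Int.units_eq_one_or (θ * δ ^ k) with hk | hk
    · exact ⟨k + n, by rw [zpow_add, hn, mul_one], by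
        rw [zpow_add, ← mul_assoc, hk, hδn', one_mul]⟩
    · exact ⟨k, rfl, hk⟩

/-- A homomorphism on a normal closure `⟪b⟫` sending `u b u⁻¹` to the class of `u` intertwines
conjugation with left multiplication in the group ring of the quotient. -/
theorem toAdd_map_conj_of_map_conj {G : Type*} [Group G] (b : G)
    (q : Subgroup.normalClosure {b} →*
      Multiplicative (MonoidAlgebra ℤ (G ⧸ Subgroup.normalClosure {b})))
    (hq : ∀ (u : G) (hu : u * b * u⁻¹ ∈ Subgroup.normalClosure {b}),
      q ⟨u * b * u⁻¹, hu⟩ = Multiplicative.ofAdd (MonoidAlgebra.of ℤ _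
        (QuotientGroup.mk' (Subgroup.normalClosure {b}) u)))
    (y : G) (n : Subgroup.normalClosure {b}) :
    (q (MulAut.conjNormal y n)).toAdd =
      MonoidAlgebra.of ℤ _ (QuotientGroup.mk' (Subgroup.normalClosure {b}) y) * (q n).toAdd := by
  let r := (AddMonoidHom.toMultiplicative (AddMonoidHom.mulLeft (MonoidAlgebra.of ℤ _
    (QuotientGroup.mk' (Subgroup.normalClosure {b}) y)))).comp q
  let q' := q.comp (MulAut.conjNormal y).toMonoidHom
  have hle : Subgroup.normalClosure {b} ≤
      (q'.eqLocus r).map (Subgroup.normalClosure {b}).subtype := by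
    refine (Subgroup.closure_le _).2 fun z hz => ?_
    have hz' : z ∈ Subgroup.normalClosure {b} := Subgroup.subset_closure hz
    obtain ⟨u, rfl⟩ : ∃ u, u * b * u⁻¹ = z := by
      simpa [Group.mem_conjugatesOfSet_iff, isConj_iff] using hz
    refine ⟨⟨_, hz'⟩, ?_, rfl⟩
    have e : y * (u * b * u⁻¹) * y⁻¹ = (y * u) * b * (y * u)⁻¹ := by group
    have hyz : (y * u) * b * (y * u)⁻¹ ∈ Subgroup.normalClosure {b} :=
      e ▸ Subgroup.normalClosure_normal.conj_mem _ hz' y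
    have he : MulAut.conjNormal y ⟨u * b * u⁻¹, hz'⟩ =
        (⟨_, hyz⟩ : Subgroup.normalClosure {b}) := Subtype.ext (by simpa using e)
    change q (MulAut.conjNormal y ⟨u * b * u⁻¹, hz'⟩) =
      Multiplicative.ofAdd (MonoidAlgebra.of ℤ _
        (QuotientGroup.mk' (Subgroup.normalClosure {b}) y) * (q ⟨u * b * u⁻¹, hz'⟩).toAdd)
    rw [he, hq, hq, toAdd_ofAdd, map_mul, map_mul]
  obtain ⟨m, hm, hmn⟩ := hle n.2
  obtain rfl : m = n := Subtype.ext hmn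
  exact congrArg Multiplicative.toAdd hm

/-- **Theorem 5.1.**
(a) If `x ∈ N` and `y, v ∈ F₂` satisfy the quadratic equation
`x y x^{-δ} y⁻¹ = v B^θ v⁻¹ B` in `F₂`, then in `ℤ[π]` the first derived equation
`(1 - δ·ȳ)·q_N(x) = 1 + θ·v̄` holds, where `q_N` is the homomorphism `N → (ℤ[π],+)`
determined by `q_N(uBu⁻¹) = ū`.
(b) Every solution `(x̃, ȳ)` of `(1 - δ·ȳ)·x̃ = 1 + θ·v̄` in `ℤ[π] × π` satisfies
`v̄ = ȳ^k` and `θ·δ^k = -1` for some `k ∈ ℤ`. -/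
theorem statement (ε δ θ : ℤˣ) :
    (∀ qN : (N ε : Subgroup F2) →* Multiplicative (MonoidAlgebra ℤ (piGrp ε)),
      (∀ (u : F2) (hu : u * B ε * u⁻¹ ∈ N ε),
        qN ⟨u * B ε * u⁻¹, hu⟩ =
          Multiplicative.ofAdd (MonoidAlgebra.of ℤ (piGrp ε) (p ε u))) →
      ∀ (x y v : F2) (hx : x ∈ N ε),
        x * y * x ^ (-(δ : ℤ)) * y⁻¹ = v * B ε ^ (θ : ℤ) * v⁻¹ * B ε →
        ((1 : MonoidAlgebra ℤ (piGrp ε)) -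
            ((δ : ℤ) : MonoidAlgebra ℤ (piGrp ε)) * MonoidAlgebra.of ℤ (piGrp ε) (p ε y)) *
            Multiplicative.toAdd (qN ⟨x, hx⟩) =
          1 + ((θ : ℤ) : MonoidAlgebra ℤ (piGrp ε)) * MonoidAlgebra.of ℤ (piGrp ε) (p ε v)) ∧
    (∀ (xt : MonoidAlgebra ℤ (piGrp ε)) (yb vb : piGrp ε),
      ((1 : MonoidAlgebra ℤ (piGrp ε)) -
          ((δ : ℤ) : MonoidAlgebra ℤ (piGrp ε)) * MonoidAlgebra.of ℤ (piGrp ε) yb) * xt =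
        1 + ((θ : ℤ) : MonoidAlgebra ℤ (piGrp ε)) * MonoidAlgebra.of ℤ (piGrp ε) vb →
      ∃ k : ℤ, vb = yb ^ k ∧ θ * δ ^ k = -1) := by
  refine ⟨fun qN hq x y v hx h => ?_, fun xt yb vb h => exists_eq_zpow_of_one_sub_mul_eq δ θ h⟩
  have hB : B ε ∈ N ε := Subgroup.subset_normalClosure rfl
  have conj := toAdd_map_conj_of_map_conj (B ε) qN hq
  have hqB : (qN ⟨B ε, hB⟩).toAdd = 1 := by
    have := hq 1 (by simpa using hB)
    simp only [one_mul, inv_one, mul_one, map_one] at this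
    exact congrArg Multiplicative.toAdd this
  have key : ⟨x, hx⟩ * MulAut.conjNormal y (⟨x, hx⟩ ^ (-(δ : ℤ)) : N ε) =
      MulAut.conjNormal v (⟨B ε, hB⟩ ^ (θ : ℤ) : N ε) * ⟨B ε, hB⟩ :=
    Subtype.ext (by simpa [-map_zpow, -zpow_neg, mul_assoc] using h)
  have key' := congrArg (fun z => (qN z).toAdd) key
  simp only [map_mul qN, toAdd_mul] at key'
  rw [conj, conj, map_zpow qN, map_zpow qN, toAdd_zpow, toAdd_zpow, hqB,
    mul_smul_comm, mul_smul_comm, mul_one, neg_smul, zsmul_eq_mul, zsmul_eq_mul] at key'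
  rw [sub_mul, one_mul, mul_assoc, sub_eq_add_neg, add_comm (1 : MonoidAlgebra ℤ (piGrp ε))]
  exact key'

end Stmt8
end
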